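/- Let N ≥ 3, μ ∈ (0, μ₀) with μ₀ = (N-2)²/4, and let V ∈ C^γ_loc(ℝ^N∖{0}) (γ ∈ (0,1)) be a positive potential satisfying |x|^{-2} - c₅ ≤ V(x) ≤ |x|^{-2} for all x ∈ ℝ^N∖{0}, for some c₅ > 0, and additionally lim_{|x|→+∞} V(x)|x|² = ν for some ν ∈ (0,1). Let u_k be the minimal positive classical solution of -Δu - μVu = 0 in ℝ^N∖{0} satisfying the dμ-distributional identity with constant k > 0. Then for every μ' ∈ (νμ, μ) there exists c₆ > 0 such that u_k(x) ≤ c₆|x|^{τ₋(μ')} for all x ∈ ℝ^N with |x| ≥ 1. -/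

import Mathlib

open Filter MeasureTheory Metric

noncomputable section

/-- Euclidean space ℝ^N. -/
abbrev Euc (N : ℕ) : Type := EuclideanSpace ℝ (Fin N)

/-- The Laplacian of `u` at `x`, as the sum of the pure second derivatives in the
coordinate directions. -/
def lap {N : ℕ} (u : Euc N → ℝ) (x : Euc N) : ℝ :=
  ∑ i : Fin N, fderiv ℝ (fun y => fderiv ℝ u y (EuclideanSpace.single i 1)) x
    (EuclideanSpace.single i 1)

/-- μ₀ = (N-2)²/4. -/
def mu0 (N : ℕ) : ℝ := ((N : ℝ) - 2) ^ 2 / 4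

/-- τ₋(μ) = -(N-2)/2 - √(μ₀-μ). -/
def tauMinus (N : ℕ) (μ : ℝ) : ℝ := -((N : ℝ) - 2) / 2 - Real.sqrt (mu0 N - μ)

/-- τ₊(μ) = -(N-2)/2 + √(μ₀-μ). -/
def tauPlus (N : ℕ) (μ : ℝ) : ℝ := -((N : ℝ) - 2) / 2 + Real.sqrt (mu0 N - μ)

/-- Surface area of the unit sphere in ℝ^N, i.e. N times the volume of the unit ball. -/
def sphereArea (N : ℕ) : ℝ := N * (volume (ball (0 : Euc N) 1)).toReal

/-- The normalizing constant c_μ: 2√(μ₀-μ)|𝕊^{N-1}| for μ < μ₀ and |𝕊^{N-1}| for μ = μ₀. -/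
def cMu (N : ℕ) (μ : ℝ) : ℝ :=
  if μ < mu0 N then 2 * Real.sqrt (mu0 N - μ) * sphereArea N else sphereArea N

/-- The normalizing constant c_N = ((N-2)|𝕊^{N-1}|)⁻¹ of the fundamental solution of -Δ. -/
def cN (N : ℕ) : ℝ := (((N : ℝ) - 2) * sphereArea N)⁻¹

/-- The singular profile Φ_μ: |x|^{τ₋(μ)} for μ < μ₀ and |x|^{-(N-2)/2}(-ln|x|) for μ = μ₀. -/
def PhiFun (N : ℕ) (μ : ℝ) (x : Euc N) : ℝ :=
  if μ < mu0 N then ‖x‖ ^ tauMinus N μ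
  else ‖x‖ ^ (-((N : ℝ) - 2) / 2) * (-Real.log ‖x‖)

/-- The adjoint operator L*_μ ξ(x) = -Δξ(x) - 2τ₊(μ)|x|⁻² x·∇ξ(x). -/
def LstarMu (N : ℕ) (μ : ℝ) (ξ : Euc N → ℝ) (x : Euc N) : ℝ :=
  -lap ξ x - 2 * tauPlus N μ / ‖x‖ ^ 2 * fderiv ℝ ξ x x

/-- The adjoint operator L*_{μV} ξ = L*_μ ξ - μ(V - |x|⁻²)ξ. -/
def LstarMuV (N : ℕ) (μ : ℝ) (V ξ : Euc N → ℝ) (x : Euc N) : ℝ :=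
  LstarMu N μ ξ x - μ * (V x - ‖x‖ ^ (-2 : ℝ)) * ξ x

/-- A compactly supported C^{1,1} test function: compactly supported, differentiable,
with Lipschitz gradient. -/
def IsC11c {N : ℕ} (ξ : Euc N → ℝ) : Prop :=
  HasCompactSupport ξ ∧ Differentiable ℝ ξ ∧ ∃ L : NNReal, LipschitzWith L (fderiv ℝ ξ)

/-- The dμ-distributional identity with constant `k`. -/
def DistribIdentity (N : ℕ) (μ : ℝ) (V u : Euc N → ℝ) (k : ℝ) : Prop :=
  ∀ ξ : Euc N → ℝ, IsC11c ξ →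
    ∫ x : Euc N, u x * LstarMuV N μ V ξ x * ‖x‖ ^ tauPlus N μ = cMu N μ * k * ξ 0

/-- `u` is a classical solution of -Δu - μVu = 0 in ℝ^N∖{0}. -/
def IsSolution (N : ℕ) (μ : ℝ) (V u : Euc N → ℝ) : Prop :=
  ContDiffOn ℝ 2 u {x : Euc N | x ≠ 0} ∧
  ∀ x : Euc N, x ≠ 0 → -lap u x - μ * V x * u x = 0

/-- `f` is locally γ-Hölder continuous on `s`. -/
def LocHolderOn {N : ℕ} (γ : ℝ) (s : Set (Euc N)) (f : Euc N → ℝ) : Prop :=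
  ∀ x ∈ s, ∃ ε > 0, ∃ C > 0, ∀ y ∈ ball x ε ∩ s, ∀ z ∈ ball x ε ∩ s,
    |f y - f z| ≤ C * dist y z ^ γ

/-- The filter `‖x‖ → +∞` on ℝ^N. -/
def normAtTop (N : ℕ) : Filter (Euc N) := comap norm atTop

/-- Assumption (V): V is locally Hölder and positive on ℝ^N∖{0},
0 ≤ V(x) - |x|⁻² ≤ c₀, and limsup_{|x|→∞} V(x)|x|² = α. -/
def AssumpV (N : ℕ) (V : Euc N → ℝ) (α : ℝ) : Prop :=
  (∃ γ : ℝ, 0 < γ ∧ γ < 1 ∧ LocHolderOn γ {x : Euc N | x ≠ 0} V) ∧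
  (∀ x : Euc N, x ≠ 0 → 0 < V x) ∧
  (∃ c₀ : ℝ, 0 < c₀ ∧ ∀ x : Euc N, x ≠ 0 →
    0 ≤ V x - ‖x‖ ^ (-2 : ℝ) ∧ V x - ‖x‖ ^ (-2 : ℝ) ≤ c₀) ∧
  limsup (fun x : Euc N => V x * ‖x‖ ^ 2) (normAtTop N) = α

/-- Assumption (Ṽ): V is locally Hölder and positive on ℝ^N∖{0},
0 ≤ V(x) - |x|⁻² ≤ c₀, and liminf_{|x|→∞} V(x)|x|² = β. -/
def AssumpVtilde (N : ℕ) (V : Euc N → ℝ) (β : ℝ) : Prop :=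
  (∃ γ : ℝ, 0 < γ ∧ γ < 1 ∧ LocHolderOn γ {x : Euc N | x ≠ 0} V) ∧
  (∀ x : Euc N, x ≠ 0 → 0 < V x) ∧
  (∃ c₀ : ℝ, 0 < c₀ ∧ ∀ x : Euc N, x ≠ 0 →
    0 ≤ V x - ‖x‖ ^ (-2 : ℝ) ∧ V x - ‖x‖ ^ (-2 : ℝ) ≤ c₀) ∧
  liminf (fun x : Euc N => V x * ‖x‖ ^ 2) (normAtTop N) = β

/-- The potential V_ρ(x) = |x|⁻²(1 + ρ|x|²)/(1 + |x|²). -/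
def Vrho (N : ℕ) (ρ : ℝ) (x : Euc N) : ℝ :=
  ‖x‖ ^ (-2 : ℝ) * (1 + ρ * ‖x‖ ^ 2) / (1 + ‖x‖ ^ 2)

/-- Ω has C² boundary: it is the sublevel set of a C² function whose differential
does not vanish on the boundary. -/
def HasC2Boundary {N : ℕ} (Ω : Set (Euc N)) : Prop :=
  ∃ φ : Euc N → ℝ, ContDiff ℝ 2 φ ∧ Ω = {x | φ x < 0} ∧
    ∀ x ∈ frontier Ω, fderiv ℝ φ x ≠ 0

section

variable {N : ℕ}

/-- The radial function `x ↦ g (log ‖x‖)`, extended by `0` at the origin. -/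
def rad (g : ℝ → ℝ) (x : Euc N) : ℝ := if x = 0 then 0 else g (Real.log ‖x‖)

lemma rad_of_ne (g : ℝ → ℝ) {x : Euc N} (hx : x ≠ 0) : rad g x = g (Real.log ‖x‖) := if_neg hx

lemma hasFDerivAt_log_norm {x : Euc N} (hx : x ≠ 0) :
    HasFDerivAt (fun y : Euc N => Real.log ‖y‖) ((‖x‖ ^ 2)⁻¹ • innerSL ℝ x) x := by
  have h1 : HasFDerivAt (fun y : Euc N => ‖y‖ ^ 2) (2 • innerSL ℝ x) x :=
    (hasStrictFDerivAt_norm_sq x).hasFDerivAt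
  have hn : ‖x‖ ^ 2 ≠ 0 := by positivity
  have h2 := (h1.log hn).const_mul (1 / 2 : ℝ)
  refine (h2.congr_fderiv ?_).congr_of_eventuallyEq (Eventually.of_forall fun y => ?_)
  · ext v; simp [smul_smul]; ring
  · simp [Real.log_pow]

lemma rad_eventuallyEq (g : ℝ → ℝ) {x : Euc N} (hx : x ≠ 0) :
    rad g =ᶠ[nhds x] fun y => g (Real.log ‖y‖) := by
  filter_upwards [isOpen_ne.mem_nhds hx] with y hy using rad_of_ne g hy

lemma hasFDerivAt_rad {g : ℝ → ℝ} {g' : ℝ} {x : Euc N} (hx : x ≠ 0)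
    (hg : HasDerivAt g g' (Real.log ‖x‖)) :
    HasFDerivAt (rad g) (g' • (‖x‖ ^ 2)⁻¹ • innerSL ℝ x) x :=
  (hg.comp_hasFDerivAt x (hasFDerivAt_log_norm hx)).congr_of_eventuallyEq (rad_eventuallyEq g hx)

lemma contDiffAt_rad {g : ℝ → ℝ} {n : ℕ∞} (hg : ContDiff ℝ n g) {x : Euc N} (hx : x ≠ 0) :
    ContDiffAt ℝ n (rad g) x := by
  refine ContDiffAt.congr_of_eventuallyEq ?_ (rad_eventuallyEq g hx)
  exact hg.contDiffAt.comp x ((contDiffAt_norm ℝ hx).log (norm_ne_zero_iff.2 hx))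

lemma rad_eventuallyEq_zero {g : ℝ → ℝ} {t₀ : ℝ} (h0 : ∀ t ≤ t₀, g t = 0) :
    (rad g : Euc N → ℝ) =ᶠ[nhds 0] 0 := by
  filter_upwards [ball_mem_nhds (0 : Euc N) (Real.exp_pos t₀)] with x hx
  unfold rad
  split_ifs with h
  · rfl
  · apply h0
    rw [Real.log_le_iff_le_exp (by positivity)]
    simpa using (mem_ball_zero_iff.1 hx).le

lemma contDiff_rad {g : ℝ → ℝ} {n : ℕ∞} (hg : ContDiff ℝ n g) {t₀ : ℝ}
    (h0 : ∀ t ≤ t₀, g t = 0) : ContDiff ℝ n (rad g : Euc N → ℝ) := by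
  rw [contDiff_iff_contDiffAt]
  intro x
  by_cases hx : x = 0
  · subst hx
    exact contDiffAt_const.congr_of_eventuallyEq (rad_eventuallyEq_zero h0)
  · exact contDiffAt_rad hg hx

lemma hasCompactSupport_rad {g : ℝ → ℝ} {t₁ : ℝ} (h1 : ∀ t, t₁ ≤ t → g t = 0) :
    HasCompactSupport (rad g : Euc N → ℝ) := by
  refine HasCompactSupport.of_support_subset_isCompact
    (isCompact_closedBall (0 : Euc N) (Real.exp t₁)) ?_
  intro x hx
  by_contra hxx
  apply hx
  unfold rad
  split_ifs with h
  · rfl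
  · apply h1
    rw [Real.le_log_iff_exp_le (by positivity)]
    simp at hxx
    exact hxx.le

lemma measurable_rad {g : ℝ → ℝ} (hg : Measurable g) : Measurable (rad g : Euc N → ℝ) :=
  Measurable.ite (measurableSet_singleton 0) measurable_const
    (hg.comp (Real.measurable_log.comp measurable_norm))

/-- The radial Laplacian in the variable `t = log ‖x‖`. -/
lemma lap_mul_rad {a : Euc N → ℝ} {g g' : ℝ → ℝ} {g'' : ℝ} {x : Euc N} (hx : x ≠ 0)
    (hg : ∀ t, HasDerivAt g (g' t) t) (hg' : HasDerivAt g' g'' (Real.log ‖x‖))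
    (ha : ∀ᶠ y in nhds x, DifferentiableAt ℝ a y) (ha' : DifferentiableAt ℝ (fderiv ℝ a) x) :
    lap (fun y => a y * rad g y) x = rad g x * lap a x +
      2 * g' (Real.log ‖x‖) / ‖x‖ ^ 2 * fderiv ℝ a x x +
      a x * ((g'' + (N - 2) * g' (Real.log ‖x‖)) / ‖x‖ ^ 2) := by
  have hn : ‖x‖ ^ 2 ≠ 0 := by positivity
  have key : ∀ i : Fin N, fderiv ℝ (fun y => fderiv ℝ (fun y => a y * rad g y) y
      (EuclideanSpace.single i 1)) x (EuclideanSpace.single i 1) =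
      rad g x * fderiv ℝ (fun y => fderiv ℝ a y (EuclideanSpace.single i 1)) x
        (EuclideanSpace.single i 1) +
      2 * g' (Real.log ‖x‖) / ‖x‖ ^ 2 * (x i * fderiv ℝ a x (EuclideanSpace.single i 1)) +
      a x * ((g'' - 2 * g' (Real.log ‖x‖)) * (x i) ^ 2 / ‖x‖ ^ 4 + g' (Real.log ‖x‖) / ‖x‖ ^ 2) := by
    intro i
    set e : Euc N := EuclideanSpace.single i 1
    have hin : ∀ y : Euc N, inner ℝ y (EuclideanSpace.single i 1) = y i := fun y => by
      simp [EuclideanSpace.inner_single_right]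
    have hev : (fun y => fderiv ℝ (fun y => a y * rad g y) y e) =ᶠ[nhds x]
        fun y => a y * (g' (Real.log ‖y‖) * ((‖y‖ ^ 2)⁻¹ * y i)) +
          g (Real.log ‖y‖) * fderiv ℝ a y e := by
      filter_upwards [ha, isOpen_ne.mem_nhds hx] with y hy hy0
      have := (hy.hasFDerivAt.mul (hasFDerivAt_rad hy0 (hg (Real.log ‖y‖)))).fderiv
      have h2 : (fun y => a y * rad g y) = a * rad g := rfl
      rw [h2, this]
      simp [e, rad_of_ne g hy0, hin]
    rw [hev.fderiv_eq]
    have d1 := ha.self_of_nhds.hasFDerivAt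
    have d2 := hg'.comp_hasFDerivAt x (hasFDerivAt_log_norm hx)
    have d3 := (hg (Real.log ‖x‖)).comp_hasFDerivAt x (hasFDerivAt_log_norm hx)
    have d4 : HasFDerivAt (fun y : Euc N => ‖y‖ ^ 2) (2 • innerSL ℝ x) x :=
      (hasStrictFDerivAt_norm_sq x).hasFDerivAt
    have d5 := (hasDerivAt_inv hn).comp_hasFDerivAt x d4
    have d6 : HasFDerivAt (fun y : Euc N => y i) (EuclideanSpace.proj i : Euc N →L[ℝ] ℝ) x :=
      (EuclideanSpace.proj i : Euc N →L[ℝ] ℝ).hasFDerivAt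
    have d7 : HasFDerivAt (fun y => fderiv ℝ a y e) (fderiv ℝ (fun y => fderiv ℝ a y e) x) x :=
      (ha'.clm_apply (differentiableAt_const e)).hasFDerivAt
    have D := (d1.mul (d2.mul (d5.mul d6))).add (d3.mul d7)
    refine (congrArg (fun L => L e) D.fderiv).trans ?_
    simp [e, rad_of_ne g hx, hin]
    field_simp
    ring
  unfold lap
  rw [Finset.sum_congr rfl fun i _ => key i, Finset.sum_add_distrib, Finset.sum_add_distrib,
    ← Finset.mul_sum, ← Finset.mul_sum, ← Finset.mul_sum, Finset.sum_add_distrib]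
  have hxs : (∑ i : Fin N, x i • (EuclideanSpace.single i 1 : Euc N)) = x := by
    have := (EuclideanSpace.basisFun (Fin N) ℝ).sum_repr x
    simpa using this
  have s1 : ∑ i : Fin N, x i * fderiv ℝ a x (EuclideanSpace.single i 1) = fderiv ℝ a x x := by
    conv_rhs => rw [← hxs]
    rw [map_sum, hxs]
    simp
  have s2 : ∑ i : Fin N, (x i) ^ 2 = ‖x‖ ^ 2 := by
    rw [EuclideanSpace.norm_sq_eq]; simp
  rw [s1, ← Finset.sum_div, ← Finset.mul_sum, s2]
  simp only [Finset.sum_const, Finset.card_univ, Fintype.card_fin, nsmul_eq_mul]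
  field_simp
  ring

lemma lap_rad {g g' : ℝ → ℝ} {g'' : ℝ} {x : Euc N} (hx : x ≠ 0)
    (hg : ∀ t, HasDerivAt g (g' t) t) (hg' : HasDerivAt g' g'' (Real.log ‖x‖)) :
    lap (rad g) x = (g'' + (N - 2) * g' (Real.log ‖x‖)) / ‖x‖ ^ 2 := by
  have := lap_mul_rad (a := fun _ => 1) hx hg hg' (Eventually.of_forall fun y =>
    differentiableAt_const _) (by simp)
  simpa [lap] using this

lemma exists_cutoff {s : Set (Euc N)} (hs : IsCompact s) :
    ∃ χ : Euc N → ℝ, (∀ n : ℕ∞, ContDiff ℝ n χ) ∧ HasCompactSupport χ ∧ ∀ x ∈ s, χ =ᶠ[nhds x] 1 := by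
  obtain ⟨R, hR0, hR⟩ := hs.isBounded.exists_pos_norm_lt
  let f : ContDiffBump (0 : Euc N) := ⟨R, R + 1, hR0, by linarith⟩
  refine ⟨f, fun _ => f.contDiff, f.hasCompactSupport, fun x hx => ?_⟩
  exact f.eventuallyEq_one_of_mem_ball (mem_ball_zero_iff.2 (hR x hx))

/-- Integration by parts in a fixed direction. -/
lemma integral_mul_lineDeriv {a b : Euc N → ℝ} (ha : ContDiff ℝ 1 a) {L : NNReal}
    (hb : LipschitzWith L b) (hbc : HasCompactSupport b) (e : Euc N) :
    ∫ x, a x * lineDeriv ℝ b x e = -∫ x, fderiv ℝ a x e * b x := by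
  obtain ⟨χ, hχ, hχc, h1⟩ := exists_cutoff hbc.isCompact
  have hac : ContDiff ℝ 1 (fun x => χ x * a x) := (hχ 1).mul ha
  obtain ⟨D, hD⟩ : ∃ D, LipschitzWith D (fun x => χ x * a x) := hac.lipschitzWith_of_hasCompactSupport (hχc.mul_right) one_ne_zero
  have key := hD.integral_lineDeriv_mul_eq hb hbc e (μ := volume)
  have e1 : ∀ x, lineDeriv ℝ (fun x => χ x * a x) x e * b x = fderiv ℝ a x e * b x := by
    intro x
    by_cases hx : x ∈ tsupport b
    · have : (fun x => χ x * a x) =ᶠ[nhds x] a := by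
        filter_upwards [h1 x hx] with y hy; simp [hy]
      rw [(hac.differentiable one_ne_zero x).lineDeriv_eq_fderiv, this.fderiv_eq]
    · simp [image_eq_zero_of_notMem_tsupport hx]
  have e2 : ∀ x, lineDeriv ℝ b x (-e) * (χ x * a x) = -(a x * lineDeriv ℝ b x e) := by
    intro x
    rw [lineDeriv_neg]
    by_cases hx : x ∈ tsupport b
    · rw [show χ x = 1 from (h1 x hx).self_of_nhds]; ring
    · have : lineDeriv ℝ b x e = 0 := by
        rw [(notMem_tsupport_iff_eventuallyEq.1 hx).lineDeriv_eq]
        simp [lineDeriv]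
      simp [this]
  rw [← integral_congr_ae (Eventually.of_forall e1), key,
    integral_congr_ae (Eventually.of_forall e2), integral_neg, neg_neg]

lemma IsC11c.ae_differentiableAt {ξ : Euc N → ℝ} (h : IsC11c ξ) :
    ∀ᵐ x, DifferentiableAt ℝ (fderiv ℝ ξ) x := by
  obtain ⟨L, hL⟩ := h.2.2
  exact hL.ae_differentiableAt

lemma IsC11c.of_contDiff {ξ : Euc N → ℝ} (h : ContDiff ℝ 2 ξ) (hc : HasCompactSupport ξ) :
    IsC11c ξ := by
  refine ⟨hc, h.differentiable two_ne_zero, ?_⟩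
  exact (h.fderiv_right (m := 1) (by norm_num [one_add_one_eq_two])).lipschitzWith_of_hasCompactSupport
    (hc.fderiv ℝ) one_ne_zero

lemma IsC11c.contDiff_one {ξ : Euc N → ℝ} (h : IsC11c ξ) : ContDiff ℝ 1 ξ := by
  obtain ⟨L, hL⟩ := h.2.2
  exact contDiff_one_iff_fderiv.2 ⟨h.2.1, hL.continuous⟩

lemma IsC11c.exists_lipschitz {ξ : Euc N → ℝ} (h : IsC11c ξ) : ∃ L, LipschitzWith L ξ :=
  h.contDiff_one.lipschitzWith_of_hasCompactSupport h.1 one_ne_zero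

lemma measurable_lap (u : Euc N → ℝ) : Measurable (lap u) :=
  Finset.measurable_sum _ fun _ _ => measurable_fderiv_apply_const ℝ _ _

lemma lap_congr {u v : Euc N → ℝ} {x : Euc N} (h : u =ᶠ[nhds x] v) : lap u x = lap v x := by
  unfold lap
  refine Finset.sum_congr rfl fun i _ => ?_
  have : (fun y => fderiv ℝ u y (EuclideanSpace.single i 1)) =ᶠ[nhds x]
      fun y => fderiv ℝ v y (EuclideanSpace.single i 1) := by
    filter_upwards [h.eventuallyEq_nhds] with y hy
    rw [hy.fderiv_eq]
  rw [this.fderiv_eq]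

lemma lap_zero_of_eventuallyEq {u : Euc N → ℝ} {x : Euc N} (h : u =ᶠ[nhds x] 0) :
    lap u x = 0 := by
  rw [lap_congr h]
  simp [lap]

lemma lap_eq_zero_of_notMem_tsupport {u : Euc N → ℝ} {x : Euc N} (h : x ∉ tsupport u) :
    lap u x = 0 :=
  lap_zero_of_eventuallyEq (notMem_tsupport_iff_eventuallyEq.1 h)

lemma lipschitz_partial {ξ : Euc N → ℝ} {L : NNReal} (hL : LipschitzWith L (fderiv ℝ ξ))
    {e : Euc N} (he : ‖e‖ = 1) : LipschitzWith L (fun y => fderiv ℝ ξ y e) := by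
  refine LipschitzWith.of_dist_le_mul fun x y => ?_
  rw [dist_eq_norm, ← sub_apply]
  refine (ContinuousLinearMap.le_opNorm _ _).trans ?_
  rw [he, mul_one, ← dist_eq_norm]
  exact hL.dist_le_mul x y

lemma abs_lap_le {ξ : Euc N → ℝ} {L : NNReal} (hL : LipschitzWith L (fderiv ℝ ξ)) (x : Euc N) :
    |lap ξ x| ≤ N * L := by
  unfold lap
  refine (Finset.abs_sum_le_sum_abs _ _).trans ?_
  refine (Finset.sum_le_card_nsmul _ _ (L : ℝ) fun i _ => ?_).trans (by simp)
  have hl := lipschitz_partial hL (e := EuclideanSpace.single i 1) (by simp)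
  have := norm_fderiv_le_of_lipschitz ℝ (x₀ := x) hl
  refine ((fderiv ℝ (fun y => fderiv ℝ ξ y (EuclideanSpace.single i 1)) x).le_opNorm
    (EuclideanSpace.single i 1)).trans ?_
  simpa using this

lemma IsC11c.exists_bound {ξ : Euc N → ℝ} (h : IsC11c ξ) :
    ∃ C : ℝ, 0 ≤ C ∧ ∀ x, |ξ x| ≤ C ∧ ‖fderiv ℝ ξ x‖ ≤ C ∧ |lap ξ x| ≤ C := by
  obtain ⟨L, hL⟩ := h.2.2
  obtain ⟨C1, h1⟩ := h.1.exists_bound_of_continuous h.2.1.continuous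
  obtain ⟨C2, h2⟩ := (h.1.fderiv ℝ).exists_bound_of_continuous hL.continuous
  refine ⟨max (max C1 C2) (N * L), (by positivity : (0:ℝ) ≤ N * L).trans (le_max_right _ _),
    fun x => ⟨(h1 x).trans ?_, (h2 x).trans ?_, (abs_lap_le hL x).trans ?_⟩⟩ <;> simp

lemma IsC11c.integrable_mul_lap {ξ a : Euc N → ℝ} (h : IsC11c ξ)
    (ha : LocallyIntegrable a volume) : Integrable (fun x => a x * lap ξ x) := by
  obtain ⟨C, -, hC⟩ := h.exists_bound
  have h1 : IntegrableOn a (tsupport ξ) := ha.integrableOn_isCompact h.1.isCompact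
  have h2 : IntegrableOn (fun x => a x * lap ξ x) (tsupport ξ) :=
    h1.mul_bdd (c := C) (measurable_lap ξ).aestronglyMeasurable
      (Eventually.of_forall fun x => by simpa using (hC x).2.2)
  rwa [integrableOn_iff_integrable_of_support_subset] at h2
  intro x hx
  by_contra hxx
  exact hx (by simp [lap_eq_zero_of_notMem_tsupport hxx])

/-- First Green identity against a `C^{1,1}` compactly supported function. -/
lemma IsC11c.integral_mul_lap {a η : Euc N → ℝ} (h : IsC11c η) (ha : ContDiff ℝ 1 a) :
    ∫ x, a x * lap η x = -∫ x, ∑ i : Fin N, fderiv ℝ a x (EuclideanSpace.single i 1) *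
      fderiv ℝ η x (EuclideanSpace.single i 1) := by
  obtain ⟨L, hL⟩ := h.2.2
  have hlip : ∀ i : Fin N, LipschitzWith L (fun y => fderiv ℝ η y (EuclideanSpace.single i 1)) :=
    fun i => lipschitz_partial hL (by simp)
  have hae : ∀ᵐ x, a x * lap η x = ∑ i : Fin N, a x *
      lineDeriv ℝ (fun y => fderiv ℝ η y (EuclideanSpace.single i 1)) x
        (EuclideanSpace.single i 1) := by
    filter_upwards [h.ae_differentiableAt] with x hx
    rw [lap, Finset.mul_sum]
    refine Finset.sum_congr rfl fun i _ => ?_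
    rw [(hx.clm_apply (differentiableAt_const _)).lineDeriv_eq_fderiv]
  have hcs : ∀ i : Fin N, HasCompactSupport (fun y => fderiv ℝ η y (EuclideanSpace.single i 1)) :=
    fun i => h.1.fderiv_apply ℝ _
  rw [integral_congr_ae hae, integral_finsetSum, integral_finsetSum, ← Finset.sum_neg_distrib]
  · exact Finset.sum_congr rfl fun i _ => integral_mul_lineDeriv ha (hlip i) (hcs i) _
  · intro i _
    refine Continuous.integrable_of_hasCompactSupport ?_ (hcs i).mul_left
    exact ((ha.continuous_fderiv one_ne_zero).clm_apply continuous_const).mul (hlip i).continuous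
  · intro i _
    have hi : LocallyIntegrable (fun x => lineDeriv ℝ
      (fun y => fderiv ℝ η y (EuclideanSpace.single i 1)) x (EuclideanSpace.single i 1)) volume :=
      (hlip i).locallyIntegrable_lineDeriv _
    have h1 : Integrable (fun x => lineDeriv ℝ
      (fun y => fderiv ℝ η y (EuclideanSpace.single i 1)) x (EuclideanSpace.single i 1)) := by
      rw [← integrableOn_iff_integrable_of_support_subset (s := tsupport η)]
      · exact hi.integrableOn_isCompact h.1.isCompact
      · intro x hx
        by_contra hxx
        apply hx
        have h0 : (fun y => fderiv ℝ η y (EuclideanSpace.single i 1)) =ᶠ[nhds x] fun _ => 0 := by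
          filter_upwards [(notMem_tsupport_iff_eventuallyEq.1 hxx).eventuallyEq_nhds] with y hy
          rw [hy.fderiv_eq]; simp
        change lineDeriv ℝ _ _ _ = 0
        rw [h0.lineDeriv_eq]
        simp [lineDeriv]
    obtain ⟨χ, hχ, hχc, hχ1⟩ := exists_cutoff h.1.isCompact
    obtain ⟨C, hC⟩ := (hχc.mul_right (f' := a)).exists_bound_of_continuous
      ((hχ 1).continuous.mul ha.continuous)
    refine (h1.bdd_mul (c := C) (f := fun x => χ x * a x)
      ((hχ 1).continuous.mul ha.continuous).aestronglyMeasurable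
      (Eventually.of_forall hC)).congr (Eventually.of_forall fun x => ?_)
    by_cases hx : x ∈ tsupport η
    · have := (hχ1 x hx).self_of_nhds
      simp_all
    · have h0 : (fun y => fderiv ℝ η y (EuclideanSpace.single i 1)) =ᶠ[nhds x] fun _ => 0 := by
        filter_upwards [(notMem_tsupport_iff_eventuallyEq.1 hx).eventuallyEq_nhds] with y hy
        rw [hy.fderiv_eq]; simp
      have : lineDeriv ℝ (fun y => fderiv ℝ η y (EuclideanSpace.single i 1)) x
          (EuclideanSpace.single i 1) = 0 := by
        rw [h0.lineDeriv_eq]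
        simp [lineDeriv]
      simp [this]

/-- Green's second identity. -/
lemma IsC11c.integral_mul_lap_comm {a η : Euc N → ℝ} (h : IsC11c η) (ha : IsC11c a) :
    ∫ x, a x * lap η x = ∫ x, lap a x * η x := by
  rw [h.integral_mul_lap ha.contDiff_one]
  simp_rw [mul_comm (lap a _)]
  rw [ha.integral_mul_lap h.contDiff_one]
  simp_rw [mul_comm]

lemma locallyIntegrable_norm_rpow (hN : 1 ≤ N) {p : ℝ} (hp : -(N : ℝ) < p) :
    LocallyIntegrable (fun x : Euc N => ‖x‖ ^ p) volume := by
  refine locallyIntegrable_of_norm_le_rpow (by simpa using hN) (α := -p) (C := 1)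
    (by simp; linarith) (Eventually.of_forall fun x => ?_)
    (measurable_norm.pow_const p).aestronglyMeasurable
  rw [Real.norm_eq_abs, abs_of_nonneg (by positivity)]; simp

lemma integral_unit_mass (hN : 1 ≤ N) :
    Integrable (fun x : Euc N => (N : ℝ) * (‖x‖ ^ 2 + 1) ^ (-(N : ℝ) / 2 - 1)) ∧
    ∫ x : Euc N, (N : ℝ) * (‖x‖ ^ 2 + 1) ^ (-(N : ℝ) / 2 - 1) = sphereArea N := by
  have : Nontrivial (Euc N) := Module.nontrivial_of_finrank_pos (R := ℝ) (by simp; omega)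
  have hd : ∀ y : ℝ, 0 < y → HasDerivAt (fun y : ℝ => y ^ N * (y ^ 2 + 1) ^ (-(N : ℝ) / 2))
      (y ^ (N - 1) * ((N : ℝ) * (y ^ 2 + 1) ^ (-(N : ℝ) / 2 - 1))) y := by
    intro y hy
    have hp : (0 : ℝ) < y ^ 2 + 1 := by positivity
    have h1 := (hasDerivAt_pow N y).mul
      ((((hasDerivAt_pow 2 y).add_const 1)).rpow_const (p := -(N : ℝ) / 2) (Or.inl hp.ne'))
    refine h1.congr_deriv ?_
    have e1 : y ^ N = y ^ (N - 1) * y := by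
      rw [← pow_succ]; congr 1; omega
    have e2 : (y ^ 2 + 1) ^ (-(N : ℝ) / 2) = (y ^ 2 + 1) ^ (-(N : ℝ) / 2 - 1) * (y ^ 2 + 1) := by
      rw [← Real.rpow_add_one hp.ne']; congr 1; ring
    rw [e2, e1]
    push_cast
    ring
  have hlim : Tendsto (fun y : ℝ => y ^ N * (y ^ 2 + 1) ^ (-(N : ℝ) / 2)) atTop (nhds 1) := by
    have h0 : Tendsto (fun y : ℝ => (1 + (y ^ 2)⁻¹) ^ (-(N : ℝ) / 2)) atTop (nhds 1) := by
      have : Tendsto (fun y : ℝ => 1 + (y ^ 2)⁻¹) atTop (nhds (1 + 0)) :=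
        tendsto_const_nhds.add (tendsto_inv_atTop_zero.comp (tendsto_pow_atTop two_ne_zero))
      have h := this.rpow_const (p := -(N : ℝ) / 2) (Or.inl (by norm_num))
      simpa using h
    refine h0.congr' ?_
    filter_upwards [eventually_gt_atTop 0] with y hy
    have : y ^ 2 + 1 = y ^ 2 * (1 + (y ^ 2)⁻¹) := by field_simp
    rw [this, Real.mul_rpow (by positivity) (by positivity), ← mul_assoc, ← Real.rpow_natCast y N,
      ← Real.rpow_natCast y 2, ← Real.rpow_mul hy.le, ← Real.rpow_add hy]
    push_cast
    simp [show (N : ℝ) + 2 * (-(N : ℝ) / 2) = 0 by ring]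
  have hcont : ContinuousWithinAt (fun y : ℝ => y ^ N * (y ^ 2 + 1) ^ (-(N : ℝ) / 2))
      (Set.Ici 0) 0 := by
    refine ContinuousAt.continuousWithinAt ?_
    exact (continuousAt_id.pow N).mul ((((continuousAt_id.pow 2).add continuousAt_const)).rpow_const
      (Or.inl (by norm_num)))
  have hpos : ∀ y ∈ Set.Ioi (0 : ℝ),
      0 ≤ y ^ (N - 1) * ((N : ℝ) * (y ^ 2 + 1) ^ (-(N : ℝ) / 2 - 1)) := by
    intro y hy
    have : (0 : ℝ) < y := hy
    positivity
  have hi := integrableOn_Ioi_deriv_of_nonneg hcont hd hpos hlim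
  have hv := integral_Ioi_of_hasDerivAt_of_nonneg hcont hd hpos hlim
  refine ⟨?_, ?_⟩
  · refine (integrable_fun_norm_addHaar (E := Euc N) volume
      (f := fun y => (N : ℝ) * (y ^ 2 + 1) ^ (-(N : ℝ) / 2 - 1))).2 ?_
    simpa using hi
  · rw [integral_fun_norm_addHaar (E := Euc N) volume
      (fun y => (N : ℝ) * (y ^ 2 + 1) ^ (-(N : ℝ) / 2 - 1))]
    simp only [smul_eq_mul, finrank_euclideanSpace, Fintype.card_fin, nsmul_eq_mul]
    rw [hv]
    have : (0 : ℝ) ^ N = 0 := by simp; omega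
    simp [sphereArea, this, Measure.real]

lemma contDiff_reg (p : ℝ) {ε : ℝ} (hε : 0 < ε) {n : ℕ∞} :
    ContDiff ℝ n (fun x : Euc N => (‖x‖ ^ 2 + ε ^ 2) ^ p) := by
  refine ContDiff.rpow_const_of_ne ((contDiff_norm_sq ℝ).add contDiff_const) fun x => ?_
  positivity

lemma hasFDerivAt_reg (p : ℝ) {ε : ℝ} (hε : 0 < ε) (x : Euc N) :
    HasFDerivAt (fun x : Euc N => (‖x‖ ^ 2 + ε ^ 2) ^ p)
      ((2 * p * (‖x‖ ^ 2 + ε ^ 2) ^ (p - 1)) • innerSL ℝ x) x := by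
  have h1 : HasFDerivAt (fun y : Euc N => ‖y‖ ^ 2) (2 • innerSL ℝ x) x :=
    (hasStrictFDerivAt_norm_sq x).hasFDerivAt
  refine ((h1.add_const (ε ^ 2)).rpow_const (p := p) (Or.inl (by positivity))).congr_fderiv ?_
  ext v; simp; ring

lemma sum_coord_smul (x : Euc N) : (∑ i : Fin N, x i • (EuclideanSpace.single i 1 : Euc N)) = x := by
  simpa using (EuclideanSpace.basisFun (Fin N) ℝ).sum_repr x

lemma sum_coord_mul_apply (x : Euc N) (L : Euc N →L[ℝ] ℝ) :
    ∑ i : Fin N, x i * L (EuclideanSpace.single i 1) = L x := by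
  conv_rhs => rw [← sum_coord_smul x]
  rw [map_sum]; simp

/-- The approximate identity obtained from regularising `x / ‖x‖ ^ N`. -/
lemma tendsto_approx_identity (hN : 1 ≤ N) {ξ : Euc N → ℝ} (hξ : Continuous ξ)
    (hc : HasCompactSupport ξ) :
    Tendsto (fun ε : ℝ => ∫ x : Euc N, N * ε ^ 2 * (‖x‖ ^ 2 + ε ^ 2) ^ (-(N : ℝ) / 2 - 1) * ξ x)
      (nhdsWithin 0 (Set.Ioi 0)) (nhds (sphereArea N * ξ 0)) := by
  obtain ⟨hi, hv⟩ := integral_unit_mass hN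
  obtain ⟨C, hC⟩ := hc.exists_bound_of_continuous hξ
  have h1 : Tendsto (fun ε : ℝ => ∫ x : Euc N, (N : ℝ) * (‖x‖ ^ 2 + 1) ^ (-(N : ℝ) / 2 - 1) *
      ξ (ε • x)) (nhdsWithin 0 (Set.Ioi 0)) (nhds (∫ x : Euc N, (N : ℝ) *
      (‖x‖ ^ 2 + 1) ^ (-(N : ℝ) / 2 - 1) * ξ 0)) := by
    refine tendsto_integral_filter_of_dominated_convergence
      (fun x => (N : ℝ) * (‖x‖ ^ 2 + 1) ^ (-(N : ℝ) / 2 - 1) * C) ?_ ?_ (hi.mul_const C) ?_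
    · refine Eventually.of_forall fun ε => hi.aestronglyMeasurable.mul ?_
      exact (hξ.comp (continuous_const_smul ε)).aestronglyMeasurable
    · refine Eventually.of_forall fun ε => Eventually.of_forall fun x => ?_
      rw [norm_mul, Real.norm_of_nonneg (by positivity)]
      exact mul_le_mul_of_nonneg_left (hC _) (by positivity)
    · refine Eventually.of_forall fun x => ?_
      refine tendsto_const_nhds.mul ?_
      have : Tendsto (fun ε : ℝ => ξ (ε • x)) (nhds 0) (nhds (ξ ((0 : ℝ) • x))) :=
        (hξ.comp (continuous_id.smul continuous_const)).tendsto 0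
      rw [zero_smul] at this
      exact this.mono_left nhdsWithin_le_nhds
  rw [integral_mul_const, hv] at h1
  refine h1.congr' ?_
  filter_upwards [self_mem_nhdsWithin] with ε hε
  have hε : 0 < ε := hε
  have h2 := Measure.integral_comp_smul (volume : Measure (Euc N))
    (fun x : Euc N => N * ε ^ 2 * (‖x‖ ^ 2 + ε ^ 2) ^ (-(N : ℝ) / 2 - 1) * ξ x) ε
  have h3 : ∀ x : Euc N, N * ε ^ 2 * (‖ε • x‖ ^ 2 + ε ^ 2) ^ (-(N : ℝ) / 2 - 1) * ξ (ε • x) =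
      (ε ^ N)⁻¹ * ((N : ℝ) * (‖x‖ ^ 2 + 1) ^ (-(N : ℝ) / 2 - 1) * ξ (ε • x)) := by
    intro x
    have : ‖ε • x‖ ^ 2 + ε ^ 2 = ε ^ 2 * (‖x‖ ^ 2 + 1) := by
      rw [norm_smul, Real.norm_of_nonneg hε.le]; ring
    rw [this, Real.mul_rpow (by positivity) (by positivity), ← Real.rpow_natCast ε 2,
      ← Real.rpow_natCast ε N, ← Real.rpow_mul hε.le, ← Real.rpow_neg hε.le]
    have : ε ^ (-(N : ℝ)) = ε ^ ((2 : ℕ) : ℝ) * ε ^ (((2 : ℕ) : ℝ) * (-(N : ℝ) / 2 - 1)) := by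
      rw [← Real.rpow_add hε]; congr 1; push_cast; ring
    rw [this]; ring
  simp only [h3] at h2
  rw [integral_const_mul, finrank_euclideanSpace, Fintype.card_fin, abs_of_pos (by positivity),
    smul_eq_mul] at h2
  exact mul_left_cancel₀ (by positivity) h2

lemma norm_sq_rpow (p : ℝ) (x : Euc N) : (‖x‖ ^ 2) ^ p = ‖x‖ ^ (2 * p) := by
  rw [← Real.rpow_natCast, ← Real.rpow_mul (norm_nonneg x)]; norm_num

lemma reg_rpow_le {p : ℝ} (hp : p ≤ 0) (ε : ℝ) {x : Euc N} (hx : x ≠ 0) :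
    (‖x‖ ^ 2 + ε ^ 2) ^ p ≤ ‖x‖ ^ (2 * p) := by
  have h : 0 < ‖x‖ := norm_pos_iff.2 hx
  have := Real.rpow_le_rpow_of_nonpos (by positivity : 0 < ‖x‖ ^ 2)
    (by nlinarith [sq_nonneg ε] : ‖x‖ ^ 2 ≤ ‖x‖ ^ 2 + ε ^ 2) hp
  rwa [norm_sq_rpow] at this

lemma tendsto_reg_rpow (p : ℝ) {x : Euc N} (hx : x ≠ 0) :
    Tendsto (fun ε : ℝ => (‖x‖ ^ 2 + ε ^ 2) ^ p) (nhdsWithin 0 (Set.Ioi 0))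
      (nhds (‖x‖ ^ (2 * p))) := by
  have h : 0 < ‖x‖ := norm_pos_iff.2 hx
  have h1 : Tendsto (fun ε : ℝ => ‖x‖ ^ 2 + ε ^ 2) (nhds 0) (nhds (‖x‖ ^ 2 + 0 ^ 2)) :=
    (continuous_const.add (continuous_pow 2)).tendsto 0
  have h2 := (h1.rpow_const (p := p) (Or.inl (by positivity))).mono_left
    (nhdsWithin_le_nhds (s := Set.Ioi 0))
  rw [zero_pow two_ne_zero, add_zero, norm_sq_rpow] at h2
  exact h2

lemma ae_ne_zero (hN : 1 ≤ N) : ∀ᵐ x : Euc N, x ≠ 0 := by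
  have : Nontrivial (Euc N) := Module.nontrivial_of_finrank_pos (R := ℝ) (by simp; omega)
  simp [ae_iff]

/-- The divergence identity for the vector field `x / ‖x‖ ^ N`. -/
lemma integral_radial_deriv (hN : 1 ≤ N) {ξ : Euc N → ℝ} (hξ : ContDiff ℝ 1 ξ)
    (hc : HasCompactSupport ξ) :
    Integrable (fun x : Euc N => ‖x‖ ^ (-(N : ℝ)) * fderiv ℝ ξ x x) ∧
    Tendsto (fun ε : ℝ => ∫ x : Euc N, (‖x‖ ^ 2 + ε ^ 2) ^ (-(N : ℝ) / 2) * fderiv ℝ ξ x x)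
      (nhdsWithin 0 (Set.Ioi 0)) (nhds (∫ x : Euc N, ‖x‖ ^ (-(N : ℝ)) * fderiv ℝ ξ x x)) ∧
    ∫ x : Euc N, ‖x‖ ^ (-(N : ℝ)) * fderiv ℝ ξ x x = -(sphereArea N * ξ 0) := by
  have hcont : Continuous (fun x => fderiv ℝ ξ x x) :=
    (hξ.continuous_fderiv one_ne_zero).clm_apply continuous_id
  have hbd : Integrable (fun x : Euc N => ‖x‖ ^ (1 - (N : ℝ)) * ‖fderiv ℝ ξ x‖) := by
    have := locallyIntegrable_norm_rpow (N := N) hN (p := 1 - N) (by linarith)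
    refine this.integrable_smul_right_of_hasCompactSupport
      (hξ.continuous_fderiv one_ne_zero).norm (hc.fderiv ℝ).norm
  have hle : ∀ x : Euc N, x ≠ 0 →
      ‖x‖ ^ (-(N : ℝ)) * ‖fderiv ℝ ξ x x‖ ≤ ‖x‖ ^ (1 - (N : ℝ)) * ‖fderiv ℝ ξ x‖ := by
    intro x hx
    have h : 0 < ‖x‖ := norm_pos_iff.2 hx
    rw [show (1 - (N : ℝ)) = -N + 1 by ring, Real.rpow_add_one h.ne', mul_assoc]
    refine mul_le_mul_of_nonneg_left ?_ (by positivity)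
    rw [mul_comm]
    exact (fderiv ℝ ξ x).le_opNorm x
  have hmeas : ∀ p : ℝ, ∀ ε : ℝ, AEStronglyMeasurable
      (fun x : Euc N => (‖x‖ ^ 2 + ε ^ 2) ^ p * fderiv ℝ ξ x x) volume := fun p ε =>
    (((measurable_norm.pow_const 2).add_const _).pow_const p).aestronglyMeasurable.mul
      hcont.aestronglyMeasurable
  have hlim : Tendsto (fun ε : ℝ => ∫ x : Euc N,
      (‖x‖ ^ 2 + ε ^ 2) ^ (-(N : ℝ) / 2) * fderiv ℝ ξ x x)
      (nhdsWithin 0 (Set.Ioi 0)) (nhds (∫ x : Euc N, ‖x‖ ^ (-(N : ℝ)) * fderiv ℝ ξ x x)) := by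
    refine tendsto_integral_filter_of_dominated_convergence _
      (Eventually.of_forall fun ε => hmeas _ ε) (Eventually.of_forall fun ε => ?_) hbd ?_
    · filter_upwards [ae_ne_zero hN] with x hx
      rw [norm_mul, Real.norm_of_nonneg (by positivity)]
      refine le_trans (mul_le_mul_of_nonneg_right ?_ (norm_nonneg _)) (hle x hx)
      have := reg_rpow_le (p := -(N : ℝ) / 2)
        (div_nonpos_of_nonpos_of_nonneg (by simp) (by norm_num)) ε hx
      rwa [show 2 * (-(N : ℝ) / 2) = -N by ring] at this
    · filter_upwards [ae_ne_zero hN] with x hx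
      have := tendsto_reg_rpow (-(N : ℝ) / 2) hx
      rw [show 2 * (-(N : ℝ) / 2) = -N by ring] at this
      exact this.mul_const _
  refine ⟨?_, hlim, ?_⟩
  · refine hbd.mono' ((measurable_norm.pow_const _).aestronglyMeasurable.mul
      hcont.aestronglyMeasurable) ?_
    filter_upwards [ae_ne_zero hN] with x hx
    rw [norm_mul, Real.norm_of_nonneg (by positivity)]
    exact hle x hx
  · have h2 := (tendsto_approx_identity hN hξ.continuous hc).neg
    refine tendsto_nhds_unique (hlim.congr' ?_) h2
    filter_upwards [self_mem_nhdsWithin] with ε hε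
    have hε : 0 < ε := hε
    obtain ⟨L, hL⟩ := hξ.lipschitzWith_of_hasCompactSupport hc one_ne_zero
    have hP : ∀ i : Fin N, ContDiff ℝ 1
        (fun x : Euc N => (‖x‖ ^ 2 + ε ^ 2) ^ (-(N : ℝ) / 2) * x i) := fun i =>
      (contDiff_reg _ hε (n := 1)).mul (EuclideanSpace.proj i : Euc N →L[ℝ] ℝ).contDiff
    have hPd : ∀ (i : Fin N) (x : Euc N),
        fderiv ℝ (fun x : Euc N => (‖x‖ ^ 2 + ε ^ 2) ^ (-(N : ℝ) / 2) * x i) x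
          (EuclideanSpace.single i 1) = (‖x‖ ^ 2 + ε ^ 2) ^ (-(N : ℝ) / 2) -
          N * (‖x‖ ^ 2 + ε ^ 2) ^ (-(N : ℝ) / 2 - 1) * (x i) ^ 2 := by
      intro i x
      have h6 : HasFDerivAt (fun y : Euc N => y i) (EuclideanSpace.proj i : Euc N →L[ℝ] ℝ) x :=
        (EuclideanSpace.proj i : Euc N →L[ℝ] ℝ).hasFDerivAt
      refine (congrArg (fun L => L (EuclideanSpace.single i 1))
        ((hasFDerivAt_reg (-(N : ℝ) / 2) hε x).mul h6).fderiv).trans ?_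
      simp [EuclideanSpace.inner_single_right]
      ring
    have key : ∀ i : Fin N, ∫ x : Euc N, (‖x‖ ^ 2 + ε ^ 2) ^ (-(N : ℝ) / 2) * x i *
        fderiv ℝ ξ x (EuclideanSpace.single i 1) = -∫ x : Euc N,
        ((‖x‖ ^ 2 + ε ^ 2) ^ (-(N : ℝ) / 2) -
          N * (‖x‖ ^ 2 + ε ^ 2) ^ (-(N : ℝ) / 2 - 1) * (x i) ^ 2) * ξ x := by
      intro i
      have := integral_mul_lineDeriv (hP i) hL hc (EuclideanSpace.single i 1)
      simp_rw [hPd i] at this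
      rw [← this]
      refine integral_congr_ae (Eventually.of_forall fun x => ?_)
      simp only
      rw [(hξ.differentiable one_ne_zero x).lineDeriv_eq_fderiv]
    have e1 : ∀ x : Euc N, (‖x‖ ^ 2 + ε ^ 2) ^ (-(N : ℝ) / 2) * fderiv ℝ ξ x x =
        ∑ i : Fin N, (‖x‖ ^ 2 + ε ^ 2) ^ (-(N : ℝ) / 2) * x i *
        fderiv ℝ ξ x (EuclideanSpace.single i 1) := by
      intro x
      rw [← sum_coord_mul_apply x (fderiv ℝ ξ x), Finset.mul_sum]
      simp_rw [mul_assoc]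
    have e2 : ∀ x : Euc N, N * ε ^ 2 * (‖x‖ ^ 2 + ε ^ 2) ^ (-(N : ℝ) / 2 - 1) * ξ x =
        ∑ i : Fin N, ((‖x‖ ^ 2 + ε ^ 2) ^ (-(N : ℝ) / 2) -
          N * (‖x‖ ^ 2 + ε ^ 2) ^ (-(N : ℝ) / 2 - 1) * (x i) ^ 2) * ξ x := by
      intro x
      have s2 : ∑ i : Fin N, (x i) ^ 2 = ‖x‖ ^ 2 := by
        rw [EuclideanSpace.norm_sq_eq]; simp
      rw [← Finset.sum_mul, Finset.sum_sub_distrib, ← Finset.mul_sum, s2]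
      have hq : ‖x‖ ^ 2 + ε ^ 2 ≠ 0 := by positivity
      have : (‖x‖ ^ 2 + ε ^ 2) ^ (-(N : ℝ) / 2) =
          (‖x‖ ^ 2 + ε ^ 2) ^ (-(N : ℝ) / 2 - 1) * (‖x‖ ^ 2 + ε ^ 2) := by
        rw [← Real.rpow_add_one hq]; congr 1; ring
      rw [this]
      simp only [Finset.sum_const, Finset.card_univ, Fintype.card_fin, nsmul_eq_mul]
      ring
    simp_rw [e1, e2]
    rw [integral_finsetSum, integral_finsetSum, ← Finset.sum_neg_distrib]
    · exact Finset.sum_congr rfl fun i _ => key i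
    · intro i _
      refine Continuous.integrable_of_hasCompactSupport ?_ hc.mul_left
      refine Continuous.mul (Continuous.sub (contDiff_reg _ hε (n := 1)).continuous
        ((continuous_const.mul (contDiff_reg _ hε (n := 1)).continuous).mul ?_)) hξ.continuous
      exact ((EuclideanSpace.proj i : Euc N →L[ℝ] ℝ).continuous).pow 2
    · intro i _
      refine Continuous.integrable_of_hasCompactSupport ?_ (hc.fderiv_apply ℝ _).mul_left
      exact (hP i).continuous.mul ((hξ.continuous_fderiv one_ne_zero).clm_apply continuous_const)

/-- `‖x‖ ^ (2 - N)` is a multiple of the fundamental solution of `-Δ`. -/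
lemma IsC11c.integral_norm_rpow_mul_lap (hN : 3 ≤ N) {η : Euc N → ℝ} (h : IsC11c η) :
    ∫ x : Euc N, ‖x‖ ^ (2 - (N : ℝ)) * lap η x = -((N - 2) * (sphereArea N * η 0)) := by
  have hN' : (3 : ℝ) ≤ N := by exact_mod_cast hN
  obtain ⟨-, h2, h3⟩ := integral_radial_deriv (by omega) h.contDiff_one h.1
  rw [h3] at h2
  have hlim : Tendsto (fun ε : ℝ => ∫ x : Euc N,
      (‖x‖ ^ 2 + ε ^ 2) ^ ((2 - (N : ℝ)) / 2) * lap η x)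
      (nhdsWithin 0 (Set.Ioi 0)) (nhds (∫ x : Euc N, ‖x‖ ^ (2 - (N : ℝ)) * lap η x)) := by
    have hInt := (h.integrable_mul_lap (locallyIntegrable_norm_rpow (by omega)
      (p := 2 - (N : ℝ)) (by linarith))).norm
    refine tendsto_integral_filter_of_dominated_convergence _
      (Eventually.of_forall fun ε => ?_) (Eventually.of_forall fun ε => ?_) hInt ?_
    · exact (((measurable_norm.pow_const 2).add_const _).pow_const _).aestronglyMeasurable.mul
        (measurable_lap η).aestronglyMeasurable
    · filter_upwards [ae_ne_zero (by omega)] with x hx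
      rw [norm_mul, norm_mul,
        Real.norm_of_nonneg (r := (‖x‖ ^ 2 + ε ^ 2) ^ ((2 - (N : ℝ)) / 2)) (by positivity),
        Real.norm_of_nonneg (r := ‖x‖ ^ (2 - (N : ℝ))) (by positivity)]
      refine mul_le_mul_of_nonneg_right ?_ (norm_nonneg _)
      have := reg_rpow_le (p := (2 - (N : ℝ)) / 2) (by linarith) ε hx
      rwa [show 2 * ((2 - (N : ℝ)) / 2) = 2 - N by ring] at this
    · filter_upwards [ae_ne_zero (by omega)] with x hx
      have := tendsto_reg_rpow ((2 - (N : ℝ)) / 2) hx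
      rw [show 2 * ((2 - (N : ℝ)) / 2) = 2 - N by ring] at this
      exact this.mul_const _
  refine tendsto_nhds_unique hlim ?_
  have h4 := h2.const_mul ((N : ℝ) - 2)
  rw [mul_neg] at h4
  refine h4.congr' ?_
  filter_upwards [self_mem_nhdsWithin] with ε hε
  have hε : 0 < ε := hε
  rw [h.integral_mul_lap (contDiff_reg _ hε (n := 1)), ← integral_const_mul, ← integral_neg]
  refine integral_congr_ae (Eventually.of_forall fun x => ?_)
  simp only
  rw [← sum_coord_mul_apply x (fderiv ℝ η x), Finset.mul_sum, Finset.mul_sum,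
    ← Finset.sum_neg_distrib]
  refine Finset.sum_congr rfl fun i _ => ?_
  rw [(hasFDerivAt_reg _ hε x).fderiv]
  simp [EuclideanSpace.inner_single_right]
  rw [show (2 - (N : ℝ)) / 2 - 1 = -N / 2 by ring]
  ring

lemma sphereArea_pos (hN : 1 ≤ N) : 0 < sphereArea N := by
  unfold sphereArea
  refine mul_pos (by exact_mod_cast hN) (ENNReal.toReal_pos ?_ measure_ball_lt_top.ne)
  exact (measure_ball_pos volume _ one_pos).ne'

lemma cN_pos (hN : 3 ≤ N) : 0 < cN N := by
  have hN' : (3 : ℝ) ≤ N := by exact_mod_cast hN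
  exact inv_pos.2 (mul_pos (by linarith) (sphereArea_pos (by omega)))

lemma cN_mul (hN : 3 ≤ N) : cN N * ((N - 2) * sphereArea N) = 1 := by
  have hN' : (3 : ℝ) ≤ N := by exact_mod_cast hN
  exact inv_mul_cancel₀ (mul_pos (by linarith) (sphereArea_pos (by omega))).ne'

lemma lap_comp_add (η : Euc N → ℝ) (a x : Euc N) : lap (fun y => η (y + a)) x = lap η (x + a) := by
  unfold lap
  simp_rw [fderiv_comp_add_right]
  refine Finset.sum_congr rfl fun i _ => ?_
  rw [fderiv_comp_add_right (f := fun y => fderiv ℝ η y (EuclideanSpace.single i 1))]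

lemma IsC11c.comp_add {η : Euc N → ℝ} (h : IsC11c η) (a : Euc N) :
    IsC11c (fun y => η (y + a)) := by
  obtain ⟨h1, h2, L, hL⟩ := h
  refine ⟨h1.comp_homeomorph (Homeomorph.addRight a), h2.comp (by fun_prop), L, ?_⟩
  have : fderiv ℝ (fun y => η (y + a)) = fun x => fderiv ℝ η (x + a) := by
    ext1 x; rw [fderiv_comp_add_right]
  rw [this]
  refine LipschitzWith.of_dist_le_mul fun x y => ?_
  simpa using hL.dist_le_mul (x + a) (y + a)

/-- Representation of a compactly supported function by its Newtonian potential. -/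
lemma IsC11c.newton_repr (hN : 3 ≤ N) {η : Euc N → ℝ} (h : IsC11c η) (x : Euc N) :
    η x = -(cN N * ∫ y, ‖x - y‖ ^ (2 - (N : ℝ)) * lap η y) := by
  have h1 := (h.comp_add x).integral_norm_rpow_mul_lap hN
  simp_rw [lap_comp_add, zero_add] at h1
  have h2 := integral_sub_right_eq_self (μ := (volume : Measure (Euc N)))
    (fun y => ‖y‖ ^ (2 - (N : ℝ)) * lap η (y + x)) x
  simp_rw [sub_add_cancel, norm_sub_rev _ x] at h2
  rw [h2, h1]
  linear_combination -η x * cN_mul hN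

lemma newton_integrable (hN : 3 ≤ N) {a : ℝ} (ha : 0 < a) (ha' : a < N - 2) {x : Euc N}
    (hx : x ≠ 0) : Integrable (fun y : Euc N => ‖x - y‖ ^ (2 - (N : ℝ)) * ‖y‖ ^ (-a - 2)) := by
  have hN' : (3 : ℝ) ≤ N := by exact_mod_cast hN
  set ρ := ‖x‖ / 2 with hρ
  have hρ0 : 0 < ρ := by have := norm_pos_iff.2 hx; positivity
  have m1 : Measurable (fun y : Euc N => ‖x - y‖ ^ (2 - (N : ℝ))) :=
    ((measurable_const.sub measurable_id).norm).pow_const _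
  have m2 : Measurable (fun y : Euc N => ‖y‖ ^ (-a - 2)) := measurable_norm.pow_const _
  have e1 : IntegrableOn (fun y : Euc N => ‖x - y‖ ^ (2 - (N : ℝ)) * ‖y‖ ^ (-a - 2))
      (ball 0 ρ) := by
    have : IntegrableOn (fun y : Euc N => ‖y‖ ^ (-a - 2)) (ball 0 ρ) :=
      ((locallyIntegrable_norm_rpow (by omega) (by linarith)).integrableOn_isCompact
        (isCompact_closedBall 0 ρ)).mono_set ball_subset_closedBall
    refine this.bdd_mul (c := ρ ^ (2 - (N : ℝ))) m1.aestronglyMeasurable ?_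
    refine (ae_restrict_iff' measurableSet_ball).2 (Eventually.of_forall fun y hy => ?_)
    rw [mem_ball_zero_iff] at hy
    rw [Real.norm_of_nonneg (by positivity)]
    refine Real.rpow_le_rpow_of_nonpos hρ0 ?_ (by linarith)
    have := norm_sub_norm_le x y
    linarith
  have e2 : IntegrableOn (fun y : Euc N => ‖x - y‖ ^ (2 - (N : ℝ)) * ‖y‖ ^ (-a - 2))
      (ball x ρ) := by
    have h0 : LocallyIntegrable (fun y : Euc N => ‖x - y‖ ^ (2 - (N : ℝ))) := by
      refine locallyIntegrable_iff.2 fun k hk => ?_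
      have h1 := (locallyIntegrable_norm_rpow (N := N) (by omega)
        (p := 2 - (N : ℝ)) (by linarith)).integrableOn_isCompact
          (hk.image (continuous_const.sub continuous_id : Continuous fun y => x - y))
      have h2 := (MeasurePreserving.integrableOn_comp_preimage
        (Measure.measurePreserving_sub_left (volume : Measure (Euc N)) x)
        (MeasurableEquiv.subLeft x).measurableEmbedding).2 h1
      refine h2.mono_set fun y hy => ?_
      exact Set.mem_image_of_mem _ hy
    refine ((h0.integrableOn_isCompact (isCompact_closedBall x ρ)).mono_set
      ball_subset_closedBall).mul_bdd (c := ρ ^ (-a - 2)) m2.aestronglyMeasurable ?_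
    refine (ae_restrict_iff' measurableSet_ball).2 (Eventually.of_forall fun y hy => ?_)
    rw [mem_ball, dist_eq_norm] at hy
    rw [Real.norm_of_nonneg (by positivity)]
    refine Real.rpow_le_rpow_of_nonpos hρ0 ?_ (by linarith)
    have := norm_sub_norm_le x y
    rw [norm_sub_rev] at hy
    linarith
  have e3 : IntegrableOn (fun y : Euc N => ‖x - y‖ ^ (2 - (N : ℝ)) * ‖y‖ ^ (-a - 2))
      (ball 0 ρ ∪ ball x ρ)ᶜ := by
    have h0 : Integrable (fun y : Euc N => (1 + ‖y‖) ^ (-((N : ℝ) + a))) :=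
      integrable_one_add_norm (by simpa using ha)
    refine ((h0.const_mul ((3 : ℝ)⁻¹ ^ (2 - (N : ℝ)) * (ρ / (1 + ρ)) ^ (-((N : ℝ) + a)))).integrableOn
      (s := (ball 0 ρ ∪ ball x ρ)ᶜ)).mono' (m1.mul m2).aestronglyMeasurable ?_
    refine (ae_restrict_iff' (measurableSet_ball.union measurableSet_ball).compl).2
      (Eventually.of_forall fun y hy => ?_)
    simp only [Set.mem_compl_iff, Set.mem_union, mem_ball, dist_eq_norm, not_or, not_lt,
      sub_zero] at hy
    obtain ⟨hy1, hy2⟩ := hy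
    rw [norm_sub_rev] at hy2
    have hy0 : 0 < ‖y‖ := hρ0.trans_le hy1
    have t1 : 3⁻¹ * ‖y‖ ≤ ‖x - y‖ := by
      have := norm_sub_norm_le y x
      rw [norm_sub_rev] at this
      linarith
    have t2 : ρ / (1 + ρ) * (1 + ‖y‖) ≤ ‖y‖ := by
      rw [div_mul_eq_mul_div, div_le_iff₀ (by linarith)]
      nlinarith
    rw [Real.norm_of_nonneg (by positivity)]
    calc ‖x - y‖ ^ (2 - (N : ℝ)) * ‖y‖ ^ (-a - 2)
        ≤ (3⁻¹ * ‖y‖) ^ (2 - (N : ℝ)) * ‖y‖ ^ (-a - 2) :=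
          mul_le_mul_of_nonneg_right
            (Real.rpow_le_rpow_of_nonpos (by positivity) t1 (by linarith)) (by positivity)
      _ = (3 : ℝ)⁻¹ ^ (2 - (N : ℝ)) * ‖y‖ ^ (-((N : ℝ) + a)) := by
          rw [Real.mul_rpow (by norm_num) hy0.le, mul_assoc, ← Real.rpow_add hy0]
          congr 2; ring
      _ ≤ (3 : ℝ)⁻¹ ^ (2 - (N : ℝ)) * (ρ / (1 + ρ) * (1 + ‖y‖)) ^ (-((N : ℝ) + a)) :=
          mul_le_mul_of_nonneg_left
            (Real.rpow_le_rpow_of_nonpos (by positivity) t2 (by linarith)) (by positivity)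
      _ = _ := by
          rw [Real.mul_rpow (by positivity) (by positivity)]; ring
  have := (e1.union e2).union e3
  rwa [Set.union_compl_self, integrableOn_univ] at this

lemma exists_cutoff_line : ∃ (φ φ' φ'' : ℝ → ℝ) (C : ℝ), ContDiff ℝ 2 φ ∧
    (∀ t, HasDerivAt φ (φ' t) t) ∧ (∀ t, HasDerivAt φ' (φ'' t) t) ∧
    (∀ t, |φ t| ≤ C ∧ |φ' t| ≤ C ∧ |φ'' t| ≤ C) ∧ φ 0 = 1 ∧ (∀ t, 2 ≤ |t| → φ t = 0) := by
  let f : ContDiffBump (0 : ℝ) := ⟨1, 2, one_pos, by norm_num⟩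
  have hf : ContDiff ℝ 2 f := f.contDiff
  have hc := f.hasCompactSupport
  have hf1 : ContDiff ℝ 1 (deriv f) := (contDiff_succ_iff_deriv (n := 1)).1
    (by simpa [one_add_one_eq_two] using hf) |>.2.2
  have hf2 : Continuous (deriv (deriv f)) := hf1.continuous_deriv le_rfl
  obtain ⟨C1, h1⟩ := hc.exists_bound_of_continuous hf.continuous
  obtain ⟨C2, h2⟩ := hc.deriv.exists_bound_of_continuous hf1.continuous
  obtain ⟨C3, h3⟩ := hc.deriv.deriv.exists_bound_of_continuous hf2
  refine ⟨f, deriv f, deriv (deriv f), max (max C1 C2) C3, hf,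
    fun t => (hf.differentiable two_ne_zero t).hasDerivAt,
    fun t => (hf1.differentiable one_ne_zero t).hasDerivAt, fun t => ⟨?_, ?_, ?_⟩,
    f.one_of_mem_closedBall (by simp [f]), fun t ht => f.zero_of_le_dist (by simpa [f] using ht)⟩
  · exact (h1 t).trans ((le_max_left _ _).trans (le_max_left _ _))
  · exact (h2 t).trans ((le_max_right _ _).trans (le_max_left _ _))
  · exact (h3 t).trans (le_max_right _ _)

lemma exp_log_norm {x : Euc N} (hx : x ≠ 0) (p : ℝ) :
    Real.exp (p * Real.log ‖x‖) = ‖x‖ ^ p := by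
  rw [Real.rpow_def_of_pos (norm_pos_iff.2 hx), mul_comm]

/-- Representation of a radial function of power decay by its Newtonian potential. -/
lemma rad_newton_repr (hN : 3 ≤ N) {a : ℝ} (ha : 0 < a) (ha' : a < N - 2) {g g' g'' : ℝ → ℝ}
    (hg2 : ContDiff ℝ 2 g) (hg : ∀ t, HasDerivAt g (g' t) t) (hg' : ∀ t, HasDerivAt g' (g'' t) t)
    {C : ℝ} (hC : ∀ t, |g t| ≤ C * Real.exp (-a * t) ∧ |g' t| ≤ C * Real.exp (-a * t) ∧
      |g'' t| ≤ C * Real.exp (-a * t)) {x : Euc N} (hx : x ≠ 0) :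
    rad g x = -(cN N * ∫ y, ‖x - y‖ ^ (2 - (N : ℝ)) * lap (rad g) y) := by
  have hN' : (3 : ℝ) ≤ N := by exact_mod_cast hN
  obtain ⟨φ, φ', φ'', D, hφ2, hφ, hφ', hD, hφ0, hφ1⟩ := exists_cutoff_line
  have hD0 : 0 ≤ D := (abs_nonneg _).trans (hD 0).1
  have hφc : Continuous φ := hφ2.continuous
  have hφc' : Continuous φ' := continuous_iff_continuousAt.2 fun t => (hφ' t).continuousAt
  let G : ℝ → ℝ → ℝ := fun s t => g t * φ (s * t)
  let G' : ℝ → ℝ → ℝ := fun s t => g' t * φ (s * t) + g t * (φ' (s * t) * s)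
  let G'' : ℝ → ℝ → ℝ := fun s t => (g'' t * φ (s * t) + g' t * (φ' (s * t) * s)) +
    (g' t * (φ' (s * t) * s) + g t * (φ'' (s * t) * s * s))
  have dl : ∀ s t : ℝ, HasDerivAt (fun t => s * t) s t := fun s t => by
    simpa using (hasDerivAt_id t).const_mul s
  have dG : ∀ s t, HasDerivAt (G s) (G' s t) t := fun s t =>
    (hg t).mul ((hφ (s * t)).comp t (dl s t))
  have dG' : ∀ s t, HasDerivAt (G' s) (G'' s t) t := fun s t =>
    ((hg' t).mul ((hφ (s * t)).comp t (dl s t))).add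
      ((hg t).mul (((hφ' (s * t)).comp t (dl s t)).mul_const s))
  have hcd : ∀ s, 0 < s → IsC11c (rad (G s) : Euc N → ℝ) := by
    intro s hs
    have z : ∀ t, 2 / s ≤ |t| → G s t = 0 := by
      intro t ht
      simp only [G]
      rw [hφ1, mul_zero]
      rw [abs_mul, abs_of_pos hs]
      rwa [div_le_iff₀' hs] at ht
    refine IsC11c.of_contDiff (contDiff_rad (n := 2) (t₀ := -(2 / s)) ?_ ?_)
      (hasCompactSupport_rad (t₁ := 2 / s) ?_)
    · exact hg2.mul (hφ2.comp (contDiff_const.mul contDiff_id))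
    · intro t ht
      exact z t (by rw [abs_of_nonpos (by have : 0 < 2 / s := by positivity
                                          linarith)]; linarith)
    · intro t ht
      exact z t (ht.trans (le_abs_self t))
  have hInt := newton_integrable hN ha ha' hx
  have hlim : Tendsto (fun s : ℝ => ∫ y, ‖x - y‖ ^ (2 - (N : ℝ)) * lap (rad (G s)) y)
      (nhdsWithin 0 (Set.Ioi 0)) (nhds (∫ y, ‖x - y‖ ^ (2 - (N : ℝ)) * lap (rad g) y)) := by
    refine tendsto_integral_filter_of_dominated_convergence
      (fun y => (4 * C * D + (N - 2) * (2 * C * D)) *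
        (‖x - y‖ ^ (2 - (N : ℝ)) * ‖y‖ ^ (-a - 2)))
      (Eventually.of_forall fun s => ?_) ?_ (hInt.const_mul _) ?_
    · exact (((measurable_const.sub measurable_id).norm).pow_const _).aestronglyMeasurable.mul
        (measurable_lap _).aestronglyMeasurable
    · filter_upwards [Ioc_mem_nhdsGT (zero_lt_one' ℝ)] with s hs
      filter_upwards [ae_ne_zero (by omega)] with y hy
      have hy0 := norm_pos_iff.2 hy
      rw [lap_rad hy (dG s) (dG' s _)]
      set t := Real.log ‖y‖ with ht
      set E := Real.exp (-a * t) with hE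
      obtain ⟨c1, c2, c3⟩ := hC t
      obtain ⟨d1, d2, d3⟩ := hD (s * t)
      have hCE : 0 ≤ C * E := (abs_nonneg _).trans c1
      have hb : ∀ p q r : ℝ, |p| ≤ C * E → |q| ≤ D → |r| ≤ 1 → |p * (q * r)| ≤ C * E * D := by
        intro p q r h1 h2 h3
        rw [abs_mul, abs_mul]
        refine mul_le_mul h1 ?_ (by positivity) hCE
        exact (mul_le_mul h2 h3 (by positivity) hD0).trans (by simp)
      have hs1 : |s| ≤ 1 := by rw [abs_of_pos hs.1]; exact hs.2
      have hs2 : |s * s| ≤ 1 := by rw [abs_mul]; exact mul_le_one₀ hs1 (abs_nonneg _) hs1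
      have b1 : |G'' s t| ≤ 4 * (C * E * D) := by
        have e1 := hb _ _ 1 c3 d1 (by simp)
        have e2 := hb _ _ s c2 d2 hs1
        have e3 := hb _ _ (s * s) c1 d3 hs2
        rw [mul_one] at e1
        rw [← mul_assoc (φ'' _)] at e3
        simp only [G'']
        refine (abs_add_le _ _).trans ?_
        have := abs_add_le (g'' t * φ (s * t)) (g' t * (φ' (s * t) * s))
        have := abs_add_le (g' t * (φ' (s * t) * s)) (g t * (φ'' (s * t) * s * s))
        linarith
      have b2 : |G' s t| ≤ 2 * (C * E * D) := by
        have e1 := hb _ _ 1 c2 d1 (by simp)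
        have e2 := hb _ _ s c1 d2 hs1
        rw [mul_one] at e1
        simp only [G']
        refine (abs_add_le _ _).trans ?_
        linarith
      have hE2 : E / ‖y‖ ^ 2 = ‖y‖ ^ (-a - 2) := by
        rw [hE, ht, exp_log_norm hy, Real.rpow_sub hy0]
        norm_num
      rw [norm_mul, Real.norm_of_nonneg (by positivity), Real.norm_eq_abs, abs_div,
        abs_of_pos (by positivity : 0 < ‖y‖ ^ 2), mul_left_comm]
      refine mul_le_mul_of_nonneg_left ?_ (by positivity)
      rw [← hE2, ← mul_div_assoc]
      refine div_le_div_of_nonneg_right ?_ (by positivity)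
      refine (abs_add_le _ _).trans ?_
      rw [abs_mul, abs_of_nonneg (by linarith : (0 : ℝ) ≤ N - 2)]
      nlinarith [mul_le_mul_of_nonneg_left b2 (by linarith : (0 : ℝ) ≤ N - 2)]
    · filter_upwards [ae_ne_zero (by omega)] with y hy
      rw [lap_rad hy hg (hg' _)]
      refine Tendsto.const_mul _ ?_
      have hcongr : (fun s => lap (rad (G s)) y) = fun s =>
          (G'' s (Real.log ‖y‖) + (N - 2) * G' s (Real.log ‖y‖)) / ‖y‖ ^ 2 := by
        ext s; exact lap_rad hy (dG s) (dG' s _)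
      rw [hcongr]
      set t := Real.log ‖y‖
      have i0 : Tendsto (fun s : ℝ => s) (nhdsWithin 0 (Set.Ioi 0)) (nhds 0) :=
        nhdsWithin_le_nhds
      have i1 : Tendsto (fun s : ℝ => s * t) (nhdsWithin 0 (Set.Ioi 0)) (nhds 0) := by
        simpa using i0.mul_const t
      have j1 : Tendsto (fun s : ℝ => φ (s * t)) (nhdsWithin 0 (Set.Ioi 0)) (nhds 1) := by
        rw [← hφ0]; exact (hφc.tendsto 0).comp i1
      have j2 : Tendsto (fun s : ℝ => φ' (s * t) * s) (nhdsWithin 0 (Set.Ioi 0)) (nhds 0) := by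
        simpa using ((hφc'.tendsto 0).comp i1).mul i0
      have j3 : Tendsto (fun s : ℝ => φ'' (s * t) * s * s) (nhdsWithin 0 (Set.Ioi 0))
          (nhds 0) := by
        have := (bdd_le_mul_tendsto_zero' D (Eventually.of_forall fun s => (hD (s * t)).2.2) i0)
        simpa using this.mul i0
      have k1 : Tendsto (fun s => G' s t) (nhdsWithin 0 (Set.Ioi 0)) (nhds (g' t)) := by
        simpa using (j1.const_mul (g' t)).add (j2.const_mul (g t))
      have k2 : Tendsto (fun s => G'' s t) (nhdsWithin 0 (Set.Ioi 0)) (nhds (g'' t)) := by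
        simpa using ((j1.const_mul (g'' t)).add (j2.const_mul (g' t))).add
          ((j2.const_mul (g' t)).add (j3.const_mul (g t)))
      exact (k2.add (k1.const_mul _)).div_const _
  have hlim2 : Tendsto (fun s : ℝ => rad (G s) x) (nhdsWithin 0 (Set.Ioi 0))
      (nhds (rad g x)) := by
    simp_rw [rad_of_ne _ hx]
    have i1 : Tendsto (fun s : ℝ => s * Real.log ‖x‖) (nhdsWithin 0 (Set.Ioi 0)) (nhds 0) := by
      have i0 : Tendsto (fun s : ℝ => s) (nhdsWithin 0 (Set.Ioi 0)) (nhds 0) :=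
        nhdsWithin_le_nhds
      simpa using i0.mul_const (Real.log ‖x‖)
    have := ((hφc.tendsto 0).comp i1).const_mul (g (Real.log ‖x‖))
    simpa [hφ0] using this
  refine tendsto_nhds_unique hlim2 ((hlim.const_mul (cN N)).neg.congr' ?_)
  filter_upwards [self_mem_nhdsWithin] with s hs
  exact ((hcd s hs).newton_repr hN x).symm

/-- The Newtonian potential of `f`. -/
def pot (f : Euc N → ℝ) (x : Euc N) : ℝ := cN N * ∫ y, ‖x - y‖ ^ (2 - (N : ℝ)) * f y

lemma norm_rpow_repr (hN : 3 ≤ N) {a : ℝ} (ha : 0 < a) (ha' : a < N - 2) {x : Euc N}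
    (hx : x ≠ 0) :
    cN N * ∫ y, ‖x - y‖ ^ (2 - (N : ℝ)) * ‖y‖ ^ (-a - 2) = (a * (N - 2 - a))⁻¹ * ‖x‖ ^ (-a) := by
  have d : ∀ c t : ℝ, HasDerivAt (fun t => c * Real.exp (-a * t)) (-a * c * Real.exp (-a * t)) t := by
    intro c t
    have := ((((hasDerivAt_id t).const_mul (-a)).exp).const_mul c)
    refine this.congr_deriv ?_
    simp; ring
  have h := rad_newton_repr hN ha ha' (g := fun t => 1 * Real.exp (-a * t))
    (contDiff_const.mul (Real.contDiff_exp.comp (contDiff_const.mul contDiff_id)))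
    (d 1) (d _) (C := max 1 (max a (a ^ 2))) (fun t => ?_) hx
  · have hne : (a * (N - 2 - a)) ≠ 0 := (mul_pos ha (by linarith)).ne'
    have e : ∫ y, ‖x - y‖ ^ (2 - (N : ℝ)) * lap (rad fun t => 1 * Real.exp (-a * t)) y =
        ∫ y, -(a * (N - 2 - a)) * (‖x - y‖ ^ (2 - (N : ℝ)) * ‖y‖ ^ (-a - 2)) := by
      refine integral_congr_ae ?_
      filter_upwards [ae_ne_zero (by omega)] with y hy
      rw [lap_rad hy (d 1) (d _ _), exp_log_norm hy, Real.rpow_sub (norm_pos_iff.2 hy)]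
      norm_num
      ring
    rw [e, integral_const_mul, rad_of_ne _ hx, exp_log_norm hx] at h
    rw [eq_inv_mul_iff_mul_eq₀ hne]
    linear_combination -h
  · have hp := Real.exp_pos (-a * t)
    simp only [abs_mul, abs_of_pos hp, abs_neg, abs_of_pos ha, abs_one]
    refine ⟨?_, ?_, ?_⟩
    · exact mul_le_mul_of_nonneg_right (le_max_left _ _) hp.le
    · rw [mul_one]
      exact mul_le_mul_of_nonneg_right ((le_max_left _ _).trans (le_max_right _ _)) hp.le
    · refine mul_le_mul_of_nonneg_right (le_trans (le_of_eq ?_)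
        ((le_max_right _ _).trans (le_max_right _ _))) hp.le
      ring

lemma measurable_newton (x : Euc N) : Measurable (fun y : Euc N => ‖x - y‖ ^ (2 - (N : ℝ))) :=
  ((measurable_const.sub measurable_id).norm).pow_const _

lemma pot_integrable (hN : 3 ≤ N) {a C : ℝ} (ha : 0 < a) (ha' : a < N - 2) {f : Euc N → ℝ}
    (hf : AEStronglyMeasurable f) (hfb : ∀ x, x ≠ 0 → |f x| ≤ C * ‖x‖ ^ (-a - 2)) {x : Euc N}
    (hx : x ≠ 0) : Integrable (fun y => ‖x - y‖ ^ (2 - (N : ℝ)) * f y) := by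
  refine ((newton_integrable hN ha ha' hx).const_mul C).mono'
    ((measurable_newton x).aestronglyMeasurable.mul hf) ?_
  filter_upwards [ae_ne_zero (by omega)] with y hy
  rw [norm_mul, Real.norm_of_nonneg (by positivity), mul_left_comm]
  exact mul_le_mul_of_nonneg_left (hfb y hy) (by positivity)

lemma aestronglyMeasurable_newton_prod {f : Euc N → ℝ} (hf : AEStronglyMeasurable f) :
    AEStronglyMeasurable (fun p : Euc N × Euc N => ‖p.1 - p.2‖ ^ (2 - (N : ℝ)) * f p.2)
      (volume.prod volume) :=
  (((measurable_fst.sub measurable_snd).norm).pow_const _).aestronglyMeasurable.mul hf.comp_snd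

lemma aestronglyMeasurable_pot {f : Euc N → ℝ} (hf : AEStronglyMeasurable f) :
    AEStronglyMeasurable (pot f) :=
  (aestronglyMeasurable_newton_prod hf).integral_prod_right'.const_mul _

lemma integral_newton_abs_le (hN : 3 ≤ N) {a C : ℝ} (ha : 0 < a) (ha' : a < N - 2)
    {f : Euc N → ℝ} (hf : AEStronglyMeasurable f)
    (hfb : ∀ x, x ≠ 0 → |f x| ≤ C * ‖x‖ ^ (-a - 2)) {x : Euc N}
    (hx : x ≠ 0) : cN N * ∫ y, ‖‖x - y‖ ^ (2 - (N : ℝ)) * f y‖ ≤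
      C * (a * (N - 2 - a))⁻¹ * ‖x‖ ^ (-a) := by
  rw [mul_assoc, ← norm_rpow_repr hN ha ha' hx, mul_left_comm]
  refine mul_le_mul_of_nonneg_left ?_ (cN_pos hN).le
  rw [← integral_const_mul]
  refine integral_mono_ae (pot_integrable hN ha ha' hf hfb hx).norm
    ((newton_integrable hN ha ha' hx).const_mul C) ?_
  filter_upwards [ae_ne_zero (by omega)] with y hy
  rw [norm_mul, Real.norm_of_nonneg (by positivity), mul_left_comm]
  exact mul_le_mul_of_nonneg_left (hfb y hy) (by positivity)

/-- Symmetry of the Newtonian potential. -/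
lemma integral_mul_pot (hN : 3 ≤ N) {a C : ℝ} (ha : 0 < a) (ha' : a < N - 2) {f b : Euc N → ℝ}
    (hf : AEStronglyMeasurable f) (hfb : ∀ x, x ≠ 0 → |f x| ≤ C * ‖x‖ ^ (-a - 2))
    (hb : AEStronglyMeasurable b) (hInt : Integrable (fun x : Euc N => ‖x‖ ^ (-a) * b x)) :
    ∫ x, b x * pot f x = ∫ y, pot b y * f y := by
  have hc := cN_pos hN
  have hm : AEStronglyMeasurable
      (fun p : Euc N × Euc N => b p.1 * (‖p.1 - p.2‖ ^ (2 - (N : ℝ)) * f p.2))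
      (volume.prod volume) := hb.comp_fst.mul (aestronglyMeasurable_newton_prod hf)
  have hI : Integrable (fun p : Euc N × Euc N => b p.1 * (‖p.1 - p.2‖ ^ (2 - (N : ℝ)) * f p.2))
      (volume.prod volume) := by
    refine (integrable_prod_iff hm).2 ⟨?_, ?_⟩
    · filter_upwards [ae_ne_zero (by omega)] with x hx
      exact (pot_integrable hN ha ha' hf hfb hx).const_mul _
    · refine (hInt.norm.const_mul ((cN N)⁻¹ * (C * (a * (N - 2 - a))⁻¹))).mono'
        hm.norm.integral_prod_right' ?_
      filter_upwards [ae_ne_zero (by omega)] with x hx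
      rw [Real.norm_of_nonneg (integral_nonneg fun _ => norm_nonneg _)]
      simp_rw [norm_mul (b x)]
      rw [integral_const_mul]
      have := integral_newton_abs_le hN ha ha' hf hfb hx
      rw [← le_inv_mul_iff₀ hc] at this
      refine (mul_le_mul_of_nonneg_left this (norm_nonneg (b x))).trans (le_of_eq ?_)
      rw [norm_mul, Real.norm_of_nonneg (r := ‖x‖ ^ (-a)) (by positivity)]
      ring
  have hs := integral_integral_swap (f := fun x y => b x * (‖x - y‖ ^ (2 - (N : ℝ)) * f y)) hI
  have e1 : ∀ x, b x * pot f x = cN N * ∫ y, b x * (‖x - y‖ ^ (2 - (N : ℝ)) * f y) := by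
    intro x; rw [integral_const_mul]; unfold pot; ring
  have e2 : ∀ y, pot b y * f y = cN N * ∫ x, b x * (‖x - y‖ ^ (2 - (N : ℝ)) * f y) := by
    intro y
    unfold pot
    rw [mul_assoc, ← integral_mul_const]
    congr 1
    refine integral_congr_ae (Eventually.of_forall fun x => ?_)
    simp only
    rw [norm_sub_rev]; ring
  simp_rw [e1, e2]
  rw [integral_const_mul, integral_const_mul, hs]

lemma pot_weak_form (hN : 3 ≤ N) {a C : ℝ} (ha : 0 < a) (ha' : a < N - 2) {f η : Euc N → ℝ}
    (hf : AEStronglyMeasurable f) (hfb : ∀ x, x ≠ 0 → |f x| ≤ C * ‖x‖ ^ (-a - 2))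
    (h : IsC11c η) : ∫ x, lap η x * pot f x = -∫ x, η x * f x := by
  rw [integral_mul_pot hN ha ha' hf hfb (measurable_lap η).aestronglyMeasurable
    (h.integrable_mul_lap (locallyIntegrable_norm_rpow (by omega) (by linarith))), ← integral_neg]
  refine integral_congr_ae (Eventually.of_forall fun x => ?_)
  simp only
  rw [h.newton_repr hN x]; unfold pot; ring

lemma locallyIntegrable_of_abs_le_rpow (hN : 1 ≤ N) {p C : ℝ} (hp : -(N : ℝ) < p)
    {w : Euc N → ℝ} (hw : AEStronglyMeasurable w) (hwb : ∀ x, x ≠ 0 → |w x| ≤ C * ‖x‖ ^ p) :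
    LocallyIntegrable w := by
  have h := (locallyIntegrable_norm_rpow hN hp).smul C
  refine h.mono hw ?_
  filter_upwards [ae_ne_zero hN] with x hx
  refine (hwb x hx).trans ?_
  exact le_abs_self _

lemma exists_transition : ∃ (ψ ψ' ψ'' : ℝ → ℝ) (D : ℝ), (∀ n : ℕ∞, ContDiff ℝ n ψ) ∧
    (∀ n : ℕ∞, ContDiff ℝ n ψ') ∧ (∀ n : ℕ∞, ContDiff ℝ n ψ'') ∧
    (∀ t, HasDerivAt ψ (ψ' t) t) ∧ (∀ t, HasDerivAt ψ' (ψ'' t) t) ∧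
    (∀ t, |ψ t| ≤ D ∧ |ψ' t| ≤ D ∧ |ψ'' t| ≤ D) ∧ (∀ t, 0 ≤ ψ t ∧ ψ t ≤ 1) ∧
    (∀ t ≤ 0, ψ t = 0) ∧ (∀ t, 1 ≤ t → ψ t = 1) ∧
    (∀ t, t < 0 ∨ 1 < t → ψ' t = 0 ∧ ψ'' t = 0) := by
  set ψ := Real.smoothTransition
  have h0 : ContDiff ℝ (⊤ : ℕ∞) ψ := Real.smoothTransition.contDiff
  have h1 : ContDiff ℝ (⊤ : ℕ∞) (deriv ψ) := (contDiff_infty_iff_deriv.1 h0).2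
  have h2 : ContDiff ℝ (⊤ : ℕ∞) (deriv (deriv ψ)) := (contDiff_infty_iff_deriv.1 h1).2
  have z : ∀ t, t < 0 ∨ 1 < t → deriv ψ t = 0 := by
    rintro t (ht | ht)
    · have : ψ =ᶠ[nhds t] fun _ => 0 := by
        filter_upwards [Iio_mem_nhds ht] with s hs
        exact Real.smoothTransition.zero_of_nonpos (le_of_lt hs)
      rw [this.deriv_eq]; simp
    · have : ψ =ᶠ[nhds t] fun _ => 1 := by
        filter_upwards [Ioi_mem_nhds ht] with s hs
        exact Real.smoothTransition.one_of_one_le (le_of_lt hs)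
      rw [this.deriv_eq]; simp
  have z2 : ∀ t, t < 0 ∨ 1 < t → deriv (deriv ψ) t = 0 := by
    intro t ht
    have : deriv ψ =ᶠ[nhds t] fun _ => 0 := by
      have ho : IsOpen {t : ℝ | t < 0 ∨ 1 < t} := isOpen_Iio.union isOpen_Ioi
      filter_upwards [ho.mem_nhds ht] with s hs using z s hs
    rw [this.deriv_eq]; simp
  have cs : ∀ f : ℝ → ℝ, (∀ t, t < 0 ∨ 1 < t → f t = 0) → HasCompactSupport f := by
    intro f hf
    refine HasCompactSupport.intro (isCompact_Icc (a := (0 : ℝ)) (b := 1)) fun t ht => hf t ?_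
    rw [Set.mem_Icc, not_and_or, not_le, not_le] at ht
    exact ht
  obtain ⟨C1, hC1⟩ := (cs _ z).exists_bound_of_continuous h1.continuous
  obtain ⟨C2, hC2⟩ := (cs _ z2).exists_bound_of_continuous h2.continuous
  refine ⟨ψ, deriv ψ, deriv (deriv ψ), max 1 (max C1 C2), fun n => h0.of_le (by exact_mod_cast le_top),
    fun n => h1.of_le (by exact_mod_cast le_top), fun n => h2.of_le (by exact_mod_cast le_top),
    fun t => (h0.differentiable (by simp) t).hasDerivAt,
    fun t => (h1.differentiable (by simp) t).hasDerivAt, fun t => ⟨?_, ?_, ?_⟩,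
    fun t => ⟨Real.smoothTransition.nonneg t, Real.smoothTransition.le_one t⟩,
    fun t ht => Real.smoothTransition.zero_of_nonpos ht,
    fun t ht => Real.smoothTransition.one_of_one_le ht, fun t ht => ⟨z t ht, z2 t ht⟩⟩
  · rw [abs_of_nonneg (Real.smoothTransition.nonneg t)]
    exact (Real.smoothTransition.le_one t).trans (le_max_left _ _)
  · exact (hC1 t).trans ((le_max_left _ _).trans (le_max_right _ _))
  · exact (hC2 t).trans ((le_max_right _ _).trans (le_max_right _ _))

/-- A parametrix for the Laplacian: up to a smoothing operator, Newtonian potentials are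
convolutions with a kernel supported in a small ball. -/
lemma exists_parametrix (hN : 3 ≤ N) (t₁ : ℝ) : ∃ (k k' k'' m : ℝ → ℝ) (B : ℝ),
    ContDiff ℝ 2 k ∧ (∀ t, HasDerivAt k (k' t) t) ∧ (∀ t, HasDerivAt k' (k'' t) t) ∧
    ContDiff ℝ 1 k' ∧
    (∀ t, |k t| ≤ B * Real.exp ((2 - N) * t) ∧ |k' t| ≤ B * Real.exp ((2 - N) * t) ∧
      |k'' t| ≤ B * Real.exp ((2 - N) * t)) ∧
    (∀ t, t₁ + 1 < t → k t = 0 ∧ k' t = 0 ∧ k'' t = 0) ∧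
    ContDiff ℝ 2 m ∧ (∀ t ≤ t₁ - 1, m t = 0) ∧ (∀ t, t₁ + 2 ≤ t → m t = 0) ∧
    ∀ (a C : ℝ) (f : Euc N → ℝ), 0 < a → a < N - 2 → AEStronglyMeasurable f →
      (∀ x, x ≠ 0 → |f x| ≤ C * ‖x‖ ^ (-a - 2)) → ∀ x, x ≠ 0 →
      pot f x = (∫ y, rad k (x - y) * f y) + ∫ y, rad m (x - y) * pot f y := by
  have hN' : (3 : ℝ) ≤ N := by exact_mod_cast hN
  obtain ⟨ψ₀, ψ₀', ψ₀'', D, hψ, hψ', hψ'', dψ, dψ', hD, hψ1, hz, ho, hz'⟩ := exists_transition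
  have hD0 : 0 ≤ D := (abs_nonneg _).trans (hD 0).1
  have hc := cN_pos hN
  have sh : ∀ n : ℕ∞, ContDiff ℝ n (fun t : ℝ => t - t₁) := fun n => contDiff_id.sub contDiff_const
  set E : ℝ → ℝ := fun t => Real.exp ((2 - N) * t) with hE
  have hEc : ∀ n : ℕ∞, ContDiff ℝ n E := fun n =>
    Real.contDiff_exp.comp (contDiff_const.mul contDiff_id)
  have dE : ∀ t, HasDerivAt E ((2 - N) * E t) t := fun t => by
    have := ((hasDerivAt_id t).const_mul (2 - (N : ℝ))).exp
    refine this.congr_deriv ?_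
    simp [hE]; ring
  have hE0 : ∀ t, 0 < E t := fun t => Real.exp_pos _
  set ψ : ℝ → ℝ := fun t => ψ₀ (t - t₁)
  set ψ' : ℝ → ℝ := fun t => ψ₀' (t - t₁)
  set ψ'' : ℝ → ℝ := fun t => ψ₀'' (t - t₁)
  have dp : ∀ t, HasDerivAt ψ (ψ' t) t := fun t => (dψ (t - t₁)).comp_sub_const t t₁
  have dp' : ∀ t, HasDerivAt ψ' (ψ'' t) t := fun t => (dψ' (t - t₁)).comp_sub_const t t₁
  have cp : ∀ n : ℕ∞, ContDiff ℝ n ψ := fun n => (hψ n).comp (sh n)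
  have cp' : ∀ n : ℕ∞, ContDiff ℝ n ψ' := fun n => (hψ' n).comp (sh n)
  have cp'' : ∀ n : ℕ∞, ContDiff ℝ n ψ'' := fun n => (hψ'' n).comp (sh n)
  have hDb : ∀ t, |ψ t| ≤ D ∧ |ψ' t| ≤ D ∧ |ψ'' t| ≤ D := fun t => hD _
  set b : ℝ := (N : ℝ) - 2 with hb
  have hb1 : 1 ≤ b := by rw [hb]; linarith
  have hEb : ∀ t, HasDerivAt E (-b * E t) t := fun t => by
    convert dE t using 1; rw [hb]; ring
  -- generic bounds for the derivatives of a profile times `E`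
  have bd : ∀ p p' p'' F : ℝ, |p| ≤ F → |p'| ≤ F → |p''| ≤ F →
      |p| ≤ 4 * b ^ 2 * F ∧ |p' - b * p| ≤ 4 * b ^ 2 * F ∧
        |p'' - 2 * b * p' + b ^ 2 * p| ≤ 4 * b ^ 2 * F := by
    intro p p' p'' F h1 h2 h3
    have hF : 0 ≤ F := (abs_nonneg _).trans h1
    have g1 := mul_le_mul_of_nonneg_left h1 (by positivity : 0 ≤ b)
    have g2 := mul_le_mul_of_nonneg_left h2 (by positivity : 0 ≤ b)
    have g3 := mul_le_mul_of_nonneg_left h1 (by positivity : 0 ≤ b ^ 2)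
    have q1 : F ≤ b * F := by nlinarith
    have q2 : b * F ≤ b ^ 2 * F := by nlinarith [mul_nonneg (by linarith : 0 ≤ b) hF]
    rw [abs_le] at h1 h2 h3
    have g1' : |b * p| ≤ b * F := by rwa [abs_mul, abs_of_nonneg (by linarith : 0 ≤ b), ]
    have g2' : |b * p'| ≤ b * F := by rwa [abs_mul, abs_of_nonneg (by linarith : 0 ≤ b)]
    have g3' : |b ^ 2 * p| ≤ b ^ 2 * F := by rwa [abs_mul, abs_of_nonneg (by positivity : 0 ≤ b ^ 2)]
    rw [abs_le] at g1' g2' g3'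
    refine ⟨abs_le.2 ⟨?_, ?_⟩, abs_le.2 ⟨?_, ?_⟩, abs_le.2 ⟨?_, ?_⟩⟩ <;> linarith
  have dprod : ∀ (p p' p'' : ℝ → ℝ), (∀ t, HasDerivAt p (p' t) t) →
      (∀ t, HasDerivAt p' (p'' t) t) → (∀ t, HasDerivAt (fun t => p t * E t)
        ((p' t - b * p t) * E t) t) ∧ (∀ t, HasDerivAt (fun t => (p' t - b * p t) * E t)
        ((p'' t - 2 * b * p' t + b ^ 2 * p t) * E t) t) := by
    intro p p' p'' h1 h2
    refine ⟨fun t => ((h1 t).mul (hEb t)).congr_deriv (by ring), fun t =>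
      ((((h2 t).sub ((h1 t).const_mul b))).mul (hEb t)).congr_deriv (by simp; ring)⟩
  obtain ⟨dh, dh'⟩ := dprod ψ ψ' ψ'' dp dp'
  set χ : ℝ → ℝ := fun t => cN N * (1 - ψ t)
  set χ' : ℝ → ℝ := fun t => cN N * (-ψ' t)
  set χ'' : ℝ → ℝ := fun t => cN N * (-ψ'' t)
  obtain ⟨dk, dk'⟩ := dprod χ χ' χ'' (fun t => ((dp t).const_sub 1).const_mul _)
    (fun t => ((dp' t).neg).const_mul _)
  have hψz : ∀ t, t < t₁ → ψ t = 0 ∧ ψ' t = 0 ∧ ψ'' t = 0 := fun t ht =>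
    ⟨hz _ (by linarith), hz' _ (Or.inl (by linarith))⟩
  have hψo : ∀ t, t₁ + 1 < t → ψ t = 1 ∧ ψ' t = 0 ∧ ψ'' t = 0 := fun t ht =>
    ⟨ho _ (by linarith), hz' _ (Or.inr (by linarith))⟩
  set h : ℝ → ℝ := fun t => ψ t * E t with hh
  set k : ℝ → ℝ := fun t => χ t * E t with hk
  set m : ℝ → ℝ := fun t => -cN N * (ψ'' t - b * ψ' t) * Real.exp (-N * t) with hm
  have hχc : ∀ n : ℕ∞, ContDiff ℝ n χ := fun n => contDiff_const.mul (contDiff_const.sub (cp n))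
  have hχc' : ∀ n : ℕ∞, ContDiff ℝ n χ' := fun n => contDiff_const.mul (cp' n).neg
  have hmc : ContDiff ℝ 2 m := (contDiff_const.mul ((cp'' 2).sub (contDiff_const.mul (cp' 2)))).mul
    (Real.contDiff_exp.comp (contDiff_const.mul contDiff_id))
  have hm0 : ∀ t ≤ t₁ - 1, m t = 0 := by
    intro t ht
    obtain ⟨-, e1, e2⟩ := hψz t (by linarith)
    simp [hm, e1, e2]
  have hm1 : ∀ t, t₁ + 2 ≤ t → m t = 0 := by
    intro t ht
    obtain ⟨-, e1, e2⟩ := hψo t (by linarith)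
    simp [hm, e1, e2]
  refine ⟨k, _, _, m, 4 * b ^ 2 * (cN N * (1 + D)), (hχc 2).mul (hEc 2), dk, dk',
    ((hχc' 1).sub (contDiff_const.mul (hχc 1))).mul (hEc 1), ?_, ?_,
    hmc, hm0, hm1, ?_⟩
  · intro t
    obtain ⟨b1, b2, b3⟩ := hDb t
    have ee : ∀ s : ℝ, |s| ≤ 1 + D → |cN N * s| ≤ cN N * (1 + D) := fun s hs => by
      rw [abs_mul, abs_of_pos hc]; exact mul_le_mul_of_nonneg_left hs hc.le
    obtain ⟨c1, c2, c3⟩ := bd (χ t) (χ' t) (χ'' t) (cN N * (1 + D)) (ee _ (by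
        refine (abs_sub _ _).trans ?_
        simpa using b1)) (ee _ (by rw [abs_neg]; linarith)) (ee _ (by rw [abs_neg]; linarith))
    have := (hE0 t).le
    simp only [hk, abs_mul _ (E t), abs_of_pos (hE0 t)]
    exact ⟨mul_le_mul_of_nonneg_right c1 this, mul_le_mul_of_nonneg_right c2 this,
      mul_le_mul_of_nonneg_right c3 this⟩
  · intro t ht
    obtain ⟨e0, e1, e2⟩ := hψo t ht
    simp [hk, χ, χ', χ'', e0, e1, e2]
  · intro a C f ha ha' hf hfb x hx
    have hmcd : ContDiff ℝ 2 (rad m : Euc N → ℝ) := contDiff_rad (n := 2) hmc hm0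
    have hmcs : HasCompactSupport (rad m : Euc N → ℝ) := hasCompactSupport_rad hm1
    have hrepr : ∀ z : Euc N, z ≠ 0 → cN N * rad h z = pot (rad m) z := by
      intro z hz0
      rw [rad_newton_repr hN ha ha' (g := h)
        (C := 4 * b ^ 2 * D * Real.exp ((a - b) * t₁)) ((cp 2).mul (hEc 2)) dh dh' ?_ hz0]
      · unfold pot
        rw [mul_neg, ← integral_const_mul, ← mul_neg, ← integral_neg]
        congr 1
        refine integral_congr_ae ?_
        filter_upwards [ae_ne_zero (by omega)] with y hy
        rw [lap_rad hy dh (dh' _), rad_of_ne _ hy, ← hb]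
        simp only [hm]
        have : Real.exp (-N * Real.log ‖y‖) = E (Real.log ‖y‖) / ‖y‖ ^ 2 := by
          simp only [hE]
          rw [exp_log_norm hy, exp_log_norm hy, show (2 - (N : ℝ)) = -N + 2 by ring,
            Real.rpow_add (norm_pos_iff.2 hy), Real.rpow_two, mul_div_assoc, div_self, mul_one]
          exact (pow_pos (norm_pos_iff.2 hy) 2).ne'
        rw [this]
        ring
      · intro t
        obtain ⟨b1, b2, b3⟩ := hDb t
        obtain ⟨c1, c2, c3⟩ := bd _ _ _ D b1 b2 b3
        simp only [hh, abs_mul _ (E t), abs_of_pos (hE0 t)]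
        by_cases ht : t < t₁
        · obtain ⟨e0, e1, e2⟩ := hψz t ht
          have : 0 ≤ 4 * b ^ 2 * D * Real.exp ((a - b) * t₁) * Real.exp (-a * t) := by positivity
          simpa [e0, e1, e2] using this
        · have hle : E t ≤ Real.exp ((a - b) * t₁) * Real.exp (-a * t) := by
            rw [hE, ← Real.exp_add]
            refine Real.exp_le_exp.2 ?_
            rw [hb]
            nlinarith
          rw [mul_assoc (4 * b ^ 2 * D)]
          exact ⟨mul_le_mul c1 hle (hE0 t).le (by positivity),
            mul_le_mul c2 hle (hE0 t).le (by positivity),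
            mul_le_mul c3 hle (hE0 t).le (by positivity)⟩
    have hlm : LocallyIntegrable (fun y : Euc N => ‖y‖ ^ (-a)) :=
      locallyIntegrable_norm_rpow (by omega) (by linarith)
    have hcm : Continuous (fun y => rad m (x - y)) :=
      hmcd.continuous.comp (continuous_const.sub continuous_id)
    have hmcs' : HasCompactSupport (fun y => rad m (x - y)) :=
      hmcs.comp_homeomorph (Homeomorph.subLeft x)
    have hsym := integral_mul_pot hN ha ha' hf hfb hcm.aestronglyMeasurable
      (hlm.integrable_smul_right_of_hasCompactSupport hcm hmcs')
    rw [hsym]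
    have hshift : ∀ y, pot (fun t => rad m (x - t)) y = pot (rad m) (x - y) := by
      intro y
      unfold pot
      congr 1
      rw [← integral_sub_left_eq_self _ volume x]
      refine integral_congr_ae (Eventually.of_forall fun t => ?_)
      simp only [sub_sub_cancel]
      rw [show y - (x - t) = -(x - y - t) by abel, norm_neg]
    have hsplit : ∀ᵐ y, cN N * (‖x - y‖ ^ (2 - (N : ℝ)) * f y) =
        rad k (x - y) * f y + pot (fun t => rad m (x - t)) y * f y := by
      have hne : ∀ᵐ y : Euc N, y ≠ x := by
        have : Nontrivial (Euc N) := Module.nontrivial_of_finrank_pos (R := ℝ) (by simp; omega)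
        simp [ae_iff]
      filter_upwards [hne] with y hy
      have hxy : x - y ≠ 0 := sub_ne_zero.2 hy.symm
      rw [hshift, ← hrepr _ hxy, rad_of_ne _ hxy, rad_of_ne _ hxy, ← exp_log_norm hxy]
      simp only [hk, hh, hE, χ]
      ring
    have hpi := (pot_integrable hN ha ha' hf hfb hx).const_mul (cN N)
    have hki : Integrable (fun y => rad k (x - y) * f y) := by
      refine (((pot_integrable hN ha ha' hf hfb hx).norm.const_mul (cN N * (1 + D)))).mono'
        ((((measurable_rad ((hχc 0).continuous.mul (hEc 0).continuous).measurable).comp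
        (measurable_const.sub measurable_id)).aestronglyMeasurable).mul hf) ?_
      refine Eventually.of_forall fun y => ?_
      rw [norm_mul, norm_mul, ← mul_assoc]
      refine mul_le_mul_of_nonneg_right ?_ (norm_nonneg _)
      by_cases hxy : x - y = 0
      · rw [hxy]; simp [rad]; positivity
      · simp only [rad_of_ne _ hxy]
        rw [Real.norm_of_nonneg (r := ‖x - y‖ ^ (2 - (N : ℝ))) (by positivity), ← exp_log_norm hxy,
          norm_mul, Real.norm_of_nonneg (hE0 _).le]
        refine mul_le_mul_of_nonneg_right ?_ (hE0 _).le
        simp only [χ]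
        rw [norm_mul, Real.norm_of_nonneg hc.le, Real.norm_eq_abs]
        refine mul_le_mul_of_nonneg_left ?_ hc.le
        refine (abs_sub _ _).trans ?_
        simpa using (hDb _).1
    have hri : Integrable (fun y => pot (fun t => rad m (x - t)) y * f y) := by
      refine (hpi.sub hki).congr ?_
      filter_upwards [hsplit] with y hy
      simp only [Pi.sub_apply]
      linarith
    rw [← integral_add hki hri, ← integral_congr_ae hsplit, integral_const_mul]
    rfl

lemma integral_fderiv_eq_zero {κ : Euc N → ℝ} (h : ContDiff ℝ 1 κ) (hc : HasCompactSupport κ) :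
    ∫ z, fderiv ℝ κ z = 0 := by
  have h1 := hc.hasFDerivAt_convolution_left (ContinuousLinearMap.mul ℝ ℝ) h
    (locallyIntegrable_const (μ := (volume : Measure (Euc N))) (1 : ℝ)) (0 : Euc N)
  have h2 : (convolution κ (fun _ => (1 : ℝ)) (ContinuousLinearMap.mul ℝ ℝ) volume) =
      fun _ => ∫ z, κ z := by
    ext x
    simp [convolution]
  rw [h2] at h1
  have h3 := h1.unique (hasFDerivAt_const _ _)
  rw [← h3]
  unfold convolution
  refine integral_congr_ae (Eventually.of_forall fun t => ?_)
  ext v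
  simp [ContinuousLinearMap.precompL_apply]

/-- Convolution with a kernel having an integrable weak singularity is differentiable, and the
derivative may be taken under the integral sign after subtracting a constant. -/
lemma hasFDerivAt_singular_integral (hN : 1 ≤ N) {κ f c : Euc N → ℝ} {b B ρ M H γ : ℝ}
    (hκ : ∀ z, z ≠ 0 → ContDiffAt ℝ 1 κ z) (hB : ∀ z, z ≠ 0 → |κ z| ≤ B * ‖z‖ ^ (1 - b))
    (hB' : ∀ z, z ≠ 0 → ‖fderiv ℝ κ z‖ ≤ B * ‖z‖ ^ (-b)) (hρ : ∀ z, ρ < ‖z‖ → κ z = 0)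
    (hf : AEStronglyMeasurable f) (hM : ∀ x, |f x| ≤ M)
    (hH : ∀ x z, |f (x - z) - c x| ≤ H * ‖z‖ ^ γ) (hb : b < N + 1) (hγ : b < N + γ) :
    (∀ x, HasFDerivAt (fun x => ∫ z, κ z * f (x - z))
      (∫ z, (f (x - z) - c x) • fderiv ℝ κ z) x) ∧
    Continuous (fun x => ∫ z, (f (x - z) - c x) • fderiv ℝ κ z) ∧
    ∀ x, Integrable fun z => (f (x - z) - c x) • fderiv ℝ κ z := by
  obtain ⟨ψ, ψ', ψ'', D, hψ, hψ1, -, hd, -, hD, h01, hz, h1, -⟩ := exists_transition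
  have hne := ae_ne_zero (N := N) hN
  have hfl : LocallyIntegrable f :=
    (locallyIntegrable_const M).mono hf (Eventually.of_forall fun x => by
      simpa using (hM x).trans (le_abs_self M))
  have hM0 : 0 ≤ M := (abs_nonneg _).trans (hM 0)
  have hfs : ∀ x, AEStronglyMeasurable (fun z => f (x - z)) := fun x =>
    hf.comp_measurePreserving (Measure.measurePreserving_sub_left volume x)
  have hH0 : ∀ z : Euc N, 0 ≤ H * ‖z‖ ^ γ := fun z => (abs_nonneg _).trans (hH 0 z)
  have hD0 : 0 ≤ D := (abs_nonneg _).trans (hD 0).1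
  set θ : ℕ → Euc N → ℝ := fun (n : ℕ) => rad (fun t => ψ (t + (n : ℝ))) with hθ
  have hθd : ∀ (n : ℕ) z, z ≠ 0 → HasFDerivAt (θ n)
      (ψ' (Real.log ‖z‖ + (n : ℕ)) • (‖z‖ ^ 2)⁻¹ • innerSL ℝ z) z := fun n z hz0 =>
    hasFDerivAt_rad hz0 ((hd _).comp_add_const _ (n : ℝ))
  have hθc : ∀ n, ContDiff ℝ 1 (θ n) := fun n =>
    contDiff_rad (n := 1) (t₀ := -n) ((hψ 1).comp (contDiff_id.add contDiff_const))
      (fun t ht => hz _ (by linarith))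
  set κn : ℕ → Euc N → ℝ := fun n z => κ z * θ n z with hκn
  have hκ1 : ∀ (n : ℕ) z, z ≠ 0 → Real.log ‖z‖ + n > 1 → κn n =ᶠ[nhds z] κ := by
    intro n z hz0 hl
    have hcont : ContinuousAt (fun y : Euc N => Real.log ‖y‖ + n) z :=
      (ContinuousAt.log continuous_norm.continuousAt (norm_ne_zero_iff.2 hz0)).add continuousAt_const
    filter_upwards [hcont.eventually (lt_mem_nhds hl), isOpen_ne.mem_nhds hz0] with y hy hy0
    simp only [hκn, hθ, rad_of_ne _ hy0]
    rw [h1 _ hy.le, mul_one]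
  have hκnc : ∀ n, ContDiff ℝ 1 (κn n) := by
    intro n
    refine contDiff_iff_contDiffAt.2 fun z => ?_
    by_cases hz0 : z = 0
    · have : κn n =ᶠ[nhds z] fun _ => 0 := by
        have := rad_eventuallyEq_zero (N := N) (g := fun t => ψ (t + n)) (t₀ := -n)
          (fun t ht => hz _ (by linarith))
        rw [hz0]
        filter_upwards [this] with y hy
        simp [hκn, hθ, hy]
      exact contDiffAt_const.congr_of_eventuallyEq this
    · exact (hκ z hz0).mul (hθc n).contDiffAt
  have hκnρ : ∀ n z, ρ < ‖z‖ → κn n z = 0 := fun n z hz => by simp [hκn, hρ z hz]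
  have hκns : ∀ n, HasCompactSupport (κn n) := fun n =>
    HasCompactSupport.intro (isCompact_closedBall (0 : Euc N) ρ) fun z hz =>
      hκnρ n z (by simpa using hz)
  have hderρ : ∀ g : Euc N → ℝ, (∀ z, ρ < ‖z‖ → g z = 0) → ∀ z, ρ < ‖z‖ → fderiv ℝ g z = 0 := by
    intro g hg z hz
    have : g =ᶠ[nhds z] fun _ => 0 := by
      filter_upwards [(isOpen_lt continuous_const continuous_norm).mem_nhds hz] with y hy using hg y hy
    rw [this.fderiv_eq]; simp
  have hκnB : ∀ n z, z ≠ 0 → |κn n z| ≤ B * ‖z‖ ^ (1 - b) := by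
    intro n z hz0
    refine le_trans ?_ (hB z hz0)
    simp only [hκn, hθ, rad_of_ne _ hz0]
    rw [abs_mul, abs_of_nonneg (h01 _).1]
    exact mul_le_of_le_one_right (abs_nonneg _) (h01 _).2
  have hκnB' : ∀ n z, z ≠ 0 → ‖fderiv ℝ (κn n) z‖ ≤ (1 + D) * B * ‖z‖ ^ (-b) := by
    intro n z hz0
    have hzp : 0 < ‖z‖ := norm_pos_iff.2 hz0
    have hdd := ((hκ z hz0).differentiableAt (by simp)).hasFDerivAt.mul (hθd n z hz0)
    have hdd' : fderiv ℝ (κn n) z = _ := hdd.fderiv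
    rw [hdd']
    have e1 : ‖θ n z • fderiv ℝ κ z‖ ≤ B * ‖z‖ ^ (-b) := by
      refine le_trans ?_ (hB' z hz0)
      simp only [hθ, rad_of_ne _ hz0]
      rw [norm_smul, Real.norm_of_nonneg (h01 _).1]
      exact mul_le_of_le_one_left (norm_nonneg _) (h01 _).2
    have e2 : ‖κ z • ψ' (Real.log ‖z‖ + (n : ℕ)) • (‖z‖ ^ 2)⁻¹ • innerSL ℝ z‖ ≤
        D * B * ‖z‖ ^ (-b) := by
      rw [norm_smul, norm_smul, norm_smul, innerSL_apply_norm, Real.norm_eq_abs, Real.norm_eq_abs,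
        Real.norm_of_nonneg (by positivity)]
      have e3 : ‖z‖ ^ (1 - b) * ((‖z‖ ^ 2)⁻¹ * ‖z‖) = ‖z‖ ^ (-b) := by
        rw [sub_eq_add_neg, Real.rpow_add hzp, Real.rpow_one]; field_simp
      calc _ ≤ (B * ‖z‖ ^ (1 - b)) * (D * ((‖z‖ ^ 2)⁻¹ * ‖z‖)) := by
            refine mul_le_mul (hB z hz0) (mul_le_mul_of_nonneg_right (hD _).2.1 (by positivity))
              (by positivity) ((abs_nonneg _).trans (hB z hz0))
        _ = D * B * (‖z‖ ^ (1 - b) * ((‖z‖ ^ 2)⁻¹ * ‖z‖)) := by ring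
        _ = _ := by rw [e3]
    calc _ ≤ D * B * ‖z‖ ^ (-b) + B * ‖z‖ ^ (-b) := (norm_add_le _ _).trans (add_le_add e2 e1)
      _ = _ := by ring
  -- integrable majorants
  have hind : ∀ (p C : ℝ), -(N : ℝ) < p →
      Integrable ((closedBall (0 : Euc N) ρ).indicator fun z => C * ‖z‖ ^ p) := by
    intro p C hp
    exact (IntegrableOn.integrable_indicator
      (((locallyIntegrable_norm_rpow hN hp).smul C).integrableOn_isCompact
        (isCompact_closedBall _ _)) measurableSet_closedBall)
  have hmaj : ∀ (p C : ℝ) {G : Type} [NormedAddCommGroup G] (g : Euc N → G),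
      (∀ z, ρ < ‖z‖ → g z = 0) → (∀ z, z ≠ 0 → ‖g z‖ ≤ C * ‖z‖ ^ p) →
      ∀ᵐ z, ‖g z‖ ≤ (closedBall (0 : Euc N) ρ).indicator (fun z => C * ‖z‖ ^ p) z := by
    intro p C G _ g h0 hg
    filter_upwards [hne] with z hz0
    by_cases hzρ : ‖z‖ ≤ ρ
    · rw [Set.indicator_of_mem (by simpa using hzρ)]; exact hg z hz0
    · rw [Set.indicator_of_notMem (by simpa using hzρ), h0 z (not_le.1 hzρ), norm_zero]
  set G : Euc N → (Euc N →L[ℝ] ℝ) := fun x => ∫ z, (f (x - z) - c x) • fderiv ℝ κ z with hG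
  set Gn : ℕ → Euc N → (Euc N →L[ℝ] ℝ) := fun n x =>
    ∫ z, (f (x - z) - c x) • fderiv ℝ (κn n) z with hGn
  have hmeas : ∀ x (g : Euc N → ℝ), AEStronglyMeasurable (fun z => (f (x - z) - c x) • fderiv ℝ g z) :=
    fun x g => ((hfs x).sub aestronglyMeasurable_const).smul
      (measurable_fderiv ℝ g).aestronglyMeasurable
  have hprod : ∀ (g : Euc N → ℝ) (C : ℝ), (∀ z, z ≠ 0 → ‖fderiv ℝ g z‖ ≤ C * ‖z‖ ^ (-b)) →
      ∀ x z, z ≠ 0 → ‖(f (x - z) - c x) • fderiv ℝ g z‖ ≤ H * C * ‖z‖ ^ (γ - b) := by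
    intro g C hg x z hz0
    rw [norm_smul, sub_eq_add_neg γ, Real.rpow_add (norm_pos_iff.2 hz0)]
    calc _ ≤ (H * ‖z‖ ^ γ) * (C * ‖z‖ ^ (-b)) :=
          mul_le_mul (hH x z) (hg z hz0) (norm_nonneg _) (hH0 z)
      _ = _ := by ring
  have hGi : ∀ x, Integrable fun z => (f (x - z) - c x) • fderiv ℝ κ z := fun x =>
    (hind (γ - b) (H * B) (by linarith)).mono' (hmeas x κ)
      (hmaj _ _ _ (fun z hz => by simp [hderρ κ hρ z hz]) (hprod κ B hB' x))
  have hGni : ∀ n x, Integrable fun z => (f (x - z) - c x) • fderiv ℝ (κn n) z := fun n x =>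
    (hind (γ - b) (H * ((1 + D) * B)) (by linarith)).mono' (hmeas x _)
      (hmaj _ _ _ (fun z hz => by simp [hderρ _ (hκnρ n) z hz]) (hprod _ _ (hκnB' n) x))
  have hFn : ∀ n x, HasFDerivAt (fun x => ∫ z, κn n z * f (x - z)) (Gn n x) x := by
    intro n x
    have h := (hκns n).hasFDerivAt_convolution_left (ContinuousLinearMap.mul ℝ ℝ) (hκnc n) hfl x
    refine h.congr_fderiv ?_
    have hzero := integral_fderiv_eq_zero (hκnc n) (hκns n)
    have hi2 : Integrable fun z => c x • fderiv ℝ (κn n) z :=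
      (((hκnc n).continuous_fderiv one_ne_zero).integrable_of_hasCompactSupport
        ((hκns n).fderiv ℝ)).smul (c x)
    have : Gn n x + ∫ z, c x • fderiv ℝ (κn n) z = ∫ z, f (x - z) • fderiv ℝ (κn n) z := by
      simp only [hGn]
      rw [← integral_add (hGni n x) hi2]
      refine integral_congr_ae (Eventually.of_forall fun z => ?_)
      simp only [sub_smul, sub_add_cancel]
    rw [integral_smul, hzero, smul_zero, add_zero] at this
    rw [this]
    unfold convolution
    refine integral_congr_ae (Eventually.of_forall fun t => ?_)
    ext v
    simp [ContinuousLinearMap.precompL_apply, mul_comm]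
  have hlim : ∀ z : Euc N, z ≠ 0 → ∀ᶠ n : ℕ in atTop, κn n =ᶠ[nhds z] κ := by
    intro z hz0
    filter_upwards [(tendsto_natCast_atTop_atTop (R := ℝ)).eventually_gt_atTop (1 - Real.log ‖z‖)]
      with n hn
    exact hκ1 n z hz0 (by linarith)
  have hF : ∀ x, Tendsto (fun n => ∫ z, κn n z * f (x - z)) atTop
      (nhds (∫ z, κ z * f (x - z))) := by
    intro x
    refine tendsto_integral_of_dominated_convergence _
      (fun n => ((hκnc n).continuous.aestronglyMeasurable).mul (hfs x))
      (hind (1 - b) (B * M) (by linarith)) (fun n => hmaj _ _ _ ?_ ?_) ?_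
    · intro z hz; simp [hκnρ n z hz]
    · intro z hz0
      rw [norm_mul]
      calc _ ≤ (B * ‖z‖ ^ (1 - b)) * M := mul_le_mul (hκnB n z hz0) (hM _) (abs_nonneg _)
            ((abs_nonneg _).trans (hκnB n z hz0))
        _ = _ := by ring
    · filter_upwards [hne] with z hz0
      refine tendsto_const_nhds.congr' ?_
      filter_upwards [hlim z hz0] with n hn
      rw [hn.eq_of_nhds]
  have hε : Tendsto (fun n => ∫ z, H * ‖z‖ ^ γ * ‖fderiv ℝ (κn n) z - fderiv ℝ κ z‖) atTop
      (nhds (∫ z : Euc N, 0)) := by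
    refine tendsto_integral_of_dominated_convergence _
      (fun n => ((continuous_norm.measurable.pow_const γ).const_mul H |>.mul
        (((measurable_fderiv ℝ _).sub (measurable_fderiv ℝ _)).norm)).aestronglyMeasurable)
      (hind (γ - b) (H * ((2 + D) * B)) (by linarith)) (fun n => hmaj _ _ _ ?_ ?_) ?_
    · intro z hz; simp [hderρ _ (hκnρ n) z hz, hderρ _ hρ z hz]
    · intro z hz0
      rw [norm_mul, Real.norm_of_nonneg (hH0 z), norm_norm, sub_eq_add_neg γ,
        Real.rpow_add (norm_pos_iff.2 hz0)]
      calc _ ≤ (H * ‖z‖ ^ γ) * ((1 + D) * B * ‖z‖ ^ (-b) + B * ‖z‖ ^ (-b)) :=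
            mul_le_mul_of_nonneg_left ((norm_sub_le _ _).trans
              (add_le_add (hκnB' n z hz0) (hB' z hz0))) (hH0 z)
        _ = _ := by ring
    · filter_upwards [hne] with z hz0
      refine tendsto_const_nhds.congr' ?_
      filter_upwards [hlim z hz0] with n hn
      rw [hn.fderiv_eq]; simp
  rw [integral_zero] at hε
  have hunif : TendstoUniformly Gn G atTop := by
    rw [Metric.tendstoUniformly_iff]
    intro ε hε0
    filter_upwards [hε.eventually (gt_mem_nhds hε0)] with n hn x
    refine lt_of_le_of_lt ?_ hn
    rw [dist_comm, dist_eq_norm]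
    simp only [hG, hGn]
    rw [← integral_sub (hGni n x) (hGi x)]
    refine norm_integral_le_of_norm_le ?_ (Eventually.of_forall fun z => ?_)
    · refine (hind (γ - b) (H * ((2 + D) * B)) (by linarith)).mono'
        ((continuous_norm.measurable.pow_const γ).const_mul H |>.mul
        (((measurable_fderiv ℝ _).sub (measurable_fderiv ℝ _)).norm)).aestronglyMeasurable
        (hmaj _ _ _ ?_ ?_)
      · intro z hz; simp [hderρ _ (hκnρ n) z hz, hderρ _ hρ z hz]
      · intro z hz0
        rw [norm_mul, Real.norm_of_nonneg (hH0 z), norm_norm, sub_eq_add_neg γ,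
          Real.rpow_add (norm_pos_iff.2 hz0)]
        calc _ ≤ (H * ‖z‖ ^ γ) * ((1 + D) * B * ‖z‖ ^ (-b) + B * ‖z‖ ^ (-b)) :=
              mul_le_mul_of_nonneg_left ((norm_sub_le _ _).trans
                (add_le_add (hκnB' n z hz0) (hB' z hz0))) (hH0 z)
          _ = _ := by ring
    · rw [← smul_sub, norm_smul]
      exact mul_le_mul_of_nonneg_right (hH x z) (norm_nonneg _)
  refine ⟨fun x => hasFDerivAt_of_tendstoUniformly hunif (fun n x => hFn n x) hF x, ?_, hGi⟩
  refine hunif.continuous (Frequently.of_forall fun n => ?_)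
  have : Gn n = fderiv ℝ (fun x => ∫ z, κn n z * f (x - z)) := by
    ext1 x; exact (hFn n x).fderiv.symm
  rw [this]
  exact (HasCompactSupport.contDiff_convolution_left (n := 1) (ContinuousLinearMap.mul ℝ ℝ) (hκns n)
    (by exact_mod_cast hκnc n) hfl).continuous_fderiv (by simp)

lemma integral_sub_left_mul (κ f : Euc N → ℝ) :
    (fun x => ∫ y, κ (x - y) * f y) = fun x => ∫ z, κ z * f (x - z) := by
  ext x
  rw [← integral_sub_left_eq_self _ volume x]
  simp only [sub_sub_cancel]

lemma lt_log_norm {t : ℝ} {z : Euc N} (h : Real.exp t < ‖z‖) : z ≠ 0 ∧ t < Real.log ‖z‖ := by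
  have hz : 0 < ‖z‖ := (Real.exp_pos t).trans h
  exact ⟨norm_pos_iff.1 hz, (Real.lt_log_iff_exp_lt hz).2 h⟩

lemma norm_fderiv_rad_le {k k' : ℝ → ℝ} {B p : ℝ} (hk : ∀ t, HasDerivAt k (k' t) t)
    (hB : ∀ t, |k' t| ≤ B * Real.exp (p * t)) {z : Euc N} (hz : z ≠ 0) :
    ‖fderiv ℝ (rad k) z‖ ≤ B * ‖z‖ ^ (p - 1) := by
  have hzp := norm_pos_iff.2 hz
  rw [(hasFDerivAt_rad hz (hk _)).fderiv, norm_smul, norm_smul, innerSL_apply_norm,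
    Real.norm_eq_abs, Real.norm_of_nonneg (by positivity), Real.rpow_sub hzp, Real.rpow_one]
  calc _ ≤ (B * Real.exp (p * Real.log ‖z‖)) * ((‖z‖ ^ 2)⁻¹ * ‖z‖) :=
        mul_le_mul_of_nonneg_right (hB _) (by positivity)
    _ = _ := by rw [exp_log_norm hz]; field_simp

lemma abs_rad_le {k : ℝ → ℝ} {B p : ℝ} (hB : ∀ t, |k t| ≤ B * Real.exp (p * t)) {z : Euc N}
    (hz : z ≠ 0) : |rad k z| ≤ B * ‖z‖ ^ p := by
  rw [rad_of_ne _ hz, ← exp_log_norm hz]; exact hB _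

lemma hasFDerivAt_rad_convolution (hN : 3 ≤ N) {k k' : ℝ → ℝ} {B t₁ M : ℝ} {f : Euc N → ℝ}
    (hk2 : ContDiff ℝ 2 k) (hk : ∀ t, HasDerivAt k (k' t) t)
    (hB : ∀ t, |k t| ≤ B * Real.exp ((2 - N) * t) ∧ |k' t| ≤ B * Real.exp ((2 - N) * t))
    (h0 : ∀ t, t₁ < t → k t = 0) (hf : AEStronglyMeasurable f) (hM : ∀ x, |f x| ≤ M) :
    ContDiff ℝ 1 (fun x => ∫ y, rad k (x - y) * f y) ∧ ∀ x v,
      fderiv ℝ (fun x => ∫ y, rad k (x - y) * f y) x v =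
        ∫ y, fderiv ℝ (rad k) (x - y) v * f y := by
  have h := hasFDerivAt_singular_integral (κ := rad k) (f := f) (c := fun _ => 0) (b := N - 1)
    (γ := 0) (H := M) (M := M) (B := B) (ρ := Real.exp t₁) (by omega)
    (fun z hz => (contDiffAt_rad hk2 hz).of_le (by norm_num))
    (fun z hz => by
      rw [show 1 - ((N : ℝ) - 1) = 2 - N by ring]; exact abs_rad_le (fun t => (hB t).1) hz)
    (fun z hz => by
      rw [show -((N : ℝ) - 1) = 2 - N - 1 by ring]
      exact norm_fderiv_rad_le hk (fun t => (hB t).2) hz)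
    (fun z hz => by rw [rad_of_ne _ (lt_log_norm hz).1]; exact h0 _ (lt_log_norm hz).2)
    hf hM (fun x z => by simpa using hM _) (by linarith) (by linarith)
  rw [integral_sub_left_mul]
  obtain ⟨h1, h2, h3⟩ := h
  have hfd : fderiv ℝ (fun x => ∫ z, rad k z * f (x - z)) = _ := funext fun x => (h1 x).fderiv
  refine ⟨contDiff_one_iff_fderiv.2 ⟨fun x => (h1 x).differentiableAt, ?_⟩, fun x v => ?_⟩
  · rw [hfd]; exact h2
  · rw [hfd, ContinuousLinearMap.integral_apply (h3 x)]
    have := congrFun (integral_sub_left_mul (fun z => fderiv ℝ (rad k) z v) f) x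
    rw [this]
    simp [mul_comm]

lemma contDiff_two_rad_convolution (hN : 3 ≤ N) {k k' k'' : ℝ → ℝ} {B t₁ M H γ : ℝ}
    {f : Euc N → ℝ} (hk2 : ContDiff ℝ 2 k) (hk : ∀ t, HasDerivAt k (k' t) t)
    (hk' : ∀ t, HasDerivAt k' (k'' t) t)
    (hB : ∀ t, |k t| ≤ B * Real.exp ((2 - N) * t) ∧ |k' t| ≤ B * Real.exp ((2 - N) * t) ∧
      |k'' t| ≤ B * Real.exp ((2 - N) * t))
    (h0 : ∀ t, t₁ < t → k t = 0) (hf : AEStronglyMeasurable f) (hM : ∀ x, |f x| ≤ M)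
    (hγ : 0 < γ) (hH : ∀ x y, |f x - f y| ≤ H * ‖x - y‖ ^ γ) :
    ContDiff ℝ 2 (fun x => ∫ y, rad k (x - y) * f y) := by
  obtain ⟨h1, h2⟩ := hasFDerivAt_rad_convolution hN hk2 hk
    (fun t => ⟨(hB t).1, (hB t).2.1⟩) h0 hf hM
  rw [show (2 : WithTop ℕ∞) = 1 + 1 by norm_num, contDiff_succ_iff_fderiv_apply]
  refine ⟨h1.differentiable (by simp), by simp, fun v => ?_⟩
  simp only [h2]
  rw [integral_sub_left_mul (fun z => fderiv ℝ (rad k) z v)]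
  have hB0 : 0 ≤ B := by simpa using (abs_nonneg _).trans (hB 0).1
  have hq : ∀ t, HasDerivAt (fun t => k' t * Real.exp (-2 * t))
      ((k'' t - 2 * k' t) * Real.exp (-2 * t)) t := by
    intro t
    have := (hk' t).mul (((hasDerivAt_id t).const_mul (-2)).exp)
    refine this.congr_deriv ?_
    simp; ring
  have hloc : ∀ z : Euc N, z ≠ 0 → (fun z => fderiv ℝ (rad k) z v) =ᶠ[nhds z]
      fun z => rad (fun t => k' t * Real.exp (-2 * t)) z * inner ℝ z v := by
    intro z hz
    filter_upwards [isOpen_ne.mem_nhds hz] with y hy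
    rw [(hasFDerivAt_rad hy (hk _)).fderiv, rad_of_ne _ hy, exp_log_norm hy, Real.rpow_neg (norm_nonneg _)]
    simp [mul_assoc]
  have hq' : ∀ t, |(k'' t - 2 * k' t) * Real.exp (-2 * t)| ≤ 3 * B * Real.exp (-N * t) := by
    intro t
    rw [abs_mul, abs_of_pos (Real.exp_pos _), show -(N : ℝ) * t = (2 - N) * t + -2 * t by ring,
      Real.exp_add, ← mul_assoc]
    refine mul_le_mul_of_nonneg_right ?_ (Real.exp_pos _).le
    have := hB t
    have h3 := abs_sub (k'' t) (2 * k' t)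
    rw [abs_mul, abs_two] at h3
    linarith
  have hq0 : ∀ t, |k' t * Real.exp (-2 * t)| ≤ B * Real.exp (-N * t) := by
    intro t
    rw [abs_mul, abs_of_pos (Real.exp_pos _), show -(N : ℝ) * t = (2 - N) * t + -2 * t by ring,
      Real.exp_add, ← mul_assoc]
    exact mul_le_mul_of_nonneg_right (hB t).2.1 (Real.exp_pos _).le
  have hg := hasFDerivAt_singular_integral (κ := fun z => fderiv ℝ (rad k) z v) (f := f) (c := f)
    (b := N) (γ := γ) (H := H) (M := M) (B := 4 * B * ‖v‖) (ρ := Real.exp t₁) (by omega)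
    (fun z hz => by
      have : ContDiffAt ℝ 1 (fderiv ℝ (rad k)) z :=
        (contDiffAt_rad hk2 hz).fderiv_right (by norm_num)
      exact this.clm_apply contDiffAt_const)
    (fun z hz => by
      rw [show 1 - (N : ℝ) = 2 - N - 1 by ring, ← Real.norm_eq_abs]
      refine (ContinuousLinearMap.le_opNorm _ _).trans ?_
      calc _ ≤ B * ‖z‖ ^ (2 - (N : ℝ) - 1) * ‖v‖ := mul_le_mul_of_nonneg_right
            (norm_fderiv_rad_le hk (fun t => (hB t).2.1) hz) (norm_nonneg _)
        _ = 1 * (B * ‖v‖ * ‖z‖ ^ (2 - (N : ℝ) - 1)) := by ring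
        _ ≤ 4 * (B * ‖v‖ * ‖z‖ ^ (2 - (N : ℝ) - 1)) :=
            mul_le_mul_of_nonneg_right (by norm_num) (by positivity)
        _ = _ := by ring)
    (fun z hz => by
      have hzp := norm_pos_iff.2 hz
      have hin : HasFDerivAt (fun z : Euc N => inner ℝ z v) (innerSL ℝ v) z := by
        have := (innerSL ℝ v).hasFDerivAt (x := z)
        refine this.congr_of_eventuallyEq (Eventually.of_forall fun y => ?_)
        simp [real_inner_comm]
      rw [(hloc z hz).fderiv_eq, ((hasFDerivAt_rad hz (hq _)).differentiableAt.hasFDerivAt.fun_mul hin).fderiv]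
      refine (norm_add_le _ _).trans ?_
      rw [norm_smul, norm_smul, innerSL_apply_norm, Real.norm_eq_abs, Real.norm_eq_abs]
      have a1 := abs_rad_le hq0 hz
      have a2 := norm_fderiv_rad_le hq hq' hz
      have a3 := abs_real_inner_le_norm z v
      have e : ‖z‖ ^ (-(N : ℝ) - 1) * ‖z‖ = ‖z‖ ^ (-(N : ℝ)) := by
        rw [Real.rpow_sub hzp, Real.rpow_one]; field_simp
      calc _ ≤ (B * ‖z‖ ^ (-(N : ℝ))) * ‖v‖ + (‖z‖ * ‖v‖) * (3 * B * ‖z‖ ^ (-(N : ℝ) - 1)) := by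
            gcongr
        _ = B * ‖v‖ * ‖z‖ ^ (-(N : ℝ)) + 3 * B * ‖v‖ * (‖z‖ ^ (-(N : ℝ) - 1) * ‖z‖) := by ring
        _ = _ := by rw [e]; ring)
    (fun z hz => by
      have : rad k =ᶠ[nhds z] fun _ => 0 := by
        filter_upwards [(isOpen_lt continuous_const continuous_norm).mem_nhds hz] with y hy
        rw [rad_of_ne _ (lt_log_norm hy).1]; exact h0 _ (lt_log_norm hy).2
      rw [this.fderiv_eq]; simp)
    hf hM (fun x z => by simpa [norm_neg] using hH (x - z) x) (by linarith) (by linarith)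
  obtain ⟨h3, h4, -⟩ := hg
  have hfd : fderiv ℝ (fun x => ∫ z, fderiv ℝ (rad k) z v * f (x - z)) = _ :=
    funext fun x => (h3 x).fderiv
  refine contDiff_one_iff_fderiv.2 ⟨fun x => (h3 x).differentiableAt, ?_⟩
  rw [hfd]; exact h4

lemma locallyIntegrable_pot (hN : 3 ≤ N) {a C : ℝ} (ha : 0 < a) (ha' : a < N - 2)
    {f : Euc N → ℝ} (hf : AEStronglyMeasurable f)
    (hfb : ∀ x, x ≠ 0 → |f x| ≤ C * ‖x‖ ^ (-a - 2)) : LocallyIntegrable (pot f) := by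
  refine locallyIntegrable_of_abs_le_rpow (p := -a) (by omega) (by linarith)
    (aestronglyMeasurable_pot hf)
    (fun x hx => le_trans ?_ (integral_newton_abs_le hN ha ha' hf hfb hx))
  unfold pot
  rw [abs_mul, abs_of_pos (cN_pos hN)]
  exact mul_le_mul_of_nonneg_left (by rw [← Real.norm_eq_abs]; exact norm_integral_le_integral_norm _)
    (cN_pos hN).le

lemma pot_localize (hN : 3 ≤ N) {a C r : ℝ} (ha : 0 < a) (ha' : a < N - 2) {f χ : Euc N → ℝ}
    (hf : AEStronglyMeasurable f) (hfb : ∀ x, x ≠ 0 → |f x| ≤ C * ‖x‖ ^ (-a - 2)) {x₀ : Euc N}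
    (hr : 0 < r) (hrx : 4 * r ≤ ‖x₀‖) (hχ : ∀ y ∈ closedBall x₀ (2 * r), χ y = 1) :
    ∃ (k k' k'' : ℝ → ℝ) (B t₁ : ℝ) (S : Euc N → ℝ), ContDiff ℝ 2 k ∧
      (∀ t, HasDerivAt k (k' t) t) ∧ (∀ t, HasDerivAt k' (k'' t) t) ∧
      (∀ t, |k t| ≤ B * Real.exp ((2 - N) * t) ∧ |k' t| ≤ B * Real.exp ((2 - N) * t) ∧
        |k'' t| ≤ B * Real.exp ((2 - N) * t)) ∧ (∀ t, t₁ < t → k t = 0) ∧ ContDiff ℝ 2 S ∧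
      pot f =ᶠ[nhds x₀] fun x => (∫ y, rad k (x - y) * (χ y * f y)) + S x := by
  obtain ⟨k, k', k'', m, B, hk2, hk, hk', -, hB, h0, hm, hm0, hm1, hrep⟩ :=
    exists_parametrix (N := N) hN (Real.log r - 1)
  refine ⟨k, k', k'', B, Real.log r, fun x => ∫ y, rad m (x - y) * pot f y, hk2, hk, hk', hB,
    fun t ht => (h0 t (by linarith)).1, ?_, ?_⟩
  · rw [integral_sub_left_mul]
    exact (hasCompactSupport_rad (t₁ := Real.log r - 1 + 2) hm1).contDiff_convolution_left (n := 2)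
      (ContinuousLinearMap.mul ℝ ℝ) (contDiff_rad (n := 2) (t₀ := Real.log r - 1 - 1) hm hm0)
      (locallyIntegrable_pot hN ha ha' hf hfb)
  · filter_upwards [ball_mem_nhds x₀ hr] with x hx
    have hx0 : x ≠ 0 := by
      rintro rfl
      rw [mem_ball, dist_zero_left] at hx
      linarith
    rw [hrep a C f ha ha' hf hfb x hx0]
    congr 1
    refine integral_congr_ae (Eventually.of_forall fun y => ?_)
    simp only
    by_cases hy : y ∈ closedBall x₀ (2 * r)
    · rw [hχ y hy, one_mul]
    · have hxy : Real.exp (Real.log r) < ‖x - y‖ := by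
        rw [Real.exp_log hr, ← dist_eq_norm, dist_comm]
        rw [mem_closedBall, not_le] at hy
        rw [mem_ball] at hx
        linarith [dist_triangle y x x₀]
      obtain ⟨h1, h2⟩ := lt_log_norm hxy
      rw [rad_of_ne _ h1, (h0 _ (by linarith)).1]
      simp

lemma exists_bump {x₀ : Euc N} {r : ℝ} (hr : 0 < r) : ∃ (χ : Euc N → ℝ) (L : ℝ), Continuous χ ∧ 0 ≤ L ∧
    (∀ y ∈ closedBall x₀ (2 * r), χ y = 1) ∧ (∀ y, 3 * r ≤ dist y x₀ → χ y = 0) ∧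
    (∀ y, 0 ≤ χ y ∧ χ y ≤ 1) ∧ ∀ y z, |χ y - χ z| ≤ L * ‖y - z‖ := by
  let χ : ContDiffBump x₀ := ⟨2 * r, 3 * r, by positivity, by linarith⟩
  have hs : ContDiff ℝ 1 (χ : Euc N → ℝ) := χ.contDiff
  obtain ⟨L, hL⟩ := hs.lipschitzWith_of_hasCompactSupport χ.hasCompactSupport one_ne_zero
  refine ⟨χ, L, hs.continuous, L.2, fun y hy => χ.one_of_mem_closedBall hy,
    fun y hy => χ.zero_of_le_dist hy, fun y => ⟨χ.nonneg, χ.le_one⟩, fun y z => ?_⟩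
  have := hL.dist_le_mul y z
  rwa [Real.dist_eq, dist_eq_norm] at this

lemma abs_le_of_dist_lt {a C r : ℝ} (ha : 0 < a) {f : Euc N → ℝ}
    (hfb : ∀ x, x ≠ 0 → |f x| ≤ C * ‖x‖ ^ (-a - 2)) {x₀ : Euc N} (hr : 0 < r)
    (hrx : 4 * r ≤ ‖x₀‖) {y : Euc N} (hy : dist y x₀ < 3 * r) : |f y| ≤ C * r ^ (-a - 2) := by
  have hx0 : x₀ ≠ 0 := norm_pos_iff.1 (by linarith)
  have hyr : r ≤ ‖y‖ := by
    have := norm_sub_norm_le x₀ y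
    rw [← dist_eq_norm, dist_comm] at this
    linarith
  have hC : 0 ≤ C := by
    have h1 := (abs_nonneg _).trans (hfb x₀ hx0)
    exact nonneg_of_mul_nonneg_left h1 (Real.rpow_pos_of_pos (norm_pos_iff.2 hx0) _)
  refine (hfb y (norm_pos_iff.1 (by linarith))).trans (mul_le_mul_of_nonneg_left ?_ hC)
  exact Real.rpow_le_rpow_of_nonpos hr hyr (by linarith)

lemma contDiffAt_one_pot (hN : 3 ≤ N) {a C : ℝ} (ha : 0 < a) (ha' : a < N - 2) {f : Euc N → ℝ}
    (hf : AEStronglyMeasurable f) (hfb : ∀ x, x ≠ 0 → |f x| ≤ C * ‖x‖ ^ (-a - 2)) {x₀ : Euc N}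
    (hx₀ : x₀ ≠ 0) : ContDiffAt ℝ 1 (pot f) x₀ := by
  have hp := norm_pos_iff.2 hx₀
  set r := ‖x₀‖ / 4 with hr
  have hr0 : 0 < r := by positivity
  obtain ⟨χ, L, hχc, -, h1, h0, h01, -⟩ := exists_bump (x₀ := x₀) hr0
  obtain ⟨k, k', k'', B, t₁, S, hk2, hk, hk', hB, hk0, hS, heq⟩ :=
    pot_localize hN ha ha' hf hfb hr0 (by linarith) h1
  have hb : ∀ x, |χ x * f x| ≤ C * r ^ (-a - 2) := by
    intro x
    have hx0' := abs_le_of_dist_lt ha hfb hr0 (by linarith : 4 * r ≤ ‖x₀‖)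
      (y := x₀) (by simpa using by positivity)
    rcases lt_or_ge (dist x x₀) (3 * r) with hx | hx
    · rw [abs_mul, abs_of_nonneg (h01 x).1]
      exact (mul_le_of_le_one_left (abs_nonneg _) (h01 x).2).trans
        (abs_le_of_dist_lt ha hfb hr0 (by linarith) hx)
    · rw [h0 x hx, zero_mul, abs_zero]; exact (abs_nonneg _).trans hx0'
  have := (hasFDerivAt_rad_convolution hN hk2 hk (fun t => ⟨(hB t).1, (hB t).2.1⟩) hk0
    (hχc.aestronglyMeasurable.mul hf) hb).1
  exact (this.add (hS.of_le (by norm_num))).contDiffAt.congr_of_eventuallyEq heq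

lemma contDiffAt_two_pot (hN : 3 ≤ N) {a C γ ε H : ℝ} (ha : 0 < a) (ha' : a < N - 2)
    {f : Euc N → ℝ}
    (hf : AEStronglyMeasurable f) (hfb : ∀ x, x ≠ 0 → |f x| ≤ C * ‖x‖ ^ (-a - 2)) {x₀ : Euc N}
    (hx₀ : x₀ ≠ 0) (hγ : 0 < γ) (hγ1 : γ ≤ 1) (hε : 0 < ε) (hH : 0 ≤ H)
    (hfH : ∀ y ∈ ball x₀ ε, ∀ z ∈ ball x₀ ε, |f y - f z| ≤ H * ‖y - z‖ ^ γ) :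
    ContDiffAt ℝ 2 (pot f) x₀ := by
  have hp := norm_pos_iff.2 hx₀
  set r := min (‖x₀‖ / 4) (ε / 4) with hr
  have hr0 : 0 < r := by positivity
  have hr1 : 4 * r ≤ ‖x₀‖ := by linarith [min_le_left (‖x₀‖ / 4) (ε / 4)]
  have hr2 : 4 * r ≤ ε := by linarith [min_le_right (‖x₀‖ / 4) (ε / 4)]
  obtain ⟨χ, L, hχc, hL0, h1, h0, h01, hL⟩ := exists_bump (x₀ := x₀) hr0
  obtain ⟨k, k', k'', B, t₁, S, hk2, hk, hk', hB, hk0, hS, heq⟩ :=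
    pot_localize hN ha ha' hf hfb hr0 hr1 h1
  set M := C * r ^ (-a - 2) with hMdef
  have hbd : ∀ y, dist y x₀ < 3 * r → |f y| ≤ M := fun y hy =>
    abs_le_of_dist_lt ha hfb hr0 hr1 hy
  have hM0 : 0 ≤ M := (abs_nonneg _).trans (hbd x₀ (by simpa using by positivity))
  have hb : ∀ x, |χ x * f x| ≤ M := by
    intro x
    rcases lt_or_ge (dist x x₀) (3 * r) with hx | hx
    · rw [abs_mul, abs_of_nonneg (h01 x).1]
      exact (mul_le_of_le_one_left (abs_nonneg _) (h01 x).2).trans (hbd x hx)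
    · rw [h0 x hx, zero_mul, abs_zero]; exact hM0
  have hχH : ∀ y z, |χ y - χ z| ≤ L ^ γ * ‖y - z‖ ^ γ := by
    intro y z
    rw [← Real.mul_rpow hL0 (norm_nonneg _)]
    have hn : 0 ≤ L * ‖y - z‖ := by positivity
    rcases le_total (L * ‖y - z‖) 1 with h | h
    · refine (hL y z).trans ?_
      calc L * ‖y - z‖ = (L * ‖y - z‖) ^ (1 : ℝ) := (Real.rpow_one _).symm
        _ ≤ _ := Real.rpow_le_rpow_of_exponent_ge_of_imp hn h hγ1 (by intro _ h'; linarith)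
    · refine le_trans ?_ (Real.one_le_rpow h hγ.le)
      rw [abs_le]
      constructor <;> linarith [h01 y, h01 z]
  have key : ∀ y z, dist y x₀ < 3 * r →
      |χ y * f y - χ z * f z| ≤ (H + M * L ^ γ) * ‖y - z‖ ^ γ := by
    intro y z hy
    have e1 : |χ y - χ z| * |f y| ≤ L ^ γ * ‖y - z‖ ^ γ * M :=
      mul_le_mul (hχH y z) (hbd y hy) (abs_nonneg _) (by positivity)
    have e0 : 0 ≤ H * ‖y - z‖ ^ γ := by positivity
    rcases lt_or_ge (dist z x₀) (3 * r) with hz | hz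
    · have e2 : |χ z| * |f y - f z| ≤ H * ‖y - z‖ ^ γ := by
        rw [abs_of_nonneg (h01 z).1]
        exact (mul_le_of_le_one_left (abs_nonneg _) (h01 z).2).trans
          (hfH y (by rw [mem_ball]; linarith) z (by rw [mem_ball]; linarith))
      calc _ = |(χ y - χ z) * f y + χ z * (f y - f z)| := by congr 1; ring
        _ ≤ |χ y - χ z| * |f y| + |χ z| * |f y - f z| := by
          rw [← abs_mul, ← abs_mul]; exact abs_add_le _ _
        _ ≤ _ := by linarith
    · have : χ y * f y - χ z * f z = (χ y - χ z) * f y := by rw [h0 z hz]; ring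
      rw [this, abs_mul]
      linarith
  have hHol : ∀ y z, |χ y * f y - χ z * f z| ≤ (H + M * L ^ γ) * ‖y - z‖ ^ γ := by
    intro y z
    rcases lt_or_ge (dist y x₀) (3 * r) with hy | hy
    · exact key y z hy
    · rcases lt_or_ge (dist z x₀) (3 * r) with hz | hz
      · rw [abs_sub_comm, norm_sub_rev]; exact key z y hz
      · rw [h0 y hy, h0 z hz]; simp; positivity
  have := contDiff_two_rad_convolution hN hk2 hk hk' hB hk0 (hχc.aestronglyMeasurable.mul hf) hb
    hγ hHol
  exact (this.add hS).contDiffAt.congr_of_eventuallyEq heq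

lemma LocHolderOn.continuousAt {γ : ℝ} (hγ : 0 < γ) {V : Euc N → ℝ}
    (h : LocHolderOn γ {x : Euc N | x ≠ 0} V) {x : Euc N} (hx : x ≠ 0) : ContinuousAt V x := by
  obtain ⟨ε, hε, C, hC, hb⟩ := h x hx
  rw [ContinuousAt, tendsto_iff_dist_tendsto_zero]
  have h0 : Tendsto (fun y => C * dist y x ^ γ) (nhds x) (nhds 0) := by
    have : ContinuousAt (fun y => C * dist y x ^ γ) x :=
      ((continuous_id.dist continuous_const).continuousAt.rpow_const (Or.inr hγ.le)).const_mul C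
    have h2 := this.tendsto
    simp only [dist_self, Real.zero_rpow hγ.ne', mul_zero] at h2
    exact h2
  refine squeeze_zero' (Eventually.of_forall fun _ => dist_nonneg) ?_ h0
  filter_upwards [ball_mem_nhds x hε, isOpen_ne.mem_nhds hx] with y hy hy0
  exact hb y ⟨hy, hy0⟩ x ⟨mem_ball_self hε, hx⟩

lemma aestronglyMeasurable_of_continuousAt (hN : 1 ≤ N) {V : Euc N → ℝ}
    (h : ∀ x, x ≠ 0 → ContinuousAt V x) : AEStronglyMeasurable V := by
  have h1 : ContinuousOn V {x : Euc N | x ≠ 0} := fun x hx => (h x hx).continuousWithinAt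
  have h2 := h1.aestronglyMeasurable (μ := volume) isOpen_ne.measurableSet
  have h3 : volume.restrict {x : Euc N | x ≠ 0} = volume :=
    Measure.restrict_eq_self_of_ae_mem (ae_ne_zero hN)
  rwa [h3] at h2

lemma continuousAt_lap {v : Euc N → ℝ} {x : Euc N} (h : ContDiffAt ℝ 2 v x) :
    ContinuousAt (lap v) x := by
  unfold lap
  refine tendsto_finsetSum _ fun i _ => ?_
  have h1 : ContDiffAt ℝ 1 (fderiv ℝ v) x := h.fderiv_right (by norm_num)
  have h2 : ContDiffAt ℝ 1 (fun y => fderiv ℝ v y (EuclideanSpace.single i 1)) x :=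
    h1.clm_apply contDiffAt_const
  have h3 : ContDiffAt ℝ 0 (fderiv ℝ (fun y => fderiv ℝ v y (EuclideanSpace.single i 1))) x :=
    h2.fderiv_right (by norm_num)
  exact (h3.clm_apply contDiffAt_const).continuousAt

lemma lap_pot_eq (hN : 3 ≤ N) {a C : ℝ} (ha : 0 < a) (ha' : a < N - 2)
    {f : Euc N → ℝ}
    (hf : AEStronglyMeasurable f) (hfb : ∀ x, x ≠ 0 → |f x| ≤ C * ‖x‖ ^ (-a - 2))
    (hfc : ∀ x, x ≠ 0 → ContinuousAt f x) (h2 : ∀ x, x ≠ 0 → ContDiffAt ℝ 2 (pot f) x)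
    {x₀ : Euc N} (hx₀ : x₀ ≠ 0) : lap (pot f) x₀ = -f x₀ := by
  have hp := norm_pos_iff.2 hx₀
  set r := ‖x₀‖ / 4 with hr
  have hr0 : 0 < r := by positivity
  let χ : ContDiffBump x₀ := ⟨2 * r, 3 * r, by positivity, by linarith⟩
  have hne : ∀ y ∈ ball x₀ (2 * r), y ≠ 0 := by
    rintro y hy rfl
    rw [mem_ball, dist_zero_left] at hy
    linarith
  have hvC : IsC11c (fun x => χ x * pot f x) := by
    refine IsC11c.of_contDiff (contDiff_iff_contDiffAt.2 fun y => ?_) χ.hasCompactSupport.mul_right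
    by_cases hy : y = 0
    · have h0 : y ∈ (closedBall x₀ (3 * r))ᶜ := by
        rw [hy, Set.mem_compl_iff, mem_closedBall, dist_zero_left]; linarith
      have : (fun x => χ x * pot f x) =ᶠ[nhds y] fun _ => 0 := by
        filter_upwards [isClosed_closedBall.isOpen_compl.mem_nhds h0] with z hz
        rw [Set.mem_compl_iff, mem_closedBall, not_le] at hz
        rw [χ.zero_of_le_dist hz.le, zero_mul]
      exact contDiffAt_const.congr_of_eventuallyEq this
    · exact χ.contDiff.contDiffAt.mul (h2 y hy)
  have hcont : ContinuousOn (fun x => lap (pot f) x + f x) (ball x₀ (2 * r)) := fun y hy =>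
    ((continuousAt_lap (h2 y (hne y hy))).add (hfc y (hne y hy))).continuousWithinAt
  have hae : ∀ᵐ x, x ∈ ball x₀ (2 * r) → lap (pot f) x + f x = 0 := by
    refine isOpen_ball.ae_eq_zero_of_integral_contDiff_smul_eq_zero
      (hcont.locallyIntegrableOn measurableSet_ball) fun φ hφ hφc hφs => ?_
    have hφC : IsC11c φ := IsC11c.of_contDiff (contDiff_infty.1 hφ 2) hφc
    have hw := pot_weak_form hN ha ha' hf hfb hφC
    have hcomm := hφC.integral_mul_lap_comm hvC
    have hloc : ∀ y ∈ tsupport φ, (fun x => χ x * pot f x) =ᶠ[nhds y] pot f := by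
      intro y hy
      filter_upwards [isOpen_ball.mem_nhds (hφs hy)] with z hz
      rw [χ.one_of_mem_closedBall (ball_subset_closedBall hz), one_mul]
    have e1 : ∫ x, χ x * pot f x * lap φ x = ∫ x, lap φ x * pot f x := by
      refine integral_congr_ae (Eventually.of_forall fun x => ?_)
      by_cases hx : x ∈ tsupport φ
      · have := (hloc x hx).eq_of_nhds
        simp only at this ⊢
        rw [this, mul_comm]
      · simp only [lap_eq_zero_of_notMem_tsupport hx]; ring
    have hsum : ∀ x, φ x • (lap (pot f) x + f x) =
        lap (fun x => χ x * pot f x) x * φ x + φ x * f x := by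
      intro x
      by_cases hx : x ∈ tsupport φ
      · rw [lap_congr (hloc x hx), smul_eq_mul]; ring
      · simp [image_eq_zero_of_notMem_tsupport hx]
    simp only [hsum]
    have hi1 : Integrable fun x => lap (fun x => χ x * pot f x) x * φ x := by
      refine (hvC.integrable_mul_lap hφ.continuous.locallyIntegrable).congr
        (Eventually.of_forall fun x => mul_comm _ _)
    have hfl : LocallyIntegrable f :=
      locallyIntegrable_of_abs_le_rpow (p := -a - 2) (by omega) (by linarith) hf hfb
    have hi2 : Integrable fun x => φ x * f x :=
      (hfl.integrable_smul_left_of_hasCompactSupport hφ.continuous hφc)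
    rw [integral_add hi1 hi2, ← hcomm, e1, hw]; ring
  have hx := Measure.eqOn_open_of_ae_eq (μ := volume) (U := ball x₀ (2 * r))
    (f := fun x => lap (pot f) x + f x) (g := fun _ => 0)
    ((ae_restrict_iff' measurableSet_ball).2 hae) isOpen_ball hcont continuousOn_const
    (mem_ball_self (by positivity))
  simp only at hx
  linarith

lemma isSolution_of_fixed_point (hN : 3 ≤ N) {μ a γ C : ℝ} (ha : 0 < a) (ha' : a < N - 2)
    (hγ : 0 < γ) (hγ1 : γ ≤ 1) {V v : Euc N → ℝ} (hV : LocHolderOn γ {x : Euc N | x ≠ 0} V)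
    (hVb : ∀ x, x ≠ 0 → |V x| ≤ ‖x‖ ^ (-2 : ℝ)) (hv : AEStronglyMeasurable v)
    (hvb : ∀ x, x ≠ 0 → |v x| ≤ C * ‖x‖ ^ (-a))
    (hfix : ∀ x, x ≠ 0 → v x = pot (fun y => μ * V y * v y) x) : IsSolution N μ V v := by
  set f := fun y => μ * V y * v y with hfdef
  have hVc : ∀ x, x ≠ 0 → ContinuousAt V x := fun x hx => hV.continuousAt hγ hx
  have hf : AEStronglyMeasurable f :=
    ((aestronglyMeasurable_of_continuousAt (by omega) hVc).const_mul μ).mul hv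
  have hfb : ∀ x, x ≠ 0 → |f x| ≤ |μ| * C * ‖x‖ ^ (-a - 2) := by
    intro x hx
    simp only [hfdef]
    rw [abs_mul, abs_mul, sub_eq_add_neg (-a), Real.rpow_add (norm_pos_iff.2 hx)]
    calc _ ≤ |μ| * ‖x‖ ^ (-2 : ℝ) * (C * ‖x‖ ^ (-a)) := by
          gcongr
          · exact hVb x hx
          · exact hvb x hx
      _ = _ := by ring
  have heq : ∀ x, x ≠ 0 → v =ᶠ[nhds x] pot f := fun x hx => by
    filter_upwards [isOpen_ne.mem_nhds hx] with y hy using hfix y hy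
  have h1 : ∀ x, x ≠ 0 → ContDiffAt ℝ 1 v x := fun x hx =>
    (contDiffAt_one_pot hN ha ha' hf hfb hx).congr_of_eventuallyEq (heq x hx)
  have hfc : ∀ x, x ≠ 0 → ContinuousAt f x := fun x hx =>
    (((hVc x hx).const_mul μ).mul (h1 x hx).continuousAt)
  have h2 : ∀ x, x ≠ 0 → ContDiffAt ℝ 2 (pot f) x := by
    intro x hx
    obtain ⟨ε, hε, H, hH, hHb⟩ := hV x hx
    obtain ⟨K, t, ht, hK⟩ := (h1 x hx).exists_lipschitzOnWith
    obtain ⟨ε', hε', hsub⟩ := Metric.mem_nhds_iff.1 ht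
    have hVn : ∀ᶠ y in nhds x, |V y| < |V x| + 1 :=
      (hVc x hx).abs.eventually (gt_mem_nhds (by linarith))
    have hvn : ∀ᶠ y in nhds x, |v y| < |v x| + 1 :=
      (h1 x hx).continuousAt.abs.eventually (gt_mem_nhds (by linarith))
    obtain ⟨ε₂, hε₂, hs2⟩ := Metric.eventually_nhds_iff_ball.1 (hVn.and (hvn.and (isOpen_ne.eventually_mem hx)))
    set e := min (min ε ε') (min ε₂ (1 / 2)) with he
    have he0 : 0 < e := by positivity
    have hee : e ≤ ε ∧ e ≤ ε' ∧ e ≤ ε₂ ∧ e ≤ 1 / 2 := by simp [he]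
    refine contDiffAt_two_pot hN ha ha' hf hfb hx hγ hγ1 he0
      (H := |μ| * ((|V x| + 1) * K + (|v x| + 1) * H)) (by positivity) fun y hy z hz => ?_
    rw [mem_ball] at hy hz
    obtain ⟨hy1, hy2, hy3⟩ := hs2 y (by rw [mem_ball]; linarith)
    obtain ⟨hz1, hz2, hz3⟩ := hs2 z (by rw [mem_ball]; linarith)
    have hd : dist y z ≤ 1 := by linarith [dist_triangle_right y z x]
    have a1 := hHb y ⟨by rw [mem_ball]; linarith, hy3⟩ z ⟨by rw [mem_ball]; linarith, hz3⟩
    have a2 := hK.dist_le_mul y (hsub (by rw [mem_ball]; linarith)) z (hsub (by rw [mem_ball]; linarith))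
    rw [Real.dist_eq] at a2
    have a3 : dist y z ≤ dist y z ^ γ := by
      calc dist y z = dist y z ^ (1 : ℝ) := (Real.rpow_one _).symm
        _ ≤ _ := Real.rpow_le_rpow_of_exponent_ge_of_imp dist_nonneg hd hγ1 (by intro _ h'; linarith)
    have a4 : |v y - v z| ≤ K * dist y z ^ γ := a2.trans (by gcongr)
    rw [← dist_eq_norm]
    calc |f y - f z| = |μ| * |V y * (v y - v z) + v z * (V y - V z)| := by
          rw [← abs_mul]; congr 1; simp only [hfdef]; ring
      _ ≤ |μ| * (|V y| * |v y - v z| + |v z| * |V y - V z|) := by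
          gcongr; rw [← abs_mul, ← abs_mul]; exact abs_add_le _ _
      _ ≤ |μ| * ((|V x| + 1) * (K * dist y z ^ γ) + (|v x| + 1) * (H * dist y z ^ γ)) := by
          gcongr
      _ = _ := by ring
  refine ⟨fun x hx => ((h2 x hx).congr_of_eventuallyEq (heq x hx)).contDiffWithinAt, fun x hx => ?_⟩
  rw [lap_congr (heq x hx), lap_pot_eq hN ha ha' hf hfb hfc h2 hx]
  simp [hfdef]

lemma IsC11c.mul {a b : Euc N → ℝ} (ha : IsC11c a) (hb : IsC11c b) :
    IsC11c (fun x => a x * b x) := by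
  refine ⟨ha.1.mul_right, ha.2.1.mul hb.2.1, ?_⟩
  obtain ⟨La, hLa⟩ := ha.2.2
  obtain ⟨Lb, hLb⟩ := hb.2.2
  obtain ⟨Ka, hKa⟩ := ha.exists_lipschitz
  obtain ⟨Kb, hKb⟩ := hb.exists_lipschitz
  obtain ⟨Ca, hCa, ba⟩ := ha.exists_bound
  obtain ⟨Cb, hCb, bb⟩ := hb.exists_bound
  have key : ∀ {f : Euc N → ℝ} {F : Euc N → (Euc N →L[ℝ] ℝ)} {K L : NNReal} {C D : ℝ},
      LipschitzWith K f → LipschitzWith L F → (∀ x, |f x| ≤ C) → (∀ x, ‖F x‖ ≤ D) →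
      ∀ x y, ‖f x • F x - f y • F y‖ ≤ (C * L + K * D) * ‖x - y‖ := by
    intro f F K L C D hf hF hC hD x y
    have e1 := hf.dist_le_mul x y
    have e2 := hF.dist_le_mul x y
    rw [dist_eq_norm, dist_eq_norm] at e1 e2
    calc _ = ‖f x • (F x - F y) + (f x - f y) • F y‖ := by
          congr 1; module
      _ ≤ |f x| * ‖F x - F y‖ + ‖f x - f y‖ * ‖F y‖ := by
          refine (norm_add_le _ _).trans ?_
          rw [norm_smul, norm_smul, Real.norm_eq_abs]
      _ ≤ C * (L * ‖x - y‖) + (K * ‖x - y‖) * D := by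
          gcongr
          · exact (abs_nonneg _).trans (hC x)
          · exact hC x
          · exact hD y
      _ = _ := by ring
  refine ⟨Real.toNNReal ((Ca * Lb + Ka * Cb) + (Cb * La + Kb * Ca)),
    LipschitzWith.of_dist_le_mul fun x y => ?_⟩
  have hfd : ∀ x, fderiv ℝ (fun x => a x * b x) x = a x • fderiv ℝ b x + b x • fderiv ℝ a x :=
    fun x => ((ha.2.1 x).hasFDerivAt.fun_mul (hb.2.1 x).hasFDerivAt).fderiv
  rw [hfd, hfd, dist_eq_norm, dist_eq_norm, Real.coe_toNNReal _ (by positivity), add_sub_add_comm,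
    add_mul]
  exact (norm_add_le _ _).trans (add_le_add
    (key hKa hLb (fun x => (ba x).1) (fun x => (bb x).2.1) x y)
    (key hKb hLa (fun x => (bb x).1) (fun x => (ba x).2.1) x y))

lemma IsC11c.mul_contDiff {a b : Euc N → ℝ} (ha : IsC11c a) (hb : ContDiff ℝ 2 b) :
    IsC11c (fun x => a x * b x) := by
  obtain ⟨χ, hχ, hχc, h1⟩ := exists_cutoff ha.1.isCompact
  have h := ha.mul (IsC11c.of_contDiff ((hχ 2).mul hb) hχc.mul_right)
  convert h using 2 with x
  by_cases hx : x ∈ tsupport a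
  · rw [(h1 x hx).eq_of_nhds]; simp
  · rw [image_eq_zero_of_notMem_tsupport hx]; simp

lemma tauMinus_add_tauPlus (N : ℕ) (μ : ℝ) : tauMinus N μ + tauPlus N μ = 2 - N := by
  unfold tauMinus tauPlus; ring

lemma tauPlus_quadratic {μ : ℝ} (h : μ ≤ mu0 N) :
    tauPlus N μ ^ 2 + (N - 2) * tauPlus N μ = -μ := by
  have := Real.sq_sqrt (sub_nonneg.2 h)
  unfold tauPlus
  have e : mu0 N = ((N : ℝ) - 2) ^ 2 / 4 := rfl
  rw [e] at this ⊢
  nlinarith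

lemma integral_norm_rpow_mul_LstarMu (hN : 3 ≤ N) {μ : ℝ} (hμ : μ < mu0 N) {ξ : Euc N → ℝ}
    (h : IsC11c ξ) :
    Integrable (fun x => ‖x‖ ^ tauMinus N μ * LstarMu N μ ξ x * ‖x‖ ^ tauPlus N μ) ∧
    ∫ x, ‖x‖ ^ tauMinus N μ * LstarMu N μ ξ x * ‖x‖ ^ tauPlus N μ = cMu N μ * ξ 0 := by
  obtain ⟨i1, -, e1⟩ := integral_radial_deriv (by omega) h.contDiff_one h.1
  have i2 := h.integrable_mul_lap (locallyIntegrable_norm_rpow (p := 2 - (N : ℝ)) (by omega)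
    (by linarith))
  have e2 := h.integral_norm_rpow_mul_lap hN
  have hae : (fun x : Euc N => -(‖x‖ ^ (2 - (N : ℝ)) * lap ξ x) -
      2 * tauPlus N μ * (‖x‖ ^ (-(N : ℝ)) * fderiv ℝ ξ x x)) =ᵐ[volume]
      fun x => ‖x‖ ^ tauMinus N μ * LstarMu N μ ξ x * ‖x‖ ^ tauPlus N μ := by
    filter_upwards [ae_ne_zero (N := N) (by omega)] with x hx
    have hp := norm_pos_iff.2 hx
    have a1 : ‖x‖ ^ tauMinus N μ * ‖x‖ ^ tauPlus N μ = ‖x‖ ^ (2 - (N : ℝ)) := by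
      rw [← Real.rpow_add hp, tauMinus_add_tauPlus]
    have a2 : ‖x‖ ^ (2 - (N : ℝ)) = ‖x‖ ^ (-(N : ℝ)) * ‖x‖ ^ 2 := by
      rw [show 2 - (N : ℝ) = -N + (2 : ℕ) by push_cast; ring, Real.rpow_add hp, Real.rpow_natCast]
    have a3 : ‖x‖ ^ tauMinus N μ * LstarMu N μ ξ x * ‖x‖ ^ tauPlus N μ =
        ‖x‖ ^ (2 - (N : ℝ)) * LstarMu N μ ξ x := by rw [← a1]; ring
    rw [a3, LstarMu, a2]
    field_simp
  refine ⟨((i2.neg).sub (i1.const_mul _)).congr hae, ?_⟩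
  have hsub := integral_sub i2.neg (i1.const_mul (2 * tauPlus N μ))
  simp only [Pi.neg_apply] at hsub
  rw [← integral_congr_ae hae, hsub, integral_neg, integral_const_mul, e1, e2, cMu,
    if_pos hμ, tauPlus]
  ring

lemma abs_LstarMu_mul_rad_le (hN : 3 ≤ N) {μ C D : ℝ} {ξ : Euc N → ℝ} {g g' g'' : ℝ → ℝ} {x : Euc N}
    (hx : x ≠ 0) (hd : Differentiable ℝ ξ) (hd' : DifferentiableAt ℝ (fderiv ℝ ξ) x)
    (hC : |ξ x| ≤ C ∧ ‖fderiv ℝ ξ x‖ ≤ C ∧ |lap ξ x| ≤ C)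
    (hg : ∀ t, HasDerivAt g (g' t) t) (hg' : ∀ t, HasDerivAt g' (g'' t) t)
    (hD : ∀ t, |g t| ≤ D ∧ |g' t| ≤ D ∧ |g'' t| ≤ D) :
    |LstarMu N μ (fun y => ξ y * rad g y) x| ≤
      D * C * (N + 2 + 3 * |tauPlus N μ|) * (1 + (‖x‖ ^ 2)⁻¹) := by
  have hN' : (3 : ℝ) ≤ N := by exact_mod_cast hN
  have hp := norm_pos_iff.2 hx
  have hD0 : 0 ≤ D := (abs_nonneg _).trans (hD 0).1
  have hC0 : 0 ≤ C := (abs_nonneg _).trans hC.1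
  obtain ⟨d0, d1, d2⟩ := hD (Real.log ‖x‖)
  set r := ‖x‖ with hr
  set s := r⁻¹ with hs
  have hs0 : 0 < s := inv_pos.2 hp
  have hrs : r * s = 1 := mul_inv_cancel₀ hp.ne'
  have hx1 : |fderiv ℝ ξ x x| ≤ C * r := by
    rw [← Real.norm_eq_abs]
    exact (ContinuousLinearMap.le_opNorm _ _).trans (mul_le_mul_of_nonneg_right hC.2.1 hp.le)
  have hfd : fderiv ℝ (fun y => ξ y * rad g y) x x = ξ x * g' (Real.log r) + g (Real.log r) * fderiv ℝ ξ x x := by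
    rw [((hd x).hasFDerivAt.fun_mul (hasFDerivAt_rad hx (hg _))).fderiv, rad_of_ne _ hx]
    simp only [add_apply, smul_apply, smul_eq_mul,
      innerSL_apply_apply, real_inner_self_eq_norm_sq, ← hr]
    field_simp
  have h1 : |fderiv ℝ (fun y => ξ y * rad g y) x x| ≤ D * C * (1 + r) := by
    rw [hfd]
    calc _ ≤ |ξ x| * |g' (Real.log r)| + |g (Real.log r)| * |fderiv ℝ ξ x x| := by
          rw [← abs_mul, ← abs_mul]; exact abs_add_le _ _
      _ ≤ C * D + D * (C * r) := by gcongr; exact hC.1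
      _ = _ := by ring
  have h2 : |lap (fun y => ξ y * rad g y) x| ≤ D * C * (2 + N * s ^ 2) := by
    rw [lap_mul_rad hx hg (hg' _) (Eventually.of_forall hd) hd', rad_of_ne _ hx, ← hr]
    have t1 : |g (Real.log r) * lap ξ x| ≤ D * C := by
      rw [abs_mul]; exact mul_le_mul d0 hC.2.2 (abs_nonneg _) hD0
    have t2 : |2 * g' (Real.log r) / r ^ 2 * fderiv ℝ ξ x x| ≤ D * C * (2 * s) := by
      have : 2 * g' (Real.log r) / r ^ 2 * fderiv ℝ ξ x x =
          (2 * s ^ 2) * (g' (Real.log r) * fderiv ℝ ξ x x) := by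
        rw [hs]; field_simp
      rw [this, abs_mul (2 * s ^ 2), abs_of_pos (by positivity : 0 < 2 * s ^ 2), abs_mul]
      calc _ ≤ (2 * s ^ 2) * (D * (C * r)) := by gcongr
        _ = D * C * (2 * s) * (r * s) := by ring
        _ = _ := by rw [hrs, mul_one]
    have t3 : |ξ x * ((g'' (Real.log r) + (N - 2) * g' (Real.log r)) / r ^ 2)| ≤
        D * C * ((N - 1) * s ^ 2) := by
      have : ξ x * ((g'' (Real.log r) + (N - 2) * g' (Real.log r)) / r ^ 2) =
          s ^ 2 * (ξ x * (g'' (Real.log r) + (N - 2) * g' (Real.log r))) := by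
        rw [hs]; field_simp
      rw [this, abs_mul, abs_mul, abs_of_pos (by positivity : 0 < s ^ 2)]
      have : |g'' (Real.log r) + (N - 2) * g' (Real.log r)| ≤ D + (N - 2) * D := by
        refine (abs_add_le _ _).trans ?_
        rw [abs_mul, abs_of_pos (by linarith : (0 : ℝ) < N - 2)]
        exact add_le_add d2 (mul_le_mul_of_nonneg_left d1 (by linarith))
      calc _ ≤ s ^ 2 * (C * (D + (N - 2) * D)) := by gcongr; exact hC.1
        _ = _ := by ring
    have t4 : 2 * s ≤ 1 + s ^ 2 := by nlinarith [sq_nonneg (s - 1)]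
    calc _ ≤ D * C + D * C * (2 * s) + D * C * ((N - 1) * s ^ 2) :=
          (abs_add_le _ _).trans (add_le_add ((abs_add_le _ _).trans (add_le_add t1 t2)) t3)
      _ = D * C * (1 + 2 * s + (N - 1) * s ^ 2) := by ring
      _ ≤ _ := by
          refine mul_le_mul_of_nonneg_left ?_ (by positivity)
          linarith
  have h3 : |2 * tauPlus N μ / r ^ 2 * fderiv ℝ (fun y => ξ y * rad g y) x x| ≤
      D * C * (|tauPlus N μ| * (1 + 3 * s ^ 2)) := by
    have : 2 * tauPlus N μ / r ^ 2 * fderiv ℝ (fun y => ξ y * rad g y) x x =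
        (2 * s ^ 2) * (tauPlus N μ * fderiv ℝ (fun y => ξ y * rad g y) x x) := by
      rw [hs]; field_simp
    rw [this, abs_mul (2 * s ^ 2), abs_of_pos (by positivity : 0 < 2 * s ^ 2), abs_mul]
    calc _ ≤ (2 * s ^ 2) * (|tauPlus N μ| * (D * C * (1 + r))) := by gcongr
      _ = D * C * |tauPlus N μ| * (2 * s ^ 2 + 2 * s * (r * s)) := by ring
      _ = D * C * |tauPlus N μ| * (2 * s ^ 2 + 2 * s) := by rw [hrs, mul_one]
      _ ≤ D * C * |tauPlus N μ| * (1 + 3 * s ^ 2) := by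
          refine mul_le_mul_of_nonneg_left ?_ (by positivity)
          nlinarith [sq_nonneg (s - 1)]
      _ = _ := by ring
  have e : (r ^ 2)⁻¹ = s ^ 2 := by rw [hs, inv_pow]
  rw [e]
  unfold LstarMu
  calc _ ≤ D * C * (2 + N * s ^ 2) + D * C * (|tauPlus N μ| * (1 + 3 * s ^ 2)) := by
        refine (abs_sub _ _).trans ?_
        rw [abs_neg]
        exact add_le_add h2 h3
    _ = D * C * ((2 + N * s ^ 2) + |tauPlus N μ| * (1 + 3 * s ^ 2)) := by ring
    _ ≤ D * C * ((N + 2 + 3 * |tauPlus N μ|) * (1 + s ^ 2)) := by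
        refine mul_le_mul_of_nonneg_left ?_ (by positivity)
        nlinarith [abs_nonneg (tauPlus N μ), mul_nonneg (abs_nonneg (tauPlus N μ)) (sq_nonneg s), sq_nonneg s]
    _ = _ := by ring

lemma LstarMuV_congr {μ : ℝ} {V ξ ζ : Euc N → ℝ} {x : Euc N} (h : ξ =ᶠ[nhds x] ζ) :
    LstarMuV N μ V ξ x = LstarMuV N μ V ζ x := by
  unfold LstarMuV LstarMu
  rw [lap_congr h, h.fderiv_eq, h.eq_of_nhds]

lemma LstarMuV_eq_zero {μ : ℝ} {V ξ : Euc N → ℝ} {x : Euc N} (h : x ∉ tsupport ξ) :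
    LstarMuV N μ V ξ x = 0 := by
  have h0 := notMem_tsupport_iff_eventuallyEq.1 h
  have : ξ =ᶠ[nhds x] fun _ => 0 := h0
  rw [LstarMuV_congr this]
  simp [LstarMuV, LstarMu, lap]

lemma IsC11c.measurable_LstarMu {μ : ℝ} {ξ : Euc N → ℝ} (h : IsC11c ξ) :
    Measurable (LstarMu N μ ξ) := by
  have h1 : Continuous fun x => fderiv ℝ ξ x x :=
    (h.contDiff_one.continuous_fderiv one_ne_zero).clm_apply continuous_id
  exact (measurable_lap ξ).neg.sub
    ((measurable_const.div (measurable_norm.pow_const 2)).mul h1.measurable)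

lemma integral_pot_mul_LstarMuV (hN : 3 ≤ N) {μ a C : ℝ} (hμ0 : μ < mu0 N) (ha : 0 < a)
    (ha' : a < N - 2) {V v ζ : Euc N → ℝ} (hf : AEStronglyMeasurable fun y => μ * V y * v y)
    (hfb : ∀ x, x ≠ 0 → |μ * V x * v x| ≤ C * ‖x‖ ^ (-a - 2))
    (hfix : ∀ x, x ≠ 0 → v x = pot (fun y => μ * V y * v y) x) (hζ : IsC11c ζ)
    (hη : IsC11c fun x => ζ x * rad (fun t => Real.exp (tauPlus N μ * t)) x) :
    Integrable (fun x => v x * LstarMuV N μ V ζ x * ‖x‖ ^ tauPlus N μ) ∧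
    ∫ x, v x * LstarMuV N μ V ζ x * ‖x‖ ^ tauPlus N μ = 0 := by
  set f := fun y => μ * V y * v y with hfdef
  set η := fun x => ζ x * rad (fun t => Real.exp (tauPlus N μ * t)) x with hηdef
  have i1 : Integrable fun x => lap η x * pot f x :=
    (hη.integrable_mul_lap (locallyIntegrable_pot hN ha ha' hf hfb)).congr
      (Eventually.of_forall fun x => mul_comm _ _)
  have i2 : Integrable fun x => η x * f x :=
    ((locallyIntegrable_of_abs_le_rpow (p := -a - 2) (by omega)
      (by linarith) hf hfb).integrable_smul_left_of_hasCompactSupport hη.2.1.continuous hη.1)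
  have hae : (fun x => -(lap η x * pot f x) - η x * f x) =ᵐ[volume]
      fun x => v x * LstarMuV N μ V ζ x * ‖x‖ ^ tauPlus N μ := by
    filter_upwards [ae_ne_zero (N := N) (by omega), hζ.ae_differentiableAt] with x hx hd
    have hp := norm_pos_iff.2 hx
    have d1 : ∀ t, HasDerivAt (fun t => Real.exp (tauPlus N μ * t))
        (tauPlus N μ * Real.exp (tauPlus N μ * t)) t := by
      intro t
      refine (((hasDerivAt_id t).const_mul (tauPlus N μ)).exp).congr_deriv ?_
      simp; ring
    have hl := lap_mul_rad hx d1 ((d1 _).const_mul (tauPlus N μ)) (Eventually.of_forall hζ.2.1) hd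
    rw [← hηdef, rad_of_ne _ hx, exp_log_norm hx] at hl
    have hq := tauPlus_quadratic hμ0.le
    have hcoef : tauPlus N μ * (tauPlus N μ * ‖x‖ ^ tauPlus N μ) +
        (N - 2) * (tauPlus N μ * ‖x‖ ^ tauPlus N μ) = -μ * ‖x‖ ^ tauPlus N μ := by
      rw [← hq]; ring
    rw [hcoef] at hl
    have hinv : ‖x‖ ^ (-2 : ℝ) = (‖x‖ ^ 2)⁻¹ := by
      rw [Real.rpow_neg hp.le]; norm_num
    have hηx : η x = ζ x * ‖x‖ ^ tauPlus N μ := by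
      simp only [hηdef]; rw [rad_of_ne _ hx, exp_log_norm hx]
    rw [← hfix x hx, hl, hηx, LstarMuV, LstarMu, hinv]
    simp only [hfdef]
    field_simp
    ring
  refine ⟨(i1.neg.sub i2).congr hae, ?_⟩
  have hsub := integral_sub i1.neg i2
  simp only [Pi.neg_apply] at hsub
  rw [← integral_congr_ae hae, hsub, integral_neg, pot_weak_form hN ha ha' hf hfb hη]
  ring

lemma aestronglyMeasurable_defect {μ p q : ℝ} {V v η : Euc N → ℝ} (hη : IsC11c η)
    (hVm : AEStronglyMeasurable V) (hv : AEStronglyMeasurable v) :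
    AEStronglyMeasurable fun x =>
      v x * LstarMuV N μ V η x * ‖x‖ ^ q - ‖x‖ ^ p * LstarMu N μ η x * ‖x‖ ^ q := by
  have hr : ∀ p : ℝ, AEStronglyMeasurable (fun x : Euc N => ‖x‖ ^ p) := fun p =>
    (measurable_norm.pow_const p).aestronglyMeasurable
  have hL : AEStronglyMeasurable (LstarMu N μ η) := hη.measurable_LstarMu.aestronglyMeasurable
  have h1 : AEStronglyMeasurable fun x : Euc N => μ * (V x - ‖x‖ ^ (-2 : ℝ)) * η x :=
    ((hVm.sub (hr _)).const_mul μ).mul hη.2.1.continuous.aestronglyMeasurable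
  have h2 : AEStronglyMeasurable (LstarMuV N μ V η) := hL.sub h1
  have h3 : AEStronglyMeasurable fun x => v x * LstarMuV N μ V η x * ‖x‖ ^ q :=
    (hv.mul h2).mul (hr q)
  have h4 : AEStronglyMeasurable fun x : Euc N => ‖x‖ ^ p * LstarMu N μ η x * ‖x‖ ^ q :=
    ((hr p).mul hL).mul (hr q)
  exact h3.sub h4

lemma abs_defect_le {μ a A σ c K M : ℝ} (hat : -a = tauMinus N μ) {V v ζ : Euc N → ℝ}
    {x : Euc N} (hx : x ≠ 0) (hvb : |v x| ≤ ‖x‖ ^ (-a))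
    (hA : |v x - ‖x‖ ^ (-a)| ≤ A * ‖x‖ ^ (-a + σ)) (hc : |V x - ‖x‖ ^ (-2 : ℝ)| ≤ c)
    (hL : |LstarMu N μ ζ x| ≤ K * (1 + (‖x‖ ^ 2)⁻¹)) (hζ : |ζ x| ≤ M) :
    |v x * LstarMuV N μ V ζ x * ‖x‖ ^ tauPlus N μ -
      ‖x‖ ^ tauMinus N μ * LstarMu N μ ζ x * ‖x‖ ^ tauPlus N μ| ≤
    A * K * ‖x‖ ^ (2 - (N : ℝ) + σ) + A * K * ‖x‖ ^ (-(N : ℝ) + σ) +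
      |μ| * c * M * ‖x‖ ^ (2 - (N : ℝ)) := by
  have hp := norm_pos_iff.2 hx
  have hc0 : 0 ≤ c := (abs_nonneg _).trans hc
  have hM : 0 ≤ M := (abs_nonneg _).trans hζ
  have hA0 : 0 ≤ A * ‖x‖ ^ (-a + σ) := (abs_nonneg _).trans hA
  have hαβ : tauMinus N μ + tauPlus N μ = 2 - N := tauMinus_add_tauPlus N μ
  set β := tauPlus N μ with hβ
  have r1 : ‖x‖ ^ (-a) * ‖x‖ ^ β = ‖x‖ ^ (2 - (N : ℝ)) := by
    rw [hat, ← Real.rpow_add hp, hαβ]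
  have r2 : ‖x‖ ^ (-a + σ) * ‖x‖ ^ β = ‖x‖ ^ (2 - (N : ℝ) + σ) := by
    rw [hat, ← Real.rpow_add hp, ← hαβ]; congr 1; ring
  have r3 : ‖x‖ ^ (2 - (N : ℝ) + σ) * (‖x‖ ^ 2)⁻¹ = ‖x‖ ^ (-(N : ℝ) + σ) := by
    rw [show 2 - (N : ℝ) + σ = -(N : ℝ) + σ + (2 : ℕ) by push_cast; ring, Real.rpow_add hp,
      Real.rpow_natCast]
    field_simp
  have hEx : v x * LstarMuV N μ V ζ x * ‖x‖ ^ β -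
      ‖x‖ ^ tauMinus N μ * LstarMu N μ ζ x * ‖x‖ ^ β =
      (v x - ‖x‖ ^ (-a)) * LstarMu N μ ζ x * ‖x‖ ^ β -
      μ * (V x - ‖x‖ ^ (-2 : ℝ)) * ζ x * v x * ‖x‖ ^ β := by
    rw [hat, LstarMuV]; ring
  rw [hEx]
  have hβ0 : 0 ≤ ‖x‖ ^ β := by positivity
  calc _ ≤ |v x - ‖x‖ ^ (-a)| * |LstarMu N μ ζ x| * ‖x‖ ^ β +
        |μ| * |V x - ‖x‖ ^ (-2 : ℝ)| * |ζ x| * |v x| * ‖x‖ ^ β := by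
        refine (abs_sub _ _).trans (le_of_eq ?_)
        simp only [abs_mul, abs_of_nonneg hβ0]
    _ ≤ (A * ‖x‖ ^ (-a + σ)) * (K * (1 + (‖x‖ ^ 2)⁻¹)) * ‖x‖ ^ β +
        |μ| * c * M * ‖x‖ ^ (-a) * ‖x‖ ^ β := by
        gcongr
    _ = A * K * (‖x‖ ^ (-a + σ) * ‖x‖ ^ β) + A * K * ((‖x‖ ^ (-a + σ) * ‖x‖ ^ β) * (‖x‖ ^ 2)⁻¹)
        + |μ| * c * M * (‖x‖ ^ (-a) * ‖x‖ ^ β) := by ring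
    _ = _ := by rw [r2, r3, r1]

lemma distribIdentity_of_fixed_point (hN : 3 ≤ N) {μ a A σ c : ℝ} (hμ0 : μ < mu0 N)
    (ha : 0 < a) (ha' : a < N - 2) (hat : -a = tauMinus N μ) (hσ : 0 < σ) {V v : Euc N → ℝ}
    (hVm : AEStronglyMeasurable V) (hVb : ∀ x, x ≠ 0 → |V x| ≤ ‖x‖ ^ (-2 : ℝ))
    (hVc : ∀ x, x ≠ 0 → |V x - ‖x‖ ^ (-2 : ℝ)| ≤ c) (hv : AEStronglyMeasurable v)
    (hvb : ∀ x, x ≠ 0 → |v x| ≤ ‖x‖ ^ (-a))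
    (hvs : ∀ x, x ≠ 0 → |v x - ‖x‖ ^ (-a)| ≤ A * ‖x‖ ^ (-a + σ))
    (hfix : ∀ x, x ≠ 0 → v x = pot (fun y => μ * V y * v y) x) (k : ℝ) :
    DistribIdentity N μ V (fun x => k * v x) k := by
  have hne := ae_ne_zero (N := N) (by omega)
  have hfm : AEStronglyMeasurable fun y => μ * V y * v y := (hVm.const_mul μ).mul hv
  have hfb : ∀ x, x ≠ 0 → |μ * V x * v x| ≤ |μ| * ‖x‖ ^ (-a - 2) := by
    intro x hx
    rw [abs_mul, abs_mul, sub_eq_add_neg (-a), Real.rpow_add (norm_pos_iff.2 hx)]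
    calc _ ≤ |μ| * ‖x‖ ^ (-2 : ℝ) * (‖x‖ ^ (-a)) := by
          gcongr
          · exact hVb x hx
          · exact hvb x hx
      _ = _ := by ring
  intro ξ hξ
  obtain ⟨ψ, ψ', ψ'', D, hψ, -, -, hd, hd', hD, -, hz, h1, -⟩ := exists_transition
  obtain ⟨C, hC0, hC⟩ := hξ.exists_bound
  have hD0 : 0 ≤ D := (abs_nonneg _).trans (hD 0).1
  set θ : ℕ → Euc N → ℝ := fun (n : ℕ) => rad (fun t => ψ (t + (n : ℝ))) with hθ
  set ζ : ℕ → Euc N → ℝ := fun n x => ξ x * θ n x with hζ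
  have hθc : ∀ n, ContDiff ℝ 2 (θ n) := fun n =>
    contDiff_rad (n := 2) (t₀ := -n) ((hψ 2).comp (contDiff_id.add contDiff_const))
      (fun t ht => hz _ (by linarith))
  have hζC : ∀ n, IsC11c (ζ n) := fun n => hξ.mul_contDiff (hθc n)
  have hηC : ∀ n, IsC11c fun x => ζ n x * rad (fun t => Real.exp (tauPlus N μ * t)) x := by
    intro n
    have : ContDiff ℝ 2 (rad (fun t => ψ (t + n) * Real.exp (tauPlus N μ * t)) : Euc N → ℝ) :=
      contDiff_rad (n := 2) (t₀ := -n) (((hψ 2).comp (contDiff_id.add contDiff_const)).mul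
        (contDiff_const.mul contDiff_id).exp) (fun t ht => by simp [hz (t + n) (by linarith)])
    convert hξ.mul_contDiff this using 2 with x
    simp only [hζ, hθ, rad]
    split_ifs <;> ring
  have hlim : ∀ x : Euc N, x ≠ 0 → ∀ᶠ n : ℕ in atTop, ζ n =ᶠ[nhds x] ξ := by
    intro x hx
    filter_upwards [(tendsto_natCast_atTop_atTop (R := ℝ)).eventually_gt_atTop (1 - Real.log ‖x‖)]
      with n hn
    have hcont : ContinuousAt (fun y : Euc N => Real.log ‖y‖ + n) x :=
      (ContinuousAt.log continuous_norm.continuousAt (norm_ne_zero_iff.2 hx)).add continuousAt_const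
    filter_upwards [hcont.eventually (lt_mem_nhds (a := 1) (by linarith)), isOpen_ne.mem_nhds hx]
      with y hy hy0
    simp only [hζ, hθ, rad_of_ne _ hy0]
    rw [h1 _ hy.le, mul_one]
  have hζ0 : ∀ n, ζ n 0 = 0 := fun n => by simp [hζ, hθ, rad]
  set β := tauPlus N μ with hβ
  set E : (Euc N → ℝ) → Euc N → ℝ := fun η x =>
    v x * LstarMuV N μ V η x * ‖x‖ ^ β - ‖x‖ ^ tauMinus N μ * LstarMu N μ η x * ‖x‖ ^ β with hE
  set K := D * C * (N + 2 + 3 * |β|) with hK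
  have hK0 : 0 ≤ K := by positivity
  set m : Euc N → ℝ := (tsupport ξ).indicator fun x => A * K * ‖x‖ ^ (2 - (N : ℝ) + σ) +
    A * K * ‖x‖ ^ (-(N : ℝ) + σ) + |μ| * c * (D * C) * ‖x‖ ^ (2 - (N : ℝ)) with hm
  have hmi : Integrable m := by
    have hl : ∀ p, -(N : ℝ) < p → LocallyIntegrable fun x : Euc N => ‖x‖ ^ p := fun p hp =>
      locallyIntegrable_norm_rpow (by omega) hp
    exact ((((hl _ (by linarith)).smul (A * K)).add ((hl _ (by linarith)).smul (A * K))).add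
      ((hl _ (by linarith)).smul (|μ| * c * (D * C)))).integrableOn_isCompact hξ.1.isCompact
      |>.integrable_indicator (isClosed_tsupport ξ).measurableSet
  have hαβ : tauMinus N μ + β = 2 - N := tauMinus_add_tauPlus N μ
  have hbound : ∀ n, ∀ᵐ x, ‖E (ζ n) x‖ ≤ m x := by
    intro n
    filter_upwards [hne, hξ.ae_differentiableAt] with x hx hdx
    by_cases hxs : x ∈ tsupport ξ
    · rw [hm, Set.indicator_of_mem hxs, Real.norm_eq_abs]
      have hL : |LstarMu N μ (ζ n) x| ≤ K * (1 + (‖x‖ ^ 2)⁻¹) :=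
        abs_LstarMu_mul_rad_le hN hx hξ.2.1 hdx (hC x) (g := fun t => ψ (t + n))
          (g' := fun t => ψ' (t + n)) (g'' := fun t => ψ'' (t + n))
          (fun t => (hd _).comp_add_const _ _) (fun t => (hd' _).comp_add_const _ _)
          (fun t => hD _)
      have hζb : |ζ n x| ≤ D * C := by
        simp only [hζ, hθ, rad_of_ne _ hx]
        rw [abs_mul, mul_comm]
        exact mul_le_mul (hD _).1 (hC x).1 (abs_nonneg _) hD0
      exact abs_defect_le hat hx (hvb x hx) (hvs x hx) (hVc x hx) hL hζb
    · have hs : x ∉ tsupport (ζ n) := fun h => hxs (tsupport_mul_subset_left h)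
      have h2 : LstarMu N μ (ζ n) x = 0 := by
        have := LstarMuV_eq_zero (μ := μ) (V := fun x => ‖x‖ ^ (-2 : ℝ)) hs
        simpa [LstarMuV] using this
      simp only [hE, LstarMuV_eq_zero hs, h2, hm]
      rw [Set.indicator_of_notMem hxs]; simp
  have hconv : ∀ x : Euc N, x ≠ 0 → ∀ᶠ n in atTop, E (ζ n) x = E ξ x := by
    intro x hx
    filter_upwards [hlim x hx] with n hn
    have h2 : LstarMu N μ (ζ n) x = LstarMu N μ ξ x := by
      have := LstarMuV_congr (μ := μ) (V := fun x => ‖x‖ ^ (-2 : ℝ)) hn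
      simpa [LstarMuV] using this
    simp only [hE, LstarMuV_congr hn, h2]
  have hEm : ∀ η, IsC11c η → AEStronglyMeasurable (E η) := fun η hη =>
    aestronglyMeasurable_defect hη hVm hv
  have hzero : ∀ n, ∫ x, E (ζ n) x = 0 := by
    intro n
    obtain ⟨i1, e1⟩ := integral_pot_mul_LstarMuV hN hμ0 ha ha' hfm hfb hfix (hζC n) (hηC n)
    obtain ⟨i2, e2⟩ := integral_norm_rpow_mul_LstarMu hN hμ0 (hζC n)
    simp only [hE]
    rw [integral_sub i1 i2, e1, e2, hζ0]; simp
  have hEint : Integrable (E ξ) := by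
    refine hmi.mono' (hEm ξ hξ) ?_
    filter_upwards [hne, ae_all_iff.2 hbound] with x hx hb
    obtain ⟨n, hn⟩ := (hconv x hx).exists
    rw [← hn]; exact hb n
  have hE0 : ∫ x, E ξ x = 0 := by
    have ht := tendsto_integral_of_dominated_convergence m (fun n => hEm _ (hζC n)) hmi hbound
      (f := E ξ) (by
        filter_upwards [hne] with x hx
        exact tendsto_const_nhds.congr' ((hconv x hx).mono fun n hn => hn.symm))
    simp only [hzero] at ht
    exact (tendsto_nhds_unique ht tendsto_const_nhds)
  obtain ⟨i2, e2⟩ := integral_norm_rpow_mul_LstarMu hN hμ0 hξ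
  have hsum := integral_add hEint i2
  rw [hE0, e2, zero_add] at hsum
  have hfin : ∫ x, v x * LstarMuV N μ V ξ x * ‖x‖ ^ β = cMu N μ * ξ 0 := by
    rw [← hsum]
    refine integral_congr_ae (Eventually.of_forall fun x => ?_)
    simp only [hE, hβ]; ring
  rw [mul_right_comm, ← hfin, mul_comm _ k, ← integral_const_mul]
  refine integral_congr_ae (Eventually.of_forall fun x => ?_)
  simp only; ring

lemma pot_mono (hN : 3 ≤ N) {f g : Euc N → ℝ} {x : Euc N}
    (hf : Integrable fun y => ‖x - y‖ ^ (2 - (N : ℝ)) * f y)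
    (hg : Integrable fun y => ‖x - y‖ ^ (2 - (N : ℝ)) * g y) (h : ∀ y, y ≠ 0 → f y ≤ g y) :
    pot f x ≤ pot g x := by
  refine mul_le_mul_of_nonneg_left (integral_mono_ae hf hg ?_) (cN_pos hN).le
  filter_upwards [ae_ne_zero (by omega)] with y hy
  exact mul_le_mul_of_nonneg_left (h y hy) (by positivity)

lemma pot_sub {f g : Euc N → ℝ} {x : Euc N}
    (hf : Integrable fun y => ‖x - y‖ ^ (2 - (N : ℝ)) * f y)
    (hg : Integrable fun y => ‖x - y‖ ^ (2 - (N : ℝ)) * g y) :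
    pot (fun y => f y - g y) x = pot f x - pot g x := by
  simp only [pot, mul_sub]
  rw [integral_sub hf hg, mul_sub]

lemma pot_const_mul (c : ℝ) (f : Euc N → ℝ) (x : Euc N) :
    pot (fun y => c * f y) x = c * pot f x := by
  simp only [pot]
  rw [mul_left_comm c, ← integral_const_mul c]
  congr 2 with y
  ring

lemma pot_nonneg (hN : 3 ≤ N) {f : Euc N → ℝ} (h : ∀ y, y ≠ 0 → 0 ≤ f y) (x : Euc N) :
    0 ≤ pot f x := by
  refine mul_nonneg (cN_pos hN).le (integral_nonneg_of_ae ?_)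
  filter_upwards [ae_ne_zero (by omega)] with y hy
  exact mul_nonneg (by positivity) (h y hy)

lemma pot_pos (hN : 3 ≤ N) {f : Euc N → ℝ} {x : Euc N} {r : ℝ} (hr : 0 < r)
    (hf : Integrable fun y => ‖x - y‖ ^ (2 - (N : ℝ)) * f y) (h : ∀ y, y ≠ 0 → 0 ≤ f y)
    (hpos : ∀ y, y ≠ 0 → ‖y‖ < r → 0 < f y) : 0 < pot f x := by
  refine mul_pos (cN_pos hN) ((integral_pos_iff_support_of_nonneg_ae ?_ hf).2 ?_)
  · filter_upwards [ae_ne_zero (by omega)] with y hy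
    exact mul_nonneg (by positivity) (h y hy)
  · have : Nontrivial (Euc N) := by
      have : Nonempty (Fin N) := ⟨⟨0, by omega⟩⟩
      infer_instance
    have hsub : ball (0 : Euc N) r \ {0, x} ⊆
        Function.support fun y => ‖x - y‖ ^ (2 - (N : ℝ)) * f y := by
      rintro y ⟨hy, hy0⟩
      simp only [Set.mem_insert_iff, Set.mem_singleton_iff, not_or] at hy0
      have h1 : 0 < ‖x - y‖ := norm_pos_iff.2 (sub_ne_zero.2 (Ne.symm hy0.2))
      exact (mul_pos (Real.rpow_pos_of_pos h1 _) (hpos y hy0.1 (by simpa using hy))).ne'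
    refine lt_of_lt_of_le ?_ (measure_mono hsub)
    rw [measure_sdiff_null (Set.Finite.measure_zero (by simp) _)]
    exact measure_ball_pos _ _ hr

/-- Monotone iteration from a supersolution `Ψ`: the decreasing sequence of iterates of
`w ↦ pot (W w)` stays above `Ψ - Z` and converges to a fixed point. -/
lemma exists_fixed_point (hN : 3 ≤ N) {a b A B : ℝ} (ha : 0 < a) (ha' : a < N - 2) (hb : 0 < b)
    (hb' : b < N - 2) {W Ψ Z : Euc N → ℝ} (hW : AEStronglyMeasurable W)
    (hΨm : AEStronglyMeasurable Ψ) (hZm : AEStronglyMeasurable Z)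
    (hW0 : ∀ x, x ≠ 0 → 0 ≤ W x) (hWb : ∀ x, x ≠ 0 → W x ≤ B * ‖x‖ ^ (-2 : ℝ))
    (hΨ0 : ∀ x, x ≠ 0 → 0 ≤ Ψ x) (hΨb : ∀ x, x ≠ 0 → Ψ x ≤ ‖x‖ ^ (-a))
    (hZ0 : ∀ x, x ≠ 0 → 0 ≤ Z x) (hZb : ∀ x, x ≠ 0 → Z x ≤ A * ‖x‖ ^ (-b))
    (hsup : ∀ x, x ≠ 0 → pot (fun y => W y * Ψ y) x ≤ Ψ x)
    (hsub : ∀ x, x ≠ 0 → Ψ x - Z x ≤ pot (fun y => W y * Ψ y) x - pot (fun y => W y * Z y) x) :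
    ∃ v : Euc N → ℝ, AEStronglyMeasurable v ∧ (∀ x, x ≠ 0 → 0 ≤ v x) ∧
      (∀ x, x ≠ 0 → v x ≤ Ψ x) ∧ (∀ x, x ≠ 0 → Ψ x - Z x ≤ v x) ∧
      ∀ x, x ≠ 0 → v x = pot (fun y => W y * v y) x := by
  have hInt : ∀ w : Euc N → ℝ, AEStronglyMeasurable w → (∀ x, x ≠ 0 → 0 ≤ w x) →
      (∀ x, x ≠ 0 → w x ≤ Ψ x) → ∀ x, x ≠ 0 →
      Integrable fun y => ‖x - y‖ ^ (2 - (N : ℝ)) * (W y * w y) := by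
    intro w hw hw0 hwΨ x hx
    refine pot_integrable hN ha ha' (C := B) (hW.mul hw) (fun y hy => ?_) hx
    rw [Pi.mul_apply, abs_of_nonneg (mul_nonneg (hW0 y hy) (hw0 y hy)), sub_eq_add_neg (-a),
      Real.rpow_add (norm_pos_iff.2 hy), mul_comm (‖y‖ ^ (-a)), ← mul_assoc]
    exact mul_le_mul (hWb y hy) ((hwΨ y hy).trans (hΨb y hy)) (hw0 y hy)
      ((hW0 y hy).trans (hWb y hy))
  have hintZ : ∀ x, x ≠ 0 → Integrable fun y => ‖x - y‖ ^ (2 - (N : ℝ)) * (W y * Z y) := by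
    intro x hx
    refine pot_integrable hN hb hb' (C := B * A) (hW.mul hZm) (fun y hy => ?_) hx
    rw [Pi.mul_apply, abs_mul, abs_of_nonneg (hW0 y hy), abs_of_nonneg (hZ0 y hy), sub_eq_add_neg (-b),
      Real.rpow_add (norm_pos_iff.2 hy)]
    calc W y * Z y ≤ (B * ‖y‖ ^ (-2 : ℝ)) * (A * ‖y‖ ^ (-b)) :=
          mul_le_mul (hWb y hy) (hZb y hy) (hZ0 y hy) ((hW0 y hy).trans (hWb y hy))
      _ = _ := by ring
  set v : ℕ → Euc N → ℝ := fun n => (fun w => pot fun y => W y * w y)^[n] Ψ with hv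
  have hv0 : v 0 = Ψ := rfl
  have hvs : ∀ n, v (n + 1) = pot fun y => W y * v n y := fun n =>
    Function.iterate_succ_apply' _ _ _
  have hP : ∀ n, AEStronglyMeasurable (v n) ∧ (∀ x, x ≠ 0 → 0 ≤ v n x) ∧
      (∀ x, x ≠ 0 → v n x ≤ Ψ x) ∧ (∀ x, x ≠ 0 → Ψ x - Z x ≤ v n x) ∧
      ∀ x, x ≠ 0 → v (n + 1) x ≤ v n x := by
    intro n
    induction n with
    | zero =>
      refine ⟨hΨm, hΨ0, fun x _ => le_rfl, fun x hx => sub_le_self _ (hZ0 x hx), fun x hx => ?_⟩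
      rw [hvs, hv0]
      exact hsup x hx
    | succ n ih =>
      obtain ⟨m, h0, hle, hge, hs⟩ := ih
      have hm : AEStronglyMeasurable (v (n + 1)) := by
        rw [hvs]; exact aestronglyMeasurable_pot (hW.mul m)
      have h0' : ∀ x, x ≠ 0 → 0 ≤ v (n + 1) x := fun x hx => by
        rw [hvs]; exact pot_nonneg hN (fun y hy => mul_nonneg (hW0 y hy) (h0 y hy)) x
      have hle' : ∀ x, x ≠ 0 → v (n + 1) x ≤ Ψ x := fun x hx => (hs x hx).trans (hle x hx)
      refine ⟨hm, h0', hle', fun x hx => ?_, fun x hx => ?_⟩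
      · refine (hsub x hx).trans ?_
        rw [hvs, ← pot_sub (hInt Ψ hΨm hΨ0 (fun _ _ => le_rfl) x hx) (hintZ x hx)]
        refine pot_mono hN ?_ (hInt _ m h0 hle x hx) fun y hy => ?_
        · simp only [mul_sub]
          have := (hInt Ψ hΨm hΨ0 (fun _ _ => le_rfl) x hx).sub (hintZ x hx)
          exact this
        · rw [← mul_sub]
          exact mul_le_mul_of_nonneg_left (hge y hy) (hW0 y hy)
      · rw [hvs (n + 1)]
        nth_rw 2 [hvs n]
        exact pot_mono hN (hInt _ hm h0' hle' x hx) (hInt _ m h0 hle x hx) fun y hy =>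
          mul_le_mul_of_nonneg_left (hs y hy) (hW0 y hy)
  have hlim : ∀ x, x ≠ 0 → Tendsto (fun n => v n x) atTop (nhds (⨅ n, v n x)) := fun x hx =>
    tendsto_atTop_ciInf (antitone_nat_of_succ_le fun n => (hP n).2.2.2.2 x hx)
      ⟨0, by rintro _ ⟨n, rfl⟩; exact (hP n).2.1 x hx⟩
  have hne := ae_ne_zero (N := N) (by omega)
  refine ⟨fun x => ⨅ n, v n x, aestronglyMeasurable_of_tendsto_ae atTop (fun n => (hP n).1)
    (hne.mono hlim), fun x hx => ge_of_tendsto' (hlim x hx) fun n => (hP n).2.1 x hx,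
    fun x hx => le_of_tendsto' (hlim x hx) fun n => (hP n).2.2.1 x hx,
    fun x hx => ge_of_tendsto' (hlim x hx) fun n => (hP n).2.2.2.1 x hx, fun x hx => ?_⟩
  have hd : Tendsto (fun n => v (n + 1) x) atTop (nhds (pot (fun y => W y * ⨅ n, v n y) x)) := by
    simp only [hvs]
    refine Tendsto.const_mul _ (tendsto_integral_of_dominated_convergence
      (fun y => ‖x - y‖ ^ (2 - (N : ℝ)) * (W y * Ψ y))
      (fun n => (hInt _ (hP n).1 (hP n).2.1 (hP n).2.2.1 x hx).aestronglyMeasurable)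
      (hInt Ψ hΨm hΨ0 (fun _ _ => le_rfl) x hx) (fun n => ?_) ?_)
    · filter_upwards [hne] with y hy
      have h1 := mul_nonneg (hW0 y hy) ((hP n).2.1 y hy)
      rw [Real.norm_of_nonneg (mul_nonneg (by positivity) h1)]
      exact mul_le_mul_of_nonneg_left
        (mul_le_mul_of_nonneg_left ((hP n).2.2.1 y hy) (hW0 y hy)) (by positivity)
    · filter_upwards [hne] with y hy
      exact ((hlim y hy).const_mul _).const_mul _
  exact tendsto_nhds_unique ((tendsto_add_atTop_iff_nat 1).2 (hlim x hx)) hd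

/-- Logarithmic profile of the barrier: it behaves like `exp (α t)` for `t ≪ T` and like
`exp ((α - δ) t)` for `t ≫ T`. -/
def profile (α δ κ T t : ℝ) : ℝ := Real.exp (α * t - δ / κ * Real.log (1 + Real.exp (κ * (t - T))))

/-- The logistic part of the slope of `log (profile α δ κ T)`. -/
def logisticSlope (δ κ T t : ℝ) : ℝ := δ * Real.exp (κ * (t - T)) / (1 + Real.exp (κ * (t - T)))

/-- The derivative of `logisticSlope`. -/
def logisticSlope' (δ κ T t : ℝ) : ℝ :=
  δ * κ * Real.exp (κ * (t - T)) / (1 + Real.exp (κ * (t - T))) ^ 2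

section barrier

variable {α β δ κ T σ μ : ℝ}

lemma contDiff_profile : ContDiff ℝ 2 (profile α δ κ T) := by
  have h : ContDiff ℝ 2 fun t : ℝ => 1 + Real.exp (κ * (t - T)) := by fun_prop
  have h2 : ContDiff ℝ 2 fun t : ℝ => Real.log (1 + Real.exp (κ * (t - T))) :=
    h.log fun t => by positivity
  exact ((contDiff_const.mul contDiff_id).sub (contDiff_const.mul h2)).exp

lemma hasDerivAt_one_add_exp (t : ℝ) :
    HasDerivAt (fun t => 1 + Real.exp (κ * (t - T))) (κ * Real.exp (κ * (t - T))) t := by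
  refine (((((hasDerivAt_id t).sub_const T).const_mul κ).exp).const_add 1).congr_deriv ?_
  simp [mul_comm]

lemma hasDerivAt_profile (hκ : 0 < κ) (t : ℝ) :
    HasDerivAt (profile α δ κ T) (profile α δ κ T t * (α - logisticSlope δ κ T t)) t := by
  refine ((((hasDerivAt_id t).const_mul α).sub (((hasDerivAt_one_add_exp (κ := κ) (T := T) t).log
    (by positivity)).const_mul (δ / κ))).exp).congr_deriv ?_
  simp only [profile, logisticSlope, id, Pi.sub_apply]
  field_simp

lemma hasDerivAt_logisticSlope (t : ℝ) :
    HasDerivAt (logisticSlope δ κ T) (logisticSlope' δ κ T t) t := by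
  have h := hasDerivAt_one_add_exp (κ := κ) (T := T) t
  have h1 : HasDerivAt (fun t => δ * Real.exp (κ * (t - T))) (δ * (κ * Real.exp (κ * (t - T)))) t := by
    refine ((h.sub_const 1).const_mul δ).congr_of_eventuallyEq (Eventually.of_forall fun s => ?_)
    simp
  refine (h1.div h (by positivity)).congr_deriv ?_
  simp only [logisticSlope']
  ring

lemma hasDerivAt_profile_mul_logisticSlope (hκ : 0 < κ) (t : ℝ) :
    HasDerivAt (fun t => profile α δ κ T t * (α - logisticSlope δ κ T t))
      (profile α δ κ T t * ((α - logisticSlope δ κ T t) ^ 2 - logisticSlope' δ κ T t)) t := by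
  refine ((hasDerivAt_profile hκ t).mul ((hasDerivAt_logisticSlope t).const_sub α)).congr_deriv ?_
  ring

lemma logisticSlope_nonneg (hδ : 0 ≤ δ) (t : ℝ) : 0 ≤ logisticSlope δ κ T t := by
  unfold logisticSlope; positivity

lemma logisticSlope_le (hδ : 0 ≤ δ) (t : ℝ) : logisticSlope δ κ T t ≤ δ := by
  unfold logisticSlope
  rw [div_le_iff₀ (by positivity)]
  nlinarith [Real.exp_pos (κ * (t - T))]

lemma logisticSlope'_nonneg (hδ : 0 ≤ δ) (hκ : 0 ≤ κ) (t : ℝ) : 0 ≤ logisticSlope' δ κ T t := by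
  unfold logisticSlope'; positivity

lemma logisticSlope_mul_le_logisticSlope' (hδ : 0 ≤ δ) (hκ : 0 ≤ κ) {t : ℝ} (ht : t ≤ T) :
    logisticSlope δ κ T t * (κ / 2) ≤ logisticSlope' δ κ T t := by
  have h1 : Real.exp (κ * (t - T)) ≤ 1 :=
    Real.exp_le_one_iff.2 (mul_nonpos_of_nonneg_of_nonpos hκ (by linarith))
  have h0 := Real.exp_pos (κ * (t - T))
  unfold logisticSlope logisticSlope'
  set y := Real.exp (κ * (t - T))
  rw [div_mul_eq_mul_div, div_le_div_iff₀ (by positivity) (by positivity)]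
  have : 0 ≤ δ * κ * y * (1 + y) * (1 - y) := by
    have := sub_nonneg.2 h1
    positivity
  nlinarith

/-- `min 1 y ≤ r ^ σ` in logarithmic variables. -/
lemma le_exp_of_le_one_of_le_exp {c : ℝ} (hσ : 0 ≤ σ) (hσκ : σ ≤ κ) (hT : 0 ≤ T) {t s : ℝ}
    (hc : 0 ≤ c) (h1 : s ≤ c) (h2 : s ≤ c * Real.exp (κ * (t - T))) : s ≤ c * Real.exp (σ * t) := by
  rcases le_total t T with ht | ht
  · refine h2.trans (mul_le_mul_of_nonneg_left (Real.exp_le_exp.2 ?_) hc)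
    nlinarith
  · refine h1.trans (le_mul_of_one_le_right hc (Real.one_le_exp ?_))
    exact mul_nonneg hσ (hT.trans ht)

lemma logisticSlope'_le_exp (hδ : 0 ≤ δ) (hσ : 0 ≤ σ) (hσκ : σ ≤ κ) (hT : 0 ≤ T) (t : ℝ) :
    logisticSlope' δ κ T t ≤ δ * κ * Real.exp (σ * t) := by
  have hκ := hσ.trans hσκ
  have h0 := Real.exp_pos (κ * (t - T))
  refine le_exp_of_le_one_of_le_exp hσ hσκ hT (by positivity) ?_ ?_
  · unfold logisticSlope'
    rw [div_le_iff₀ (by positivity)]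
    exact mul_le_mul_of_nonneg_left (by nlinarith) (by positivity)
  · unfold logisticSlope'
    exact div_le_self (by positivity) (by nlinarith)

lemma logisticSlope'_le (hδ : 0 ≤ δ) (hκ : 0 ≤ κ) (t : ℝ) : logisticSlope' δ κ T t ≤ δ * κ := by
  have h0 := Real.exp_pos (κ * (t - T))
  unfold logisticSlope'
  rw [div_le_iff₀ (by positivity)]
  exact mul_le_mul_of_nonneg_left (by nlinarith) (by positivity)

lemma profile_pos (t : ℝ) : 0 < profile α δ κ T t := Real.exp_pos _

lemma profile_le (hδ : 0 ≤ δ) (hκ : 0 ≤ κ) (t : ℝ) : profile α δ κ T t ≤ Real.exp (α * t) := by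
  refine Real.exp_le_exp.2 (sub_le_self _ (mul_nonneg (by positivity) (Real.log_nonneg ?_)))
  linarith [Real.exp_pos (κ * (t - T))]

lemma profile_le_far (hδ : 0 ≤ δ) (hκ : 0 < κ) (t : ℝ) :
    profile α δ κ T t ≤ Real.exp (δ * T) * Real.exp ((α - δ) * t) := by
  rw [← Real.exp_add]
  refine Real.exp_le_exp.2 ?_
  have h : κ * (t - T) ≤ Real.log (1 + Real.exp (κ * (t - T))) := by
    rw [Real.le_log_iff_exp_le (by positivity)]; linarith
  have h2 := mul_le_mul_of_nonneg_left h (show 0 ≤ δ / κ by positivity)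
  rw [← mul_assoc, div_mul_cancel₀ _ hκ.ne'] at h2
  linarith

lemma exp_sub_profile_le (hδ : 0 ≤ δ) (hσ : 0 ≤ σ) (hσκ : σ ≤ κ) (hT : 0 ≤ T) (t : ℝ) :
    Real.exp (α * t) - profile α δ κ T t ≤ (1 + δ / κ) * Real.exp ((α + σ) * t) := by
  have hκ := hσ.trans hσκ
  set L := Real.log (1 + Real.exp (κ * (t - T))) with hL
  have hL1 : L ≤ Real.exp (κ * (t - T)) := by
    have := Real.log_le_sub_one_of_pos (show 0 < 1 + Real.exp (κ * (t - T)) by positivity)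
    linarith
  have h0 := Real.exp_pos (κ * (t - T))
  have hb : 0 ≤ δ / κ := by positivity
  have h : 1 - Real.exp (-(δ / κ * L)) ≤ (1 + δ / κ) * Real.exp (σ * t) := by
    refine le_exp_of_le_one_of_le_exp hσ hσκ hT (by positivity) ?_ ?_
    · have := Real.exp_pos (-(δ / κ * L)); linarith
    · have := Real.add_one_le_exp (-(δ / κ * L))
      nlinarith [mul_le_mul_of_nonneg_left hL1 hb]
  have he : profile α δ κ T t = Real.exp (α * t) * Real.exp (-(δ / κ * L)) := by
    rw [← Real.exp_add]; rfl
  rw [he, add_mul α, Real.exp_add]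
  have := mul_le_mul_of_nonneg_left h (Real.exp_pos (α * t)).le
  linarith

lemma norm_rpow_neg_two {x : Euc N} : ‖x‖ ^ (-2 : ℝ) = (‖x‖ ^ 2)⁻¹ := by
  rw [Real.rpow_neg (norm_nonneg x)]; norm_num

lemma norm_rpow_sub_two (p : ℝ) {x : Euc N} (hx : x ≠ 0) :
    ‖x‖ ^ (p - 2) = ‖x‖ ^ p * (‖x‖ ^ 2)⁻¹ := by
  rw [sub_eq_add_neg, Real.rpow_add (norm_pos_iff.2 hx), norm_rpow_neg_two]

lemma le_barrier_energy {w : ℝ} (hδ : 0 ≤ δ) (hαβ : α ≤ β) (hκ : κ = 2 * (δ + β - α)) {t : ℝ}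
    (hw : w ≤ μ) (hfar : T ≤ t → w ≤ μ - δ * (δ + β - α)) :
    w ≤ μ - logisticSlope δ κ T t * (logisticSlope δ κ T t + β - α) + logisticSlope' δ κ T t := by
  have h0 := logisticSlope_nonneg (κ := κ) (T := T) hδ t
  have h1 := logisticSlope_le (κ := κ) (T := T) hδ t
  have hκ0 : 0 ≤ κ := by linarith
  rcases le_total t T with ht | ht
  · have h2 := logisticSlope_mul_le_logisticSlope' (T := T) hδ hκ0 ht
    have h3 : logisticSlope δ κ T t * (logisticSlope δ κ T t + β - α) ≤
        logisticSlope δ κ T t * (κ / 2) := mul_le_mul_of_nonneg_left (by linarith) h0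
    linarith
  · have h2 := logisticSlope'_nonneg (T := T) hδ hκ0 t
    have h3 : logisticSlope δ κ T t * (logisticSlope δ κ T t + β - α) ≤ δ * (δ + β - α) :=
      mul_le_mul h1 (by linarith) (by linarith) hδ
    linarith [hfar ht]

lemma neg_lap_profile (hκ : 0 < κ) (hs : α + β = 2 - N) (hp : α * β = μ) {x : Euc N}
    (hx : x ≠ 0) :
    -lap (rad (profile α δ κ T)) x = rad (profile α δ κ T) x * (μ -
      logisticSlope δ κ T (Real.log ‖x‖) * (logisticSlope δ κ T (Real.log ‖x‖) + β - α) +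
      logisticSlope' δ κ T (Real.log ‖x‖)) * (‖x‖ ^ 2)⁻¹ := by
  rw [lap_rad hx (hasDerivAt_profile hκ) (hasDerivAt_profile_mul_logisticSlope hκ _),
    rad_of_ne _ hx, show (N : ℝ) - 2 = -(α + β) by linarith, ← hp]
  ring

lemma profile_eq_pot (hN : 3 ≤ N) (hα : α < 0) (hα' : 2 - N < α) (hδ : 0 ≤ δ) (hκ : 0 < κ)
    {x : Euc N} (hx : x ≠ 0) :
    rad (profile α δ κ T) x = pot (fun y => -lap (rad (profile α δ κ T)) y) x := by
  have hM : ∀ t, |α - logisticSlope δ κ T t| ≤ |α| + δ := fun t =>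
    (abs_sub _ _).trans (add_le_add le_rfl
      ((abs_of_nonneg (logisticSlope_nonneg hδ t)).trans_le (logisticSlope_le hδ t)))
  rw [rad_newton_repr hN (a := -α) (by linarith) (by linarith) contDiff_profile
    (hasDerivAt_profile hκ) (hasDerivAt_profile_mul_logisticSlope hκ)
    (C := 1 + (|α| + δ) + ((|α| + δ) ^ 2 + δ * κ)) (fun t => ?_) hx]
  · simp only [pot, mul_neg, integral_neg]
  · have h0 : 0 ≤ profile α δ κ T t := (profile_pos t).le
    have h1 : profile α δ κ T t ≤ Real.exp (- -α * t) := by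
      rw [neg_neg]; exact profile_le hδ hκ.le t
    have hM0 : 0 ≤ |α| + δ := by positivity
    have hD : |(α - logisticSlope δ κ T t) ^ 2 - logisticSlope' δ κ T t| ≤
        (|α| + δ) ^ 2 + δ * κ := by
      refine (abs_sub _ _).trans (add_le_add ?_ ?_)
      · rw [abs_pow]; exact pow_le_pow_left₀ (abs_nonneg _) (hM t) 2
      · rw [abs_of_nonneg (logisticSlope'_nonneg hδ hκ.le t)]
        exact logisticSlope'_le hδ hκ.le t
    have hD0 : 0 ≤ (|α| + δ) ^ 2 + δ * κ := by positivity
    rw [abs_mul, abs_mul, abs_of_nonneg h0, mul_comm (profile α δ κ T t),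
      mul_comm (profile α δ κ T t)]
    refine ⟨h1.trans (le_mul_of_one_le_left (Real.exp_pos _).le (by linarith)), ?_, ?_⟩
    · exact mul_le_mul ((hM t).trans (by linarith)) h1 h0 (by linarith)
    · exact mul_le_mul (hD.trans (by linarith)) h1 h0 (by linarith)

lemma const_mul_norm_rpow_eq_pot (hN : 3 ≤ N) {b : ℝ} (hb : 0 < b) (hb' : b < N - 2) (A : ℝ)
    {x : Euc N} (hx : x ≠ 0) :
    A * ‖x‖ ^ (-b) = pot (fun y => A * (b * (N - 2 - b)) * ‖y‖ ^ (-b - 2)) x := by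
  have hne : b * (N - 2 - b) ≠ 0 := (mul_pos hb (by linarith)).ne'
  have h := norm_rpow_repr hN hb hb' hx
  rw [pot_const_mul, pot, h, ← mul_assoc, mul_assoc A, mul_inv_cancel₀ hne, mul_one]

/-- Existence of a solution of `v = pot (μ V v)` with the singularity of `‖x‖ ^ α` at the origin
and the decay of `‖x‖ ^ (α - δ)` at infinity. -/
lemma exists_decaying_fixed_point (hN : 3 ≤ N) (hμ : 0 < μ) (hs : α + β = 2 - N)
    (hp : α * β = μ) (hβ : β < 0) (hαβ : α < β) (hδ : 0 < δ) (hT : 0 ≤ T) {c : ℝ}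
    {V : Euc N → ℝ} (hVm : AEStronglyMeasurable V) (hVpos : ∀ x, x ≠ 0 → 0 < V x)
    (hV : ∀ x, x ≠ 0 → ‖x‖ ^ (-2 : ℝ) - c ≤ V x ∧ V x ≤ ‖x‖ ^ (-2 : ℝ))
    (hfar : ∀ x, x ≠ 0 → T ≤ Real.log ‖x‖ → μ * V x * ‖x‖ ^ 2 ≤ μ - δ * (δ + β - α)) :
    ∃ (v : Euc N → ℝ) (σ A : ℝ), 0 < σ ∧ AEStronglyMeasurable v ∧ (∀ x, x ≠ 0 → 0 ≤ v x) ∧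
      (∀ x, x ≠ 0 → v x ≤ ‖x‖ ^ α) ∧ (∀ x, x ≠ 0 → |v x - ‖x‖ ^ α| ≤ A * ‖x‖ ^ (α + σ)) ∧
      (∀ x, x ≠ 0 → v x = pot (fun y => μ * V y * v y) x) ∧
      ∀ x, x ≠ 0 → v x ≤ Real.exp (δ * T) * ‖x‖ ^ (α - δ) := by
  obtain ⟨κ, hκ⟩ : ∃ κ, κ = 2 * (δ + β - α) := ⟨_, rfl⟩
  obtain ⟨σ, hσ⟩ : ∃ σ, σ = min ((β - α) / 2) 1 := ⟨_, rfl⟩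
  have hκ0 : 0 < κ := by linarith
  have hσ0 : 0 < σ := by rw [hσ]; exact lt_min (by linarith) one_pos
  have hσ1 : σ ≤ 1 := hσ ▸ min_le_right _ _
  have hσ2 : σ ≤ (β - α) / 2 := hσ ▸ min_le_left _ _
  have hσκ : σ ≤ κ := by linarith
  have hgap : 0 < σ * (β - α - σ) := mul_pos hσ0 (by linarith)
  obtain ⟨b, hb⟩ : ∃ b, b = -(α + σ) := ⟨_, rfl⟩
  have hb0 : 0 < b := by linarith
  have hb' : b < N - 2 := by linarith
  have hbN : b * (N - 2 - b) = μ + σ * (β - α - σ) := by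
    rw [hb, show (N : ℝ) = 2 - (α + β) by linarith, ← hp]; ring
  set C := μ * max 1 c + δ * κ with hC
  have hC0 : 0 ≤ C := by positivity
  set A := C / (σ * (β - α - σ)) with hA
  have hA0 : 0 ≤ A := by positivity
  have hAC : A * (σ * (β - α - σ)) = C := div_mul_cancel₀ _ hgap.ne'
  set Ψ : Euc N → ℝ := rad (profile α δ κ T) with hΨ
  have hΨr : ∀ x, x ≠ 0 → Ψ x = profile α δ κ T (Real.log ‖x‖) := fun x hx => rad_of_ne _ hx
  have hΨ0 : ∀ x, x ≠ 0 → 0 ≤ Ψ x := fun x hx => by rw [hΨr x hx]; exact (profile_pos _).le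
  have hΨb : ∀ x, x ≠ 0 → Ψ x ≤ ‖x‖ ^ α := fun x hx => by
    rw [hΨr x hx, ← exp_log_norm hx]; exact profile_le hδ.le hκ0.le _
  have hΨm : Measurable Ψ := measurable_rad contDiff_profile.continuous.measurable
  have hW0 : ∀ x, x ≠ 0 → 0 ≤ μ * V x := fun x hx => mul_nonneg hμ.le (hVpos x hx).le
  have hWb : ∀ x, x ≠ 0 → μ * V x ≤ μ * ‖x‖ ^ (-2 : ℝ) := fun x hx =>
    mul_le_mul_of_nonneg_left (hV x hx).2 hμ.le
  have hWm : AEStronglyMeasurable fun x => μ * V x := hVm.const_mul μ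
  have hw : ∀ x : Euc N, x ≠ 0 → μ * V x = μ * V x * ‖x‖ ^ 2 * (‖x‖ ^ 2)⁻¹ := fun x hx => by
    have := norm_pos_iff.2 hx
    field_simp
  have hwμ : ∀ x : Euc N, x ≠ 0 → μ * V x * ‖x‖ ^ 2 ≤ μ := fun x hx => by
    have hpos := norm_pos_iff.2 hx
    have := mul_le_mul_of_nonneg_right (hWb x hx) (sq_nonneg ‖x‖)
    rwa [norm_rpow_neg_two, mul_assoc μ (_⁻¹), inv_mul_cancel₀ (by positivity), mul_one] at this
  set E : Euc N → ℝ := fun x => μ - logisticSlope δ κ T (Real.log ‖x‖) *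
    (logisticSlope δ κ T (Real.log ‖x‖) + β - α) + logisticSlope' δ κ T (Real.log ‖x‖) with hE
  have hF : ∀ x, x ≠ 0 → -lap Ψ x = Ψ x * E x * (‖x‖ ^ 2)⁻¹ := fun x hx =>
    neg_lap_profile hκ0 hs hp hx
  have hEw : ∀ x, x ≠ 0 → μ * V x * ‖x‖ ^ 2 ≤ E x := fun x hx =>
    le_barrier_energy hδ.le hαβ.le hκ (hwμ x hx) (hfar x hx)
  have hq : ∀ x : Euc N, E x ≤ μ + logisticSlope' δ κ T (Real.log ‖x‖) := fun x => by
    have h0 := logisticSlope_nonneg (κ := κ) (T := T) hδ.le (Real.log ‖x‖)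
    have := mul_nonneg h0 (show 0 ≤ logisticSlope δ κ T (Real.log ‖x‖) + β - α by linarith)
    simp only [hE]; linarith
  have hE0 : ∀ x, x ≠ 0 → 0 ≤ E x := fun x hx =>
    (mul_nonneg (hW0 x hx) (sq_nonneg _)).trans (hEw x hx)
  have hEμ : ∀ x : Euc N, E x ≤ μ + δ * κ := fun x =>
    (hq x).trans (add_le_add le_rfl (logisticSlope'_le hδ.le hκ0.le _))
  have hEσ : ∀ x : Euc N, x ≠ 0 → E x - μ * V x * ‖x‖ ^ 2 ≤ C * ‖x‖ ^ σ := fun x hx => by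
    have hpos := norm_pos_iff.2 hx
    have h1 : logisticSlope' δ κ T (Real.log ‖x‖) ≤ δ * κ * ‖x‖ ^ σ := by
      rw [← exp_log_norm hx]; exact logisticSlope'_le_exp hδ.le hσ0.le hσκ hT _
    have h2 : μ - μ * V x * ‖x‖ ^ 2 ≤ μ * max 1 c * ‖x‖ ^ σ := by
      rcases le_total ‖x‖ 1 with h | h
      · have h3 := mul_le_mul_of_nonneg_right (hV x hx).1 (sq_nonneg ‖x‖)
        rw [norm_rpow_neg_two, sub_mul, inv_mul_cancel₀ (by positivity)] at h3
        have h4 : ‖x‖ ^ 2 ≤ ‖x‖ ^ σ := by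
          rw [← Real.rpow_natCast]
          exact Real.rpow_le_rpow_of_exponent_ge hpos h (by push_cast; linarith)
        have h5 : c * ‖x‖ ^ 2 ≤ max 1 c * ‖x‖ ^ σ :=
          mul_le_mul (le_max_right _ _) h4 (sq_nonneg _) (by positivity)
        have h6 := mul_le_mul_of_nonneg_left (show 1 - V x * ‖x‖ ^ 2 ≤ max 1 c * ‖x‖ ^ σ by
          linarith) hμ.le
        linarith
      · have h3 := mul_nonneg (hW0 x hx) (sq_nonneg ‖x‖)
        have h4 : 1 ≤ max 1 c * ‖x‖ ^ σ := one_le_mul_of_one_le_of_one_le (le_max_left _ _)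
          (Real.one_le_rpow h hσ0.le)
        have h6 := mul_le_mul_of_nonneg_left h4 hμ.le
        linarith
    have := hq x
    rw [hC, add_mul]; linarith
  have hsplit : ∀ (p : ℝ) (x : Euc N), x ≠ 0 → ‖x‖ ^ (p - 2) = ‖x‖ ^ p * (‖x‖ ^ 2)⁻¹ :=
    fun p x hx => norm_rpow_sub_two p hx
  have iF : ∀ x, x ≠ 0 → Integrable fun y => ‖x - y‖ ^ (2 - (N : ℝ)) * -lap Ψ y := fun x hx => by
    refine pot_integrable hN (a := -α) (C := μ + δ * κ) (by linarith) (by linarith)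
      (measurable_lap Ψ).neg.aestronglyMeasurable (fun y hy => ?_) hx
    rw [Pi.neg_apply, hF y hy, hsplit _ y hy, neg_neg, abs_of_nonneg (mul_nonneg (mul_nonneg (hΨ0 y hy) (hE0 y hy))
      (by positivity)), ← mul_assoc, mul_comm (Ψ y)]
    exact mul_le_mul_of_nonneg_right (mul_le_mul (hEμ y) (hΨb y hy) (hΨ0 y hy) (by positivity))
      (by positivity)
  have iΨ : ∀ x, x ≠ 0 → Integrable fun y => ‖x - y‖ ^ (2 - (N : ℝ)) * (μ * V y * Ψ y) :=
    fun x hx => by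
    refine pot_integrable hN (a := -α) (C := μ) (by linarith) (by linarith)
      (hWm.mul hΨm.aestronglyMeasurable) (fun y hy => ?_) hx
    rw [Pi.mul_apply, abs_of_nonneg (mul_nonneg (hW0 y hy) (hΨ0 y hy)), hsplit _ y hy, neg_neg]
    calc μ * V y * Ψ y ≤ μ * ‖y‖ ^ (-2 : ℝ) * ‖y‖ ^ α :=
          mul_le_mul (hWb y hy) (hΨb y hy) (hΨ0 y hy) (by positivity)
      _ = _ := by rw [norm_rpow_neg_two]; ring
  set Z : Euc N → ℝ := fun x => A * ‖x‖ ^ (-b) with hZ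
  have hZm : AEStronglyMeasurable Z :=
    ((measurable_norm.pow_const _).const_mul A).aestronglyMeasurable
  have hZ0 : ∀ x, 0 ≤ Z x := fun x => by positivity
  have iG : ∀ x : Euc N, x ≠ 0 → Integrable fun y =>
      ‖x - y‖ ^ (2 - (N : ℝ)) * (A * (b * (N - 2 - b)) * ‖y‖ ^ (-b - 2)) := fun x hx => by
    refine pot_integrable hN (C := A * (b * (N - 2 - b))) hb0 hb'
      ((measurable_norm.pow_const _).const_mul _).aestronglyMeasurable (fun y hy => ?_) hx
    rw [abs_of_nonneg]
    rw [hbN]; positivity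
  have iZ : ∀ x, x ≠ 0 → Integrable fun y => ‖x - y‖ ^ (2 - (N : ℝ)) * (μ * V y * Z y) :=
    fun x hx => by
    refine pot_integrable hN (C := μ * A) hb0 hb' (hWm.mul hZm) (fun y hy => ?_) hx
    rw [Pi.mul_apply, abs_of_nonneg (mul_nonneg (hW0 y hy) (hZ0 y)), hsplit _ y hy]
    calc μ * V y * Z y ≤ μ * ‖y‖ ^ (-2 : ℝ) * Z y :=
          mul_le_mul_of_nonneg_right (hWb y hy) (hZ0 y)
      _ = _ := by simp only [hZ]; rw [norm_rpow_neg_two]; ring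
  have hdef : ∀ y, y ≠ 0 → -lap Ψ y - μ * V y * Ψ y ≤
      A * (b * (N - 2 - b)) * ‖y‖ ^ (-b - 2) - μ * V y * Z y := fun y hy => by
    have hpos := norm_pos_iff.2 hy
    have h1 : -lap Ψ y - μ * V y * Ψ y ≤ C * ‖y‖ ^ (-b) * (‖y‖ ^ 2)⁻¹ := by
      rw [hF y hy, hw y hy]
      calc Ψ y * E y * (‖y‖ ^ 2)⁻¹ - μ * V y * ‖y‖ ^ 2 * (‖y‖ ^ 2)⁻¹ * Ψ y
          = Ψ y * (E y - μ * V y * ‖y‖ ^ 2) * (‖y‖ ^ 2)⁻¹ := by ring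
        _ ≤ ‖y‖ ^ α * (C * ‖y‖ ^ σ) * (‖y‖ ^ 2)⁻¹ :=
            mul_le_mul_of_nonneg_right (mul_le_mul (hΨb y hy) (hEσ y hy)
              (sub_nonneg.2 (hEw y hy)) (by positivity)) (by positivity)
        _ = _ := by rw [hb, neg_neg, Real.rpow_add hpos]; ring
    have h2 : μ * V y * Z y ≤ μ * (‖y‖ ^ 2)⁻¹ * Z y := by
      rw [← norm_rpow_neg_two]
      exact mul_le_mul_of_nonneg_right (hWb y hy) (hZ0 y)
    rw [hsplit _ y hy, hbN]
    have h3 : A * (μ + σ * (β - α - σ)) * (‖y‖ ^ (-b) * (‖y‖ ^ 2)⁻¹) =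
        μ * (‖y‖ ^ 2)⁻¹ * Z y + C * ‖y‖ ^ (-b) * (‖y‖ ^ 2)⁻¹ := by
      simp only [hZ]; rw [← hAC]; ring
    linarith
  have hΨpot : ∀ x, x ≠ 0 → Ψ x = pot (fun y => -lap Ψ y) x := fun x hx =>
    profile_eq_pot hN (by linarith) (by linarith) hδ.le hκ0 hx
  obtain ⟨v, hvm, hv0, hvΨ, hvZ, hfix⟩ := exists_fixed_point hN (a := -α) (by linarith)
    (by linarith) hb0 hb' (W := fun x => μ * V x) hWm hΨm.aestronglyMeasurable hZm hW0 hWb hΨ0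
    (fun x hx => by rw [neg_neg]; exact hΨb x hx) (fun x _ => hZ0 x) (fun x _ => le_rfl)
    (fun x hx => by
      rw [hΨpot x hx]
      refine pot_mono hN ?_ (iF x hx) fun y hy => ?_
      · exact iΨ x hx
      · rw [hF y hy, hw y hy, mul_right_comm _ _ (Ψ y), mul_comm _ (Ψ y)]
        exact mul_le_mul_of_nonneg_right (mul_le_mul_of_nonneg_left (hEw y hy) (hΨ0 y hy))
          (by positivity))
    (fun x hx => by
      have h := pot_mono hN (f := fun y => -lap Ψ y - μ * V y * Ψ y)
        (g := fun y => A * (b * (N - 2 - b)) * ‖y‖ ^ (-b - 2) - μ * V y * Z y) (x := x)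
        (by simp only [mul_sub _ (-lap Ψ _)]; exact (iF x hx).sub (iΨ x hx))
        (by simp only [mul_sub (_ ^ (2 - (N : ℝ)))]; exact (iG x hx).sub (iZ x hx)) hdef
      rw [pot_sub (iF x hx) (iΨ x hx), pot_sub (iG x hx) (iZ x hx), ← hΨpot x hx,
        ← const_mul_norm_rpow_eq_pot hN hb0 hb' A hx] at h
      simp only [hZ] at h ⊢
      linarith)
  refine ⟨v, σ, 1 + δ / κ + A, hσ0, hvm, hv0, fun x hx => (hvΨ x hx).trans (hΨb x hx),
    fun x hx => ?_, hfix, fun x hx => (hvΨ x hx).trans ?_⟩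
  · rw [abs_sub_comm, abs_of_nonneg (sub_nonneg.2 ((hvΨ x hx).trans (hΨb x hx)))]
    have h1 : ‖x‖ ^ α - Ψ x ≤ (1 + δ / κ) * ‖x‖ ^ (α + σ) := by
      rw [hΨr x hx, ← exp_log_norm hx, ← exp_log_norm hx]
      exact exp_sub_profile_le hδ.le hσ0.le hσκ hT _
    have h2 := hvZ x hx
    simp only [hZ, hb, neg_neg] at h2
    rw [add_mul]; linarith
  · rw [hΨr x hx, ← exp_log_norm hx]
    exact profile_le_far hδ.le hκ0 _

end barrier

lemma pos_of_fixed_point (hN : 3 ≤ N) {μ a A σ : ℝ} (hμ : 0 < μ) (ha : 0 < a) (ha' : a < N - 2)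
    (hσ : 0 < σ) {V v : Euc N → ℝ} (hVm : AEStronglyMeasurable V)
    (hVpos : ∀ x, x ≠ 0 → 0 < V x) (hVb : ∀ x, x ≠ 0 → V x ≤ ‖x‖ ^ (-2 : ℝ))
    (hvm : AEStronglyMeasurable v) (hv0 : ∀ x, x ≠ 0 → 0 ≤ v x)
    (hvb : ∀ x, x ≠ 0 → v x ≤ ‖x‖ ^ (-a))
    (hvs : ∀ x, x ≠ 0 → |v x - ‖x‖ ^ (-a)| ≤ A * ‖x‖ ^ (-a + σ))
    (hfix : ∀ x, x ≠ 0 → v x = pot (fun y => μ * V y * v y) x) :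
    ∀ x, x ≠ 0 → 0 < v x := by
  intro x hx
  have hW : ∀ y, y ≠ 0 → 0 < μ * V y := fun y hy => mul_pos hμ (hVpos y hy)
  obtain ⟨r, hr, hsmall⟩ : ∃ r > 0, ∀ t, 0 < t → t < r → A * t ^ σ < 1 := by
    have h : Tendsto (fun t : ℝ => A * t ^ σ) (nhds 0) (nhds 0) := by
      have := ((Real.continuous_rpow_const hσ.le).tendsto 0).const_mul A
      rwa [Real.zero_rpow hσ.ne', mul_zero] at this
    obtain ⟨r, hr, h⟩ := Metric.eventually_nhds_iff.1 (h.eventually (gt_mem_nhds one_pos))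
    exact ⟨r, hr, fun t ht htr => h (by rwa [Real.dist_eq, sub_zero, abs_of_pos ht])⟩
  rw [hfix x hx]
  refine pot_pos hN hr ?_ (fun y hy => mul_nonneg (hW y hy).le (hv0 y hy)) fun y hy hyr => ?_
  · refine pot_integrable hN ha ha' (C := μ) ((hVm.const_mul μ).mul hvm) (fun y hy => ?_) hx
    rw [Pi.mul_apply, abs_of_nonneg (mul_nonneg (hW y hy).le (hv0 y hy)),
      norm_rpow_sub_two _ hy, ← norm_rpow_neg_two, mul_comm (‖y‖ ^ (-a)), ← mul_assoc]
    exact mul_le_mul (mul_le_mul_of_nonneg_left (hVb y hy) hμ.le) (hvb y hy) (hv0 y hy)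
      (by positivity)
  · have hp := norm_pos_iff.2 hy
    refine mul_pos (hW y hy) ?_
    have h1 := neg_le_of_abs_le (hvs y hy)
    rw [Real.rpow_add hp] at h1
    have h2 := mul_lt_mul_of_pos_left (hsmall _ hp hyr) (Real.rpow_pos_of_pos hp (-a))
    linarith

end

/-- Theorem 4.1 (i): decay of the minimal fundamental solution when
lim_{|x|→∞} V(x)|x|² = ν ∈ (0,1). -/
theorem minimal_solution_decay_nu
    (N : ℕ) (hN : 3 ≤ N) (μ : ℝ) (hμ : 0 < μ) (hμ0 : μ < mu0 N)
    (γ : ℝ) (hγ : 0 < γ ∧ γ < 1) (V : Euc N → ℝ)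
    (hVreg : LocHolderOn γ {x : Euc N | x ≠ 0} V)
    (hVpos : ∀ x : Euc N, x ≠ 0 → 0 < V x)
    (c₅ : ℝ) (hc₅ : 0 < c₅)
    (hV : ∀ x : Euc N, x ≠ 0 → ‖x‖ ^ (-2 : ℝ) - c₅ ≤ V x ∧ V x ≤ ‖x‖ ^ (-2 : ℝ))
    (ν : ℝ) (hν0 : 0 < ν) (hν1 : ν < 1)
    (hVinf : Tendsto (fun x : Euc N => V x * ‖x‖ ^ 2) (normAtTop N) (nhds ν))
    (k : ℝ) (hk : 0 < k) (u : Euc N → ℝ)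
    (hupos : ∀ x : Euc N, x ≠ 0 → 0 < u x)
    (husol : IsSolution N μ V u)
    (huid : DistribIdentity N μ V u k)
    (humin : ∀ v : Euc N → ℝ, (∀ x : Euc N, x ≠ 0 → 0 < v x) → IsSolution N μ V v →
      DistribIdentity N μ V v k → ∀ x : Euc N, x ≠ 0 → u x ≤ v x) :
    ∀ μ' : ℝ, ν * μ < μ' → μ' < μ → ∃ c₆ : ℝ, 0 < c₆ ∧
      ∀ x : Euc N, 1 ≤ ‖x‖ → u x ≤ c₆ * ‖x‖ ^ tauMinus N μ' := by
  intro μ' hμ'1 hμ'2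
  have hN' : (3 : ℝ) ≤ N := by exact_mod_cast hN
  set s := √(mu0 N - μ) with hs
  set s' := √(mu0 N - μ') with hs'
  have hss : s ^ 2 = mu0 N - μ := Real.sq_sqrt (by linarith)
  have hss' : s' ^ 2 = mu0 N - μ' := Real.sq_sqrt (by linarith)
  have hs0 : 0 < s := Real.sqrt_pos.2 (by linarith)
  have hlt : s < s' := Real.sqrt_lt_sqrt (by linarith) (by linarith)
  have hμ0' : mu0 N = (N - 2) ^ 2 / 4 := rfl
  have hα : tauMinus N μ = -(N - 2) / 2 - s := rfl
  have hα' : tauMinus N μ' = -(N - 2) / 2 - s' := rfl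
  have hβ : tauPlus N μ = -(N - 2) / 2 + s := rfl
  have hsN : s < (N - 2) / 2 := by
    refine lt_of_pow_lt_pow_left₀ 2 (by linarith) ?_
    rw [hss, hμ0']; linarith
  have hVc : ∀ x, x ≠ 0 → ContinuousAt V x := fun x hx => hVreg.continuousAt hγ.1 hx
  have hVm := aestronglyMeasurable_of_continuousAt (by omega) hVc
  have hVb : ∀ x, x ≠ 0 → |V x| ≤ ‖x‖ ^ (-2 : ℝ) := fun x hx => by
    rw [abs_of_pos (hVpos x hx)]; exact (hV x hx).2
  obtain ⟨R, hR⟩ : ∃ R : ℝ, ∀ x : Euc N, R ≤ ‖x‖ → μ * V x * ‖x‖ ^ 2 ≤ μ' := by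
    have h := (hVinf.const_mul μ).eventually (gt_mem_nhds (show μ * ν < μ' by linarith))
    obtain ⟨R, hR⟩ := (eventually_comap.1 h).exists_forall_of_atTop
    exact ⟨R, fun x hx => by linarith [hR _ hx x rfl]⟩
  obtain ⟨v, σ, A, hσ, hvm, hv0, hvb, hvs, hfix, hdec⟩ := exists_decaying_fixed_point hN
    (α := tauMinus N μ) (β := tauPlus N μ) (δ := s' - s) (T := Real.log (max 1 R)) (c := c₅) hμ
    (tauMinus_add_tauPlus N μ) (by rw [hα, hβ]; linear_combination -hss - hμ0') (by linarith)
    (by linarith) (by linarith) (Real.log_nonneg (le_max_left _ _)) hVm hVpos hV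
    (fun x hx hT => by
      have hx' : max 1 R ≤ ‖x‖ := (Real.log_le_log_iff (by positivity) (norm_pos_iff.2 hx)).1 hT
      refine (hR x ((le_max_right _ _).trans hx')).trans (le_of_eq ?_)
      rw [hα, hβ]; linear_combination hss' - hss)
  obtain ⟨a, ha⟩ : ∃ a, a = -tauMinus N μ := ⟨_, rfl⟩
  have ha' : tauMinus N μ = -a := by rw [ha, neg_neg]
  rw [ha'] at hvb hvs
  have ha0 : 0 < a := by linarith
  have haN : a < N - 2 := by linarith
  have hvabs : ∀ x, x ≠ 0 → |v x| ≤ ‖x‖ ^ (-a) := fun x hx => by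
    rw [abs_of_nonneg (hv0 x hx)]; exact hvb x hx
  have hvpos : ∀ x, x ≠ 0 → 0 < v x := pos_of_fixed_point hN hμ ha0 haN hσ hVm hVpos
    (fun x hx => (hV x hx).2) hvm hv0 hvb hvs hfix
  have hsol : IsSolution N μ V fun x => k * v x :=
    isSolution_of_fixed_point hN ha0 haN hγ.1 hγ.2.le hVreg hVb (C := k) (hvm.const_mul k)
      (fun x hx => by
        rw [abs_mul, abs_of_pos hk]
        exact mul_le_mul_of_nonneg_left (hvabs x hx) hk.le)
      (fun x hx => by
        rw [hfix x hx, ← pot_const_mul]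
        congr 1; ext y; ring)
  have hid : DistribIdentity N μ V (fun x => k * v x) k :=
    distribIdentity_of_fixed_point hN hμ0 ha0 haN ha'.symm hσ hVm hVb (c := c₅) (fun x hx => by
      rw [abs_le]; constructor <;> linarith [hV x hx]) hvm hvabs hvs hfix k
  refine ⟨k * Real.exp ((s' - s) * Real.log (max 1 R)), by positivity, fun x hx => ?_⟩
  have hx0 : x ≠ 0 := by rintro rfl; norm_num at hx
  refine (humin _ (fun y hy => mul_pos hk (hvpos y hy)) hsol hid x hx0).trans ?_
  rw [mul_assoc]
  refine mul_le_mul_of_nonneg_left ?_ hk.le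
  have h := hdec x hx0
  rwa [show tauMinus N μ - (s' - s) = tauMinus N μ' by rw [hα, hα']; ring] at h
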